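/- arXiv:0710.0267 — 5 statements merged into one kernel-verified Lean document; each statement's English description precedes it below -/
import Mathlib

section
/- Let A be a formally real Baer von Neumann regular poring. For x ∈ A set P(x) = {α ∈ Sper A : x ∈ α ∖ supp(α)}. Then A does not have a unique real closure * if and only if there exists x ∈ A such that the interior (taken in Spec A with the Zariski topology) of supp(P(x)) ∩ supp(P(−x)) is nonempty. -/
universe u

/-- A partial ordering (positive cone) of a commutative ring: closed under addition and
multiplication, contains all squares, and intersects its negative only in `0`. -/
def IsPartialOrdering {A : Type*} [CommRing A] (P : Set A) : Prop :=
  (∀ a ∈ P, ∀ b ∈ P, a + b ∈ P) ∧ (∀ a ∈ P, ∀ b ∈ P, a * b ∈ P) ∧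
  (∀ a : A, a ^ 2 ∈ P) ∧ (∀ a ∈ P, -a ∈ P → a = 0)

/-- A (formally) real ring: a sum of squares vanishes only if each term vanishes. -/
def IsRealRing (A : Type*) [CommRing A] : Prop :=
  ∀ (n : ℕ) (f : Fin n → A), (∑ i, f i ^ 2) = 0 → ∀ i, f i = 0

/-- A von Neumann regular commutative ring. -/
def IsVonNeumannRegular (A : Type*) [CommRing A] : Prop :=
  ∀ a : A, ∃ b : A, a = a ^ 2 * b

/-- A Baer ring: the annihilator of every subset is generated by an idempotent. -/
def IsBaerRing (A : Type*) [CommRing A] : Prop :=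
  ∀ S : Set A, ∃ e : A, e * e = e ∧ ∀ x : A, (∀ s ∈ S, x * s = 0) ↔ ∃ y : A, x = e * y

/-- An essential (ring) extension: an injective ring homomorphism such that every nonzero
ideal of the codomain meets the image of the domain nontrivially. -/
def IsEssentialExtension {A B : Type*} [CommRing A] [CommRing B] (f : A →+* B) : Prop :=
  Function.Injective f ∧ ∀ J : Ideal B, J ≠ ⊥ → ∃ a : A, f a ∈ J ∧ f a ≠ 0

/-- A real ring is real closed * if it admits no proper essential integral extension
which is again a real ring. -/
def IsRealClosedStar (B : Type u) [CommRing B] : Prop :=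
  IsRealRing B ∧ ∀ (C : Type u) [CommRing C] (f : B →+* C),
    IsRealRing C → IsEssentialExtension f → f.IsIntegral → Function.Surjective f

/-- `(B, Q)` together with the embedding `f` is a real closure * of the poring `(A, P)`:
`B` is a real closed * ring, an essential and integral extension of `A`, whose partial
ordering `Q` extends `P`. -/
structure IsRealClosureStarOf (A : Type u) [CommRing A] (P : Set A)
    (B : Type u) [CommRing B] (Q : Set B) (f : A →+* B) : Prop where
  pos_partial : IsPartialOrdering Q
  rcs : IsRealClosedStar B
  essential : IsEssentialExtension f
  integral : f.IsIntegral
  mono : ∀ a ∈ P, f a ∈ Q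

/-- Bundled real closure * of a poring `(A, P)`. -/
structure RealClosureStar (A : Type u) [CommRing A] (P : Set A) : Type (u + 1) where
  carrier : Type u
  [ring : CommRing carrier]
  pos : Set carrier
  emb : A →+* carrier
  is : IsRealClosureStarOf A P carrier pos emb

attribute [instance] RealClosureStar.ring

/-- Two real closures * of `(A, P)` are `A`-isomorphic: there is a ring isomorphism over
`A` preserving the partial orderings in both directions. -/
def RealClosureStar.AIso {A : Type u} [CommRing A] {P : Set A}
    (B C : RealClosureStar A P) : Prop :=
  ∃ e : B.carrier ≃+* C.carrier, (∀ a : A, e (B.emb a) = C.emb a) ∧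
    ∀ b : B.carrier, b ∈ B.pos ↔ e b ∈ C.pos

/-- A poring `(A, P)` has a unique real closure *: one exists, and any two are
`A`-isomorphic as porings. -/
def HasUniqueRealClosureStar (A : Type u) [CommRing A] (P : Set A) : Prop :=
  Nonempty (RealClosureStar A P) ∧ ∀ B C : RealClosureStar A P, B.AIso C

/-- A prime cone of a commutative ring. -/
structure PrimeCone (A : Type u) [CommRing A] : Type u where
  carrier : Set A
  add_mem : ∀ a ∈ carrier, ∀ b ∈ carrier, a + b ∈ carrier
  mul_mem : ∀ a ∈ carrier, ∀ b ∈ carrier, a * b ∈ carrier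
  sq_mem : ∀ a : A, a ^ 2 ∈ carrier
  mem_or_neg_mem : ∀ a : A, a ∈ carrier ∨ -a ∈ carrier
  support : Ideal A
  mem_support : ∀ a : A, a ∈ support ↔ a ∈ carrier ∧ -a ∈ carrier
  support_isPrime : support.IsPrime

/-- The real spectrum of a poring `(A, P)`: the prime cones containing `P`. -/
def RealSpectrum (A : Type u) [CommRing A] (P : Set A) : Type u :=
  {α : PrimeCone A // P ⊆ α.carrier}

/-- A real closed field: formally real, every element or its negative is a square, and
every polynomial of odd degree has a root. -/
def IsRealClosedField (F : Type u) [Field F] : Prop :=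
  IsRealRing F ∧ (∀ x : F, (∃ y : F, y ^ 2 = x) ∨ ∃ y : F, y ^ 2 = -x) ∧
    ∀ p : Polynomial F, Odd p.natDegree → ∃ x : F, Polynomial.eval x p = 0

/-- A total ordering (positive cone) of a ring. -/
def IsTotalOrderingCone {K : Type*} [CommRing K] (T : Set K) : Prop :=
  (∀ a ∈ T, ∀ b ∈ T, a + b ∈ T) ∧ (∀ a ∈ T, ∀ b ∈ T, a * b ∈ T) ∧
  (∀ x : K, x ∈ T ∨ -x ∈ T) ∧ ∀ x ∈ T, -x ∈ T → x = 0

/-- A linearly ordered field contains no square root of `-1`. -/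
instance QuadraticAlgebra.fact_sq_ne_neg_one {R : Type*} [Field R] [LinearOrder R]
    [IsStrictOrderedRing R] : Fact (∀ r : R, r ^ 2 ≠ (-1) + 0 * r) :=
  ⟨fun r h => by nlinarith [sq_nonneg r]⟩

/-- A definite diagonal form on `R ^ s` which is expressed through fewer linear forms than its
rank allows must have rank at most the number of these forms. -/
lemma card_le_of_forall_eq_zero {R : Type*} [Field R] {n : ℕ} {ι : Type*} [Fintype ι] (s : Finset (Fin n))
    (l : ι → Fin n → R)
    (h : ∀ c : Fin n → R, (∀ i ∉ s, c i = 0) → (∀ k, ∑ i, c i * l k i = 0) → c = 0) :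
    s.card ≤ Fintype.card ι := by
  classical
  let ext : (s → R) →ₗ[R] (Fin n → R) :=
    { toFun := fun c i => if hi : i ∈ s then c ⟨i, hi⟩ else 0
      map_add' := fun c d => by ext i; by_cases hi : i ∈ s <;> simp [hi]
      map_smul' := fun r c => by ext i; by_cases hi : i ∈ s <;> simp [hi] }
  let φ : (s → R) →ₗ[R] (ι → R) := (Matrix.mulVecLin (Matrix.of l)).comp ext
  have hφ : Function.Injective φ := by
    rw [injective_iff_map_eq_zero]
    intro c hc
    have h0 := h (ext c) (fun i hi => by simp [ext, hi]) (fun k => by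
      have := congrFun hc k
      simpa [φ, Matrix.mulVec, dotProduct, mul_comm] using this)
    ext i
    have := congrFun h0 i
    simpa [ext] using this
  simpa using LinearMap.finrank_le_finrank_of_injective hφ

section TraceForm

variable {K L R : Type*} [Field K] [Field L] [Algebra K L]
  [Field R] [LinearOrder R] [IsStrictOrderedRing R] [Algebra K R]

/-- Conjugation of an embedding into `R(i)`. -/
noncomputable def conjEmbedding (σ : L →ₐ[K] QuadraticAlgebra R (-1) 0) :
    L →ₐ[K] QuadraticAlgebra R (-1) 0 where
  toRingHom := (starRingEnd (QuadraticAlgebra R (-1) 0)).comp σ.toRingHom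
  commutes' x := by
    change star (σ (algebraMap K L x)) = _
    rw [σ.commutes, IsScalarTower.algebraMap_apply K R (QuadraticAlgebra R (-1) 0)]
    ext <;> simp

lemma re_conjEmbedding (σ : L →ₐ[K] QuadraticAlgebra R (-1) 0) (x : L) :
    (conjEmbedding σ x).re = (σ x).re := by
  have : conjEmbedding σ x = star (σ x) := rfl
  simp [this]

lemma im_conjEmbedding (σ : L →ₐ[K] QuadraticAlgebra R (-1) 0) (x : L) :
    (conjEmbedding σ x).im = -(σ x).im := by
  have : conjEmbedding σ x = star (σ x) := rfl
  simp [this]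

lemma conjEmbedding_conjEmbedding (σ : L →ₐ[K] QuadraticAlgebra R (-1) 0) :
    conjEmbedding (conjEmbedding σ) = σ := by
  ext x <;> simp [re_conjEmbedding, im_conjEmbedding]

/-- The trace form of `L / K`, written over `R` in an orthogonal basis, is the difference of the
sums of squares of real and imaginary parts over all embeddings into `R(i)`. -/
lemma sum_trace_mul_sq [FiniteDimensional K L] [CharZero K] [IsAlgClosed (QuadraticAlgebra R (-1) 0)] {n : ℕ}
    (v : Module.Basis (Fin n) K L) (hv : (Algebra.traceForm K L).IsOrthoᵢ v) (c : Fin n → R) :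
    ∑ i, algebraMap K R (Algebra.trace K L (v i * v i)) * c i ^ 2 =
      ∑ σ : L →ₐ[K] QuadraticAlgebra R (-1) 0,
        ((∑ i, c i * (σ (v i)).re) ^ 2 - (∑ i, c i * (σ (v i)).im) ^ 2) := by
  have key : ∀ i j, algebraMap K R (Algebra.trace K L (v i * v j)) =
      ∑ σ : L →ₐ[K] QuadraticAlgebra R (-1) 0,
        ((σ (v i)).re * (σ (v j)).re - (σ (v i)).im * (σ (v j)).im) := by
    intro i j
    have h := trace_eq_sum_embeddings (K := K) (L := L) (QuadraticAlgebra R (-1) 0)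
      (x := v i * v j)
    have h2 := congrArg (QuadraticAlgebra.reₗ (R := R) (-1) 0) h
    rw [map_sum] at h2
    rw [IsScalarTower.algebraMap_apply K R (QuadraticAlgebra R (-1) 0)] at h2
    simp only [QuadraticAlgebra.reₗ] at h2
    simp at h2
    rw [h2]
    exact Finset.sum_congr rfl fun σ _ => by ring
  have orth : ∀ i j, i ≠ j → algebraMap K R (Algebra.trace K L (v i * v j)) = 0 := by
    intro i j hij
    have := hv hij
    rw [show Algebra.trace K L (v i * v j) = 0 from this, map_zero]
  calc ∑ i, algebraMap K R (Algebra.trace K L (v i * v i)) * c i ^ 2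
      = ∑ i, ∑ j, algebraMap K R (Algebra.trace K L (v i * v j)) * (c i * c j) := by
        refine Finset.sum_congr rfl fun i _ => ?_
        rw [Finset.sum_eq_single i]
        · ring
        · intro j _ hj
          rw [orth i j hj.symm, zero_mul]
        · simp
    _ = _ := by
        simp_rw [key, Finset.sum_mul]
        rw [Finset.sum_congr rfl fun i _ => Finset.sum_comm, Finset.sum_comm]
        refine Finset.sum_congr rfl fun σ _ => ?_
        rw [sq, sq, Finset.sum_mul_sum, Finset.sum_mul_sum, ← Finset.sum_sub_distrib]
        refine Finset.sum_congr rfl fun i _ => ?_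
        rw [← Finset.sum_sub_distrib]
        exact Finset.sum_congr rfl fun j _ => by ring

variable (K L R) in
/-- The number of embeddings `L → R(i)` fixed by conjugation controls the signature of the trace
form. -/
lemma signature_bounds [FiniteDimensional K L] [CharZero K] [IsAlgClosed (QuadraticAlgebra R (-1) 0)] {n : ℕ}
    (v : Module.Basis (Fin n) K L) (hv : (Algebra.traceForm K L).IsOrthoᵢ v) :
    ∃ F : ℕ, (0 < F ↔ Nonempty (L →ₐ[K] R)) ∧
      2 * (Finset.univ.filter fun i =>
        0 < algebraMap K R (Algebra.trace K L (v i * v i))).card ≤ n + F ∧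
      2 * (Finset.univ.filter fun i =>
        algebraMap K R (Algebra.trace K L (v i * v i)) < 0).card + F ≤ n := by
  classical
  let Emb := L →ₐ[K] QuadraticAlgebra R (-1) 0
  let e : Emb ≃ Fin (Fintype.card Emb) := Fintype.equivFin Emb
  let τ : Emb → Emb := conjEmbedding
  have hτre : ∀ σ x, (τ σ x).re = (σ x).re := re_conjEmbedding
  have hτim : ∀ σ x, (τ σ x).im = -(σ x).im := im_conjEmbedding
  have hττ : ∀ σ, τ (τ σ) = σ := conjEmbedding_conjEmbedding
  let S : Finset Emb := Finset.univ.filter fun σ => e σ < e (τ σ)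
  let S' : Finset Emb := Finset.univ.filter fun σ => e (τ σ) < e σ
  let F : Finset Emb := Finset.univ.filter fun σ => τ σ = σ
  have hSS' : S.card = S'.card := by
    refine Finset.card_bij' (fun σ _ => τ σ) (fun σ _ => τ σ) ?_ ?_ ?_ ?_
    · intro σ hσ; simpa [S, S', hττ] using hσ
    · intro σ hσ; simpa [S, S', hττ] using hσ
    · intro σ _; exact hττ σ
    · intro σ _; exact hττ σ
  have htri : ∀ σ : Emb, σ ∈ S ∨ τ σ ∈ S ∨ σ ∈ F := by
    intro σ
    rcases lt_trichotomy (e σ) (e (τ σ)) with h | h | h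
    · exact .inl (by simpa [S] using h)
    · exact .inr (.inr (by simpa [F] using (e.injective h).symm))
    · exact .inr (.inl (by simpa [S, hττ] using h))
  have hcard : n = 2 * S.card + F.card := by
    have h1 : Fintype.card Emb = n := by
      rw [AlgHom.card K L, Module.finrank_eq_card_basis v, Fintype.card_fin]
    have h2 : (Finset.univ : Finset Emb) = (S ∪ S') ∪ F := by
      ext σ
      rcases lt_trichotomy (e σ) (e (τ σ)) with h | h | h
      · simp [S, h]
      · simp [F, (e.injective h).symm]
      · simp [S', h]
    have h3 : Disjoint S S' := by
      rw [Finset.disjoint_left]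
      intro σ h h'
      simp only [S, S', Finset.mem_filter, Finset.mem_univ, true_and] at h h'
      exact lt_asymm h h'
    have h4 : Disjoint (S ∪ S') F := by
      rw [Finset.disjoint_left]
      intro σ h h'
      simp only [S, S', F, Finset.mem_filter, Finset.mem_univ, true_and, Finset.mem_union] at h h'
      rw [h'] at h
      simp at h
    rw [← h1, ← Finset.card_univ, h2, Finset.card_union_of_disjoint h4,
      Finset.card_union_of_disjoint h3]
    omega
  have him : ∀ σ ∈ F, ∀ x, (σ x).im = 0 := by
    intro σ hσ x
    have h1 : τ σ = σ := by simpa [F] using hσ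
    have h2 : (τ σ x).im = -(σ x).im := im_conjEmbedding σ x
    rw [h1] at h2
    linarith
  have hsum := sum_trace_mul_sq (R := R) v hv
  have hneg : (Finset.univ.filter fun i =>
      algebraMap K R (Algebra.trace K L (v i * v i)) < 0).card ≤ Fintype.card S := by
    refine card_le_of_forall_eq_zero _ (fun σ : S => fun i => (σ.1 (v i)).im) ?_
    intro c hc hl
    have hl' : ∀ σ : Emb, ∑ i, c i * (σ (v i)).im = 0 := by
      intro σ
      rcases htri σ with h | h | h
      · exact hl ⟨σ, h⟩
      · have h1 : ∑ i, c i * (τ σ (v i)).im = 0 := hl ⟨τ σ, h⟩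
        simp_rw [hτim, mul_neg, Finset.sum_neg_distrib, neg_eq_zero] at h1
        exact h1
      · simp [him σ h]
    have h1 := hsum c
    have h2 : ∀ i, algebraMap K R (Algebra.trace K L (v i * v i)) * c i ^ 2 ≤ 0 := by
      intro i
      by_cases hi : algebraMap K R (Algebra.trace K L (v i * v i)) < 0
      · exact mul_nonpos_of_nonpos_of_nonneg hi.le (sq_nonneg _)
      · simp [hc i (by simpa using hi)]
    have h3 : ∑ i, algebraMap K R (Algebra.trace K L (v i * v i)) * c i ^ 2 = 0 := by
      refine le_antisymm (Finset.sum_nonpos fun i _ => h2 i) ?_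
      rw [h1]
      refine Finset.sum_nonneg fun σ _ => ?_
      rw [hl' σ]
      simpa using sq_nonneg _
    have h4 := (Finset.sum_eq_zero_iff_of_nonpos fun i _ => h2 i).1 h3
    ext i
    by_cases hi : algebraMap K R (Algebra.trace K L (v i * v i)) < 0
    · have := h4 i (Finset.mem_univ i)
      simpa [hi.ne] using this
    · exact hc i (by simpa using hi)
  have hpos : (Finset.univ.filter fun i =>
      0 < algebraMap K R (Algebra.trace K L (v i * v i))).card ≤
        Fintype.card (S ∪ F : Finset Emb) := by
    refine card_le_of_forall_eq_zero _
      (fun σ : (S ∪ F : Finset Emb) => fun i => (σ.1 (v i)).re) ?_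
    intro c hc hl
    have hl' : ∀ σ : Emb, ∑ i, c i * (σ (v i)).re = 0 := by
      intro σ
      rcases htri σ with h | h | h
      · exact hl ⟨σ, Finset.mem_union_left _ h⟩
      · have h1 : ∑ i, c i * (τ σ (v i)).re = 0 := hl ⟨τ σ, Finset.mem_union_left _ h⟩
        simp_rw [hτre] at h1
        exact h1
      · exact hl ⟨σ, Finset.mem_union_right _ h⟩
    have h1 := hsum c
    have h2 : ∀ i, 0 ≤ algebraMap K R (Algebra.trace K L (v i * v i)) * c i ^ 2 := by
      intro i
      by_cases hi : 0 < algebraMap K R (Algebra.trace K L (v i * v i))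
      · exact mul_nonneg hi.le (sq_nonneg _)
      · simp [hc i (by simpa using hi)]
    have h3 : ∑ i, algebraMap K R (Algebra.trace K L (v i * v i)) * c i ^ 2 = 0 := by
      refine le_antisymm ?_ (Finset.sum_nonneg fun i _ => h2 i)
      rw [h1]
      refine Finset.sum_nonpos fun σ _ => ?_
      rw [hl' σ]
      simpa using sq_nonneg _
    have h4 := (Finset.sum_eq_zero_iff_of_nonneg fun i _ => h2 i).1 h3
    ext i
    by_cases hi : 0 < algebraMap K R (Algebra.trace K L (v i * v i))
    · have := h4 i (Finset.mem_univ i)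
      simpa [hi.ne'] using this
    · exact hc i (by simpa using hi)
  rw [Fintype.card_coe] at hneg hpos
  have hU := Finset.card_union_le S F
  refine ⟨F.card, ⟨fun h => ?_, fun ⟨g⟩ => ?_⟩, by omega, by omega⟩
  · obtain ⟨σ, hσ⟩ := Finset.card_pos.1 h
    have hre : ∀ x, σ x = algebraMap R _ (σ x).re := fun x => by
      ext <;> simp [him σ hσ]
    exact ⟨{ toFun := fun x => (σ x).re
             map_one' := by simp [QuadraticAlgebra.re_one]
             map_zero' := by simp
             map_add' := fun x y => by simp
             map_mul' := fun x y => by simp [him σ hσ]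
             commutes' := fun x => by
              rw [σ.commutes, IsScalarTower.algebraMap_apply K R (QuadraticAlgebra R (-1) 0)]
              rfl }⟩
  · refine Finset.card_pos.2 ⟨(IsScalarTower.toAlgHom K R (QuadraticAlgebra R (-1) 0)).comp g, ?_⟩
    simp only [F, Finset.mem_filter, Finset.mem_univ, true_and]
    ext x
    · exact re_conjEmbedding _ _
    · refine (im_conjEmbedding _ _).trans ?_
      simp
end TraceForm

/-- An embedding of a finite extension into one real closed field yields an embedding into any
other real closed field inducing the same ordering on the base field. -/
theorem nonempty_algHom_of_finite {K L R₁ R₂ : Type*} [Field K] [Field L] [Algebra K L]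
    [FiniteDimensional K L]
    [Field R₁] [LinearOrder R₁] [IsStrictOrderedRing R₁] [Algebra K R₁]
    [IsAlgClosed (QuadraticAlgebra R₁ (-1) 0)]
    [Field R₂] [LinearOrder R₂] [IsStrictOrderedRing R₂] [Algebra K R₂]
    [IsAlgClosed (QuadraticAlgebra R₂ (-1) 0)]
    (h : ∀ x : K, 0 ≤ algebraMap K R₁ x ↔ 0 ≤ algebraMap K R₂ x) (g : L →ₐ[K] R₁) :
    Nonempty (L →ₐ[K] R₂) := by
  classical
  have : CharZero K := (algebraMap K R₁).charZero
  let _ : Invertible (2 : K) := invertibleOfNonzero two_ne_zero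
  obtain ⟨v, hv⟩ := LinearMap.BilinForm.exists_orthogonal_basis
    (B := Algebra.traceForm K L) ⟨fun x y => (Algebra.traceForm_isSymm K (S := L)).eq x y⟩
  have hd : ∀ i, Algebra.trace K L (v i * v i) ≠ 0 := fun i =>
    hv.not_isOrtho_basis_self_of_separatingLeft (traceForm_nondegenerate K L).1 i
  obtain ⟨F₁, hF₁, hp₁, hn₁⟩ := signature_bounds K L R₁ v hv
  obtain ⟨F₂, hF₂, hp₂, hn₂⟩ := signature_bounds K L R₂ v hv
  have hlt : ∀ x : K, algebraMap K R₁ x < 0 ↔ algebraMap K R₂ x < 0 := fun x => by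
    simpa using (h x).not
  simp_rw [hlt] at hn₁
  have hF : 0 < F₁ := hF₁.2 ⟨g⟩
  by_contra hcon
  have hF0 : F₂ = 0 := by
    by_contra h0
    exact hcon (hF₂.1 (Nat.pos_of_ne_zero h0))
  have hsplit : (Finset.univ.filter fun i =>
        0 < algebraMap K R₂ (Algebra.trace K L (v i * v i))).card +
      (Finset.univ.filter fun i =>
        algebraMap K R₂ (Algebra.trace K L (v i * v i)) < 0).card = Module.finrank K L := by
    rw [← Finset.card_union_of_disjoint]
    · rw [← Finset.filter_or, Finset.filter_true_of_mem, Finset.card_univ, Fintype.card_fin]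
      intro i _
      have : algebraMap K R₂ (Algebra.trace K L (v i * v i)) ≠ 0 := by simpa using hd i
      exact (lt_or_gt_of_ne this).symm
    · rw [Finset.disjoint_filter]
      intro i _ h1 h2
      exact lt_asymm h1 h2
  omega

/-- Uniqueness of real closures, in embedding form. -/
theorem nonempty_algHom_of_isAlgebraic {K L R₁ R₂ : Type*} [Field K] [Field L] [Algebra K L]
    [Algebra.IsAlgebraic K L]
    [Field R₁] [LinearOrder R₁] [IsStrictOrderedRing R₁] [Algebra K R₁]
    [IsAlgClosed (QuadraticAlgebra R₁ (-1) 0)]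
    [Field R₂] [LinearOrder R₂] [IsStrictOrderedRing R₂] [Algebra K R₂]
    [IsAlgClosed (QuadraticAlgebra R₂ (-1) 0)]
    (h : ∀ x : K, 0 ≤ algebraMap K R₁ x ↔ 0 ≤ algebraMap K R₂ x) (g : L →ₐ[K] R₁) :
    Nonempty (L →ₐ[K] R₂) := by
  refine Field.nonempty_algHom_of_exists_root fun x => ?_
  have hx : IsIntegral K x := Algebra.IsIntegral.isIntegral x
  have := IntermediateField.adjoin.finiteDimensional hx
  obtain ⟨g₂⟩ := nonempty_algHom_of_finite h (g.comp (IntermediateField.val (IntermediateField.adjoin K {x})))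
  refine ⟨g₂ (IntermediateField.AdjoinSimple.gen K x), ?_⟩
  rw [Polynomial.aeval_algHom_apply, IntermediateField.aeval_gen_minpoly, map_zero]

/-- A field with a positive cone satisfying the total order axioms is linearly ordered. -/
lemma exists_linearOrder_of_cone {R : Type*} [Field R] (T : Set R) (h0 : 0 ∈ T) (h1 : 1 ∈ T)
    (hadd : ∀ a ∈ T, ∀ b ∈ T, a + b ∈ T) (hmul : ∀ a ∈ T, ∀ b ∈ T, a * b ∈ T)
    (htot : ∀ a, a ∈ T ∨ -a ∈ T) (hanti : ∀ a ∈ T, -a ∈ T → a = 0) :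
    ∃ _ : LinearOrder R, IsStrictOrderedRing R ∧ ∀ x : R, 0 ≤ x ↔ x ∈ T := by
  classical
  let C : RingCone R :=
    { carrier := T
      zero_mem' := h0
      one_mem' := h1
      add_mem' := fun {a b} ha hb => hadd a ha b hb
      mul_mem' := fun {a b} ha hb => hmul a ha b hb
      eq_zero_of_mem_of_neg_mem' := fun {a} ha hb => hanti a ha hb }
  have : HasMemOrNegMem C := ⟨fun a => htot a⟩
  let _ : DecidablePred (· ∈ C) := fun _ => Classical.dec _
  let ord : LinearOrder R := LinearOrder.mkOfAddGroupCone C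
  have hord : IsOrderedRing R := IsOrderedRing.mkOfCone C
  refine ⟨ord, IsOrderedRing.toIsStrictOrderedRing R, fun x => ?_⟩
  have : 0 ≤ x ↔ x - 0 ∈ C := Iff.rfl
  rw [this, sub_zero]
  rfl

/-- A cone in a field which generates additively a subfield of which it contains all squares, and
which does not contain `-1`. -/
structure IsFieldCone {Ω : Type*} [Field Ω] (T : Set Ω) : Prop where
  protected zero_mem : 0 ∈ T
  protected one_mem : 1 ∈ T
  protected add_mem : ∀ a ∈ T, ∀ b ∈ T, a + b ∈ T
  protected mul_mem : ∀ a ∈ T, ∀ b ∈ T, a * b ∈ T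
  protected inv_mem : ∀ a ∈ T, a⁻¹ ∈ T
  sub_sq_mem : ∀ a ∈ T, ∀ b ∈ T, (a - b) ^ 2 ∈ T
  neg_one_notMem : -1 ∉ T

namespace IsFieldCone

variable {Ω : Type*} [Field Ω] {T : Set Ω}

lemma of_subfield {S : Subfield Ω} (hTS : T ⊆ S) (hadd : ∀ a ∈ T, ∀ b ∈ T, a + b ∈ T)
    (hmul : ∀ a ∈ T, ∀ b ∈ T, a * b ∈ T) (hsq : ∀ a ∈ S, a ^ 2 ∈ T) (h1 : -1 ∉ T) :
    IsFieldCone T where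
  zero_mem := by simpa using hsq 0 S.zero_mem
  one_mem := by simpa using hsq 1 S.one_mem
  add_mem := hadd
  mul_mem := hmul
  inv_mem a ha := by
    rcases eq_or_ne a 0 with rfl | h0
    · simpa using ha
    · have := hmul a ha _ (hsq _ (S.inv_mem (hTS ha)))
      rwa [sq, mul_inv_cancel_left₀ h0] at this
  sub_sq_mem a ha b hb := hsq _ (S.sub_mem (hTS ha) (hTS hb))
  neg_one_notMem := h1

/-- The subfield generated by a cone. -/
def subfield (hT : IsFieldCone T) : Subfield Ω where
  carrier := {x | ∃ a ∈ T, ∃ b ∈ T, x = a - b}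
  zero_mem' := ⟨0, hT.zero_mem, 0, hT.zero_mem, by simp⟩
  one_mem' := ⟨1, hT.one_mem, 0, hT.zero_mem, by simp⟩
  add_mem' := by
    rintro _ _ ⟨a, ha, b, hb, rfl⟩ ⟨c, hc, d, hd, rfl⟩
    exact ⟨a + c, hT.add_mem _ ha _ hc, b + d, hT.add_mem _ hb _ hd, by ring⟩
  neg_mem' := by
    rintro _ ⟨a, ha, b, hb, rfl⟩
    exact ⟨b, hb, a, ha, by ring⟩
  mul_mem' := by
    rintro _ _ ⟨a, ha, b, hb, rfl⟩ ⟨c, hc, d, hd, rfl⟩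
    exact ⟨a * c + b * d, hT.add_mem _ (hT.mul_mem _ ha _ hc) _ (hT.mul_mem _ hb _ hd),
      a * d + b * c, hT.add_mem _ (hT.mul_mem _ ha _ hd) _ (hT.mul_mem _ hb _ hc), by ring⟩
  inv_mem' := by
    rintro _ ⟨a, ha, b, hb, rfl⟩
    have hs := hT.inv_mem _ (hT.sub_sq_mem a ha b hb)
    refine ⟨_, hT.mul_mem a ha _ hs, _, hT.mul_mem b hb _ hs, ?_⟩
    rcases eq_or_ne (a - b) 0 with h0 | h0
    · simp [h0]
    · field_simp

lemma subset_subfield (hT : IsFieldCone T) : T ⊆ hT.subfield :=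
  fun a ha => ⟨a, ha, 0, hT.zero_mem, by simp⟩

lemma sq_mem (hT : IsFieldCone T) {x : Ω} (hx : x ∈ hT.subfield) : x ^ 2 ∈ T := by
  obtain ⟨a, ha, b, hb, rfl⟩ := hx
  exact hT.sub_sq_mem a ha b hb

lemma eq_zero_of_mem_of_neg_mem (hT : IsFieldCone T) {x : Ω} (hx : x ∈ T) (hx' : -x ∈ T) :
    x = 0 := by
  by_contra h0
  refine hT.neg_one_notMem ?_
  have := hT.mul_mem _ hx' _ (hT.inv_mem _ hx)
  rwa [neg_mul, mul_inv_cancel₀ h0] at this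

lemma two_ne_zero (hT : IsFieldCone T) : (2 : Ω) ≠ 0 := by
  intro h
  refine hT.neg_one_notMem ?_
  have : (-1 : Ω) = 1 := by linear_combination -h
  rw [this]
  exact hT.one_mem

lemma exists_maximal (hT : IsFieldCone T) :
    ∃ M, T ⊆ M ∧ Maximal (fun S : Set Ω => IsFieldCone S) M := by
  refine zorn_subset_nonempty {S | IsFieldCone S} (fun c hc hchain ⟨S₀, hS₀⟩ => ?_) T hT
  have hdir : ∀ a ∈ ⋃₀ c, ∀ b ∈ ⋃₀ c, ∃ S ∈ c, a ∈ S ∧ b ∈ S := by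
    rintro a ⟨S, hS, ha⟩ b ⟨S', hS', hb⟩
    rcases hchain.total hS hS' with h | h
    · exact ⟨S', hS', h ha, hb⟩
    · exact ⟨S, hS, ha, h hb⟩
  refine ⟨⋃₀ c, ⟨⟨S₀, hS₀, (hc hS₀).zero_mem⟩, ⟨S₀, hS₀, (hc hS₀).one_mem⟩, ?_, ?_, ?_, ?_, ?_⟩,
    fun S hS => Set.subset_sUnion_of_mem hS⟩
  · intro a ha b hb
    obtain ⟨S, hS, ha, hb⟩ := hdir a ha b hb
    exact ⟨S, hS, (hc hS).add_mem a ha b hb⟩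
  · intro a ha b hb
    obtain ⟨S, hS, ha, hb⟩ := hdir a ha b hb
    exact ⟨S, hS, (hc hS).mul_mem a ha b hb⟩
  · rintro a ⟨S, hS, ha⟩
    exact ⟨S, hS, (hc hS).inv_mem a ha⟩
  · intro a ha b hb
    obtain ⟨S, hS, ha, hb⟩ := hdir a ha b hb
    exact ⟨S, hS, (hc hS).sub_sq_mem a ha b hb⟩
  · rintro ⟨S, hS, h⟩
    exact (hc hS).neg_one_notMem h

variable (hT : Maximal (fun S : Set Ω => IsFieldCone S) T)

lemma mem_or_neg_mem_of_maximal {x : Ω} (hx : x ∈ hT.prop.subfield) : x ∈ T ∨ -x ∈ T := by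
  have hc := hT.prop
  let T' : Set Ω := {y | ∃ a ∈ T, ∃ b ∈ T, y = a + x * b}
  have hTT' : T ⊆ T' := fun a ha => ⟨a, ha, 0, hc.zero_mem, by simp⟩
  by_cases h1 : -1 ∈ T'
  · right
    obtain ⟨a, ha, b, hb, hab⟩ := h1
    have hb0 : b ≠ 0 := by
      rintro rfl
      refine hc.neg_one_notMem ?_
      simpa [hab] using ha
    have : -x = (1 + a) * b⁻¹ := by
      field_simp
      linear_combination hab
    rw [this]
    exact hc.mul_mem _ (hc.add_mem _ hc.one_mem _ ha) _ (hc.inv_mem _ hb)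
  · left
    have hT' : IsFieldCone T' := by
      refine of_subfield (S := hc.subfield) ?_ ?_ ?_ (fun a ha => hTT' (hc.sq_mem ha)) h1
      · rintro _ ⟨a, ha, b, hb, rfl⟩
        exact add_mem (hc.subset_subfield ha) (mul_mem hx (hc.subset_subfield hb))
      · rintro _ ⟨a, ha, b, hb, rfl⟩ _ ⟨c, hc', d, hd, rfl⟩
        exact ⟨a + c, hc.add_mem _ ha _ hc', b + d, hc.add_mem _ hb _ hd, by ring⟩
      · rintro _ ⟨a, ha, b, hb, rfl⟩ _ ⟨c, hc', d, hd, rfl⟩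
        exact ⟨a * c + x ^ 2 * (b * d), hc.add_mem _ (hc.mul_mem _ ha _ hc') _
          (hc.mul_mem _ (hc.sq_mem hx) _ (hc.mul_mem _ hb _ hd)),
          a * d + b * c, hc.add_mem _ (hc.mul_mem _ ha _ hd) _ (hc.mul_mem _ hb _ hc'), by ring⟩
    exact hT.le_of_ge hT' hTT' ⟨0, hc.zero_mem, 1, hc.one_mem, by simp⟩

/-- A maximal cone cannot be extended to a larger subfield. -/
lemma le_subfield_of_maximal {S : Subfield Ω} (hS : hT.prop.subfield ≤ S)
    (h1 : -1 ∉ AddSubmonoid.closure {y : Ω | ∃ t ∈ T, ∃ u ∈ S, y = t * u ^ 2}) :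
    S ≤ hT.prop.subfield := by
  have hc := hT.prop
  set T' := AddSubmonoid.closure {y : Ω | ∃ t ∈ T, ∃ u ∈ S, y = t * u ^ 2}
  have hTT' : T ⊆ T' := fun t ht =>
    AddSubmonoid.subset_closure ⟨t, ht, 1, S.one_mem, by simp⟩
  have hsq : ∀ u ∈ S, u ^ 2 ∈ T' := fun u hu =>
    AddSubmonoid.subset_closure ⟨1, hc.one_mem, u, hu, by simp⟩
  have hT' : IsFieldCone (T' : Set Ω) := by
    refine of_subfield (S := S) ?_ (fun a ha b hb => add_mem ha hb) (fun a ha b hb => ?_) hsq h1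
    · intro y hy
      induction hy using AddSubmonoid.closure_induction with
      | mem y hy =>
        obtain ⟨t, ht, u, hu, rfl⟩ := hy
        exact mul_mem (hS (hc.subset_subfield ht)) (pow_mem hu 2)
      | zero => exact S.zero_mem
      | add y z _ _ hy hz => exact add_mem hy hz
    · change a * b ∈ T'
      induction ha using AddSubmonoid.closure_induction with
      | mem y hy =>
        obtain ⟨t, ht, u, hu, rfl⟩ := hy
        induction hb using AddSubmonoid.closure_induction with
        | mem z hz =>
          obtain ⟨t', ht', u', hu', rfl⟩ := hz
          exact AddSubmonoid.subset_closure
            ⟨t * t', hc.mul_mem _ ht _ ht', u * u', mul_mem hu hu', by ring⟩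
        | zero => simp
        | add y z _ _ hy hz => rw [mul_add]; exact add_mem hy hz
      | zero => simp
      | add y z _ _ hy hz => rw [add_mul]; exact add_mem hy hz
  intro s hs
  have h2 := hc.two_ne_zero
  have h2S : (2 : Ω) ∈ S := natCast_mem S 2
  refine ⟨((s + 1) / 2) ^ 2, hT.le_of_ge hT' hTT' (hsq _ ?_),
    ((s - 1) / 2) ^ 2, hT.le_of_ge hT' hTT' (hsq _ ?_), by field_simp; ring⟩
  · exact div_mem (add_mem hs S.one_mem) h2S
  · exact div_mem (sub_mem hs S.one_mem) h2S

lemma exists_sq_eq_of_maximal [IsAlgClosed Ω] {x : Ω} (hx : x ∈ T) :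
    ∃ w ∈ hT.prop.subfield, w ^ 2 = x := by
  have hc := hT.prop
  obtain ⟨w, hw⟩ := IsAlgClosed.exists_pow_nat_eq x (n := 2) (by norm_num)
  refine ⟨w, ?_, hw⟩
  by_contra hwR
  let R := hc.subfield
  have hxR : x ∈ R := hc.subset_subfield hx
  have hinteg : IsIntegral R w := ⟨Polynomial.X ^ 2 - Polynomial.C ⟨x, hxR⟩,
    Polynomial.monic_X_pow_sub_C _ (by norm_num), by simp [hw]; exact sub_self _⟩
  have hform : ∀ y ∈ IntermediateField.adjoin R {w}, ∃ u ∈ R, ∃ v ∈ R, y = u + v * w := by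
    intro y hy
    rw [← IntermediateField.mem_toSubalgebra,
      IntermediateField.adjoin_simple_toSubalgebra_of_isAlgebraic hinteg.isAlgebraic] at hy
    induction hy using Algebra.adjoin_induction with
    | mem y hy =>
      exact ⟨0, R.zero_mem, 1, R.one_mem, by simpa using hy⟩
    | algebraMap r => exact ⟨r, r.2, 0, R.zero_mem, by simp; rfl⟩
    | add y z _ _ hy hz =>
      obtain ⟨u, hu, v, hv, rfl⟩ := hy
      obtain ⟨u', hu', v', hv', rfl⟩ := hz
      exact ⟨u + u', add_mem hu hu', v + v', add_mem hv hv', by ring⟩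
    | mul y z _ _ hy hz =>
      obtain ⟨u, hu, v, hv, rfl⟩ := hy
      obtain ⟨u', hu', v', hv', rfl⟩ := hz
      exact ⟨u * u' + v * v' * x, add_mem (mul_mem hu hu') (mul_mem (mul_mem hv hv') hxR),
        u * v' + v * u', add_mem (mul_mem hu hv') (mul_mem hv hu'), by rw [← hw]; ring⟩
  have hle : R ≤ (IntermediateField.adjoin R {w}).toSubfield := fun r hr =>
    (IntermediateField.adjoin R {w}).algebraMap_mem ⟨r, hr⟩
  refine hwR (le_subfield_of_maximal hT hle ?_ (IntermediateField.mem_adjoin_simple_self R w))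
  intro h1
  have : ∀ y ∈ AddSubmonoid.closure {y : Ω | ∃ t ∈ T, ∃ u ∈
      (IntermediateField.adjoin R {w}).toSubfield, y = t * u ^ 2},
      ∃ a ∈ T, ∃ b ∈ R, y = a + b * w := by
    intro y hy
    induction hy using AddSubmonoid.closure_induction with
    | mem y hy =>
      obtain ⟨t, ht, s, hs, rfl⟩ := hy
      obtain ⟨u, hu, v, hv, rfl⟩ := hform s hs
      refine ⟨t * (u ^ 2 + v ^ 2 * x), hc.mul_mem _ ht _ (hc.add_mem _ (hc.sq_mem hu) _
        (hc.mul_mem _ (hc.sq_mem hv) _ hx)), 2 * t * u * v, ?_, by rw [← hw]; ring⟩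
      have h2R : (2 : Ω) ∈ R := natCast_mem R 2
      exact mul_mem (mul_mem (mul_mem h2R (hc.subset_subfield ht)) hu) hv
    | zero => exact ⟨0, hc.zero_mem, 0, R.zero_mem, by simp⟩
    | add y z _ _ hy hz =>
      obtain ⟨u, hu, v, hv, rfl⟩ := hy
      obtain ⟨u', hu', v', hv', rfl⟩ := hz
      exact ⟨u + u', hc.add_mem _ hu _ hu', v + v', add_mem hv hv', by ring⟩
  obtain ⟨a, ha, b, hb, hab⟩ := this _ h1
  rcases eq_or_ne b 0 with rfl | hb0
  · refine hc.neg_one_notMem ?_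
    simpa [hab] using ha
  · refine hwR ?_
    have : w = (-1 - a) / b := by
      field_simp
      linear_combination -hab
    rw [this]
    exact div_mem (sub_mem (neg_mem R.one_mem) (hc.subset_subfield ha)) hb

lemma eq_bot_of_maximal [IsAlgClosed Ω] (S : IntermediateField hT.prop.subfield Ω)
    (hS : ¬ IsSumSq (-1 : S)) : S = ⊥ := by
  have hc := hT.prop
  rw [eq_bot_iff]
  intro s hs
  have hle : hc.subfield ≤ S.toSubfield := fun r hr => S.algebraMap_mem ⟨r, hr⟩
  have := le_subfield_of_maximal hT hle ?_ hs
  · exact IntermediateField.mem_bot.2 ⟨⟨s, this⟩, rfl⟩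
  intro h1
  have key : ∀ y ∈ AddSubmonoid.closure {y : Ω | ∃ t ∈ T, ∃ u ∈ S.toSubfield, y = t * u ^ 2},
      ∃ z : S, IsSumSq z ∧ (z : Ω) = y := by
    intro y hy
    induction hy using AddSubmonoid.closure_induction with
    | mem y hy =>
      obtain ⟨t, ht, u, hu, rfl⟩ := hy
      obtain ⟨w, hw, rfl⟩ := exists_sq_eq_of_maximal hT ht
      refine ⟨⟨w, hle hw⟩ * ⟨u, hu⟩ * (⟨w, hle hw⟩ * ⟨u, hu⟩), IsSumSq.mul_self _, ?_⟩
      simp only [MulMemClass.coe_mul]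
      ring
    | zero => exact ⟨0, .zero, rfl⟩
    | add y z _ _ hy hz =>
      obtain ⟨a, ha, rfl⟩ := hy
      obtain ⟨b, hb, rfl⟩ := hz
      exact ⟨a + b, ha.add hb, rfl⟩
  obtain ⟨z, hz, hz1⟩ := key _ h1
  refine hS ?_
  convert hz
  exact Subtype.ext hz1.symm

end IsFieldCone

section Springer

open Polynomial

lemma IsSumSq.even_natDegree_and_leadingCoeff_pos {R : Type*} [Field R] [LinearOrder R]
    [IsStrictOrderedRing R] {s : R[X]} (hs : IsSumSq s) :
    s ≠ 0 → Even s.natDegree ∧ 0 < s.leadingCoeff := by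
  induction hs with
  | zero => simp
  | sq_add a t ih =>
    rename_i s
    intro h0
    rcases eq_or_ne a 0 with rfl | ha
    · simp only [mul_zero, zero_add] at h0 ⊢
      exact ih h0
    have ha2 : Even (a * a).natDegree ∧ 0 < (a * a).leadingCoeff := by
      rw [natDegree_mul ha ha, leadingCoeff_mul]
      exact ⟨⟨_, rfl⟩, mul_self_pos.2 (leadingCoeff_ne_zero.2 ha)⟩
    rcases eq_or_ne s 0 with rfl | hs0
    · simpa using ha2
    have hs2 := ih hs0
    rcases lt_trichotomy (a * a).degree s.degree with h | h | h
    · rw [leadingCoeff_add_of_degree_lt h, natDegree_add_eq_right_of_degree_lt h]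
      exact hs2
    · have hpos := add_pos ha2.2 hs2.2
      rw [leadingCoeff_add_of_degree_eq h hpos.ne']
      refine ⟨?_, hpos⟩
      have : (a * a + s).natDegree = s.natDegree := by
        apply natDegree_eq_of_degree_eq
        rw [degree_add_eq_of_leadingCoeff_add_ne_zero hpos.ne', h, max_self]
      rw [this]
      exact hs2.1
    · rw [leadingCoeff_add_of_degree_lt' h, natDegree_add_eq_left_of_degree_lt h]
      exact ha2

lemma IsSumSq.exists_dvd_sub {R : Type*} [Field R] {h s : R[X]} (hh : 0 < h.natDegree)
    (hs : IsSumSq s) :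
    ∃ t, IsSumSq t ∧ h ∣ s - t ∧ t.natDegree ≤ 2 * (h.natDegree - 1) := by
  induction hs with
  | zero => exact ⟨0, .zero, by simp, by simp⟩
  | sq_add a t ih =>
    rename_i s
    obtain ⟨t, ht, hdvd, hdeg⟩ := ih
    refine ⟨a % h * (a % h) + t, .sq_add _ ht, ?_, ?_⟩
    · have h1 : h ∣ a - a % h := ⟨a / h, by
        linear_combination -(EuclideanDomain.div_add_mod a h)⟩
      have : a * a + s - (a % h * (a % h) + t) = (a - a % h) * (a + a % h) + (s - t) := by ring
      rw [this]
      exact dvd_add (h1.mul_right _) hdvd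
    · have h1 := natDegree_mod_lt a hh.ne'
      refine (natDegree_add_le _ _).trans (max_le (natDegree_mul_le.trans ?_) hdeg)
      omega

/-- Springer's theorem for sums of squares, in terms of polynomials. -/
lemma not_dvd_one_add_of_odd_natDegree {R : Type*} [Field R] [LinearOrder R]
    [IsStrictOrderedRing R] (h : R[X]) (hodd : Odd h.natDegree) (s : R[X]) (hs : IsSumSq s) :
    ¬ h ∣ 1 + s := by
  induction hn : h.natDegree using Nat.strong_induction_on generalizing h s with
  | _ n ih =>
    intro hdvd
    subst hn
    have hpos : 0 < h.natDegree := hodd.pos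
    obtain ⟨t, ht, hst, hdeg⟩ := hs.exists_dvd_sub hpos
    have hdvd' : h ∣ 1 + t := by
      have : 1 + t = (1 + s) - (s - t) := by ring
      rw [this]
      exact dvd_sub hdvd hst
    obtain ⟨g, hg⟩ := hdvd'
    have hne : (1 + t) ≠ 0 := by
      intro h0
      have h1 : IsSumSq (t.eval 0) := by
        clear hst hdeg hg h0
        induction ht with
        | zero => simp
        | sq_add a t ih => simpa using IsSumSq.sq_add _ ih
      have h2 := congrArg (eval 0) h0
      have h3 := h1.nonneg
      simp only [eval_add, eval_one, eval_zero] at h2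
      linarith
    have heven := (IsSumSq.add .one ht).even_natDegree_and_leadingCoeff_pos hne
    have hdeg' : (1 + t).natDegree ≤ 2 * (h.natDegree - 1) :=
      (natDegree_add_le _ _).trans (max_le (by simp) hdeg)
    have hg0 : g ≠ 0 := by rintro rfl; simp at hg; exact hne hg
    have hh0 : h ≠ 0 := by rintro rfl; simp at hpos
    have hmul : (1 + t).natDegree = h.natDegree + g.natDegree := by
      rw [hg, natDegree_mul hh0 hg0]
    have hgodd : Odd g.natDegree := by
      have h1 := heven.1
      rw [hmul] at h1
      by_contra hcon
      rw [Nat.not_odd_iff_even] at hcon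
      have := (Nat.even_add.1 h1).2 hcon
      exact (Nat.not_even_iff_odd.2 hodd) this
    exact ih g.natDegree (by omega) g hgodd t ht rfl ⟨h, by rw [hg, mul_comm]⟩

lemma not_isSumSq_neg_one_of_odd_finrank {R E : Type*} [Field R] [LinearOrder R]
    [IsStrictOrderedRing R] [Field E] [Algebra R E] [FiniteDimensional R E]
    (hodd : Odd (Module.finrank R E)) : ¬ IsSumSq (-1 : E) := by
  intro hs
  obtain ⟨α, hα⟩ := Field.exists_primitive_element R E
  have hinteg : IsIntegral R α := Algebra.IsIntegral.isIntegral α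
  have hsurj : ∀ x : E, ∃ q : R[X], aeval α q = x := fun x => by
    have : x ∈ (⊤ : IntermediateField R E) := trivial
    rw [← hα, ← IntermediateField.mem_toSubalgebra,
      IntermediateField.adjoin_simple_toSubalgebra_of_isAlgebraic hinteg.isAlgebraic,
      Algebra.adjoin_singleton_eq_range_aeval] at this
    exact this
  have hlift : ∀ e : E, IsSumSq e → ∃ s : R[X], IsSumSq s ∧ aeval α s = e := by
    intro e he
    induction he with
    | zero => exact ⟨0, .zero, by simp⟩
    | sq_add a t ih =>
      obtain ⟨s, hs, rfl⟩ := ih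
      obtain ⟨q, rfl⟩ := hsurj a
      exact ⟨q * q + s, .sq_add _ hs, by simp⟩
  obtain ⟨s, hs, hs1⟩ := hlift _ hs
  refine not_dvd_one_add_of_odd_natDegree (minpoly R α) ?_ s hs (minpoly.dvd R α (by simp [hs1]))
  rwa [← IntermediateField.adjoin.finrank hinteg, hα, IntermediateField.finrank_top']

end Springer

section FundamentalTheorem

lemma finrank_ne_two_of_forall_isSquare {C F : Type*} [Field C] [Field F] [Algebra C F]
    (h2 : (2 : C) ≠ 0) (hsq : ∀ x : C, ∃ y, y ^ 2 = x) : Module.finrank C F ≠ 2 := by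
  intro h
  have : FiniteDimensional C F := Module.finite_of_finrank_eq_succ h
  have hnot : ∃ α : F, α ∉ (algebraMap C F).range := by
    by_contra! hcon
    have hbot : (⊥ : Subalgebra C F) = ⊤ := by
      rw [eq_top_iff]
      intro x _
      exact hcon x
    have := Subalgebra.bot_eq_top_iff_finrank_eq_one.1 hbot
    omega
  obtain ⟨α, hα⟩ := hnot
  have hinteg : IsIntegral C α := Algebra.IsIntegral.isIntegral α
  have hdeg : (minpoly C α).natDegree = 2 :=
    le_antisymm (h ▸ minpoly.natDegree_le α) ((minpoly.two_le_natDegree_iff hinteg).2 hα)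
  have hmon := minpoly.monic hinteg
  have hz := minpoly.aeval C α
  rw [Polynomial.aeval_eq_sum_range, hdeg] at hz
  have hlc : (minpoly C α).coeff 2 = 1 := by
    have := hmon.leadingCoeff
    rwa [Polynomial.leadingCoeff, hdeg] at this
  simp only [Finset.sum_range_succ, Finset.sum_range_zero, hlc, Algebra.smul_def, map_one] at hz
  set b := (minpoly C α).coeff 1
  set c := (minpoly C α).coeff 0
  obtain ⟨δ, hδ⟩ := hsq (b ^ 2 - 4 * c)
  have hδ' := congrArg (algebraMap C F) hδ
  simp only [map_pow, map_sub, map_mul, map_ofNat] at hδ'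
  have hprod : (2 * α + algebraMap C F b - algebraMap C F δ) *
      (2 * α + algebraMap C F b + algebraMap C F δ) = 0 := by
    linear_combination 4 * hz - hδ'
  have h2F : (2 : F) ≠ 0 := by
    have := (map_ne_zero (algebraMap C F)).2 h2
    rwa [map_ofNat] at this
  rcases mul_eq_zero.1 hprod with h0 | h0
  · refine hα ⟨(δ - b) / 2, ?_⟩
    rw [map_div₀, map_sub, map_ofNat]
    field_simp
    linear_combination -h0
  · refine hα ⟨(-δ - b) / 2, ?_⟩
    rw [map_div₀, map_sub, map_neg, map_ofNat]
    field_simp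
    linear_combination -h0

variable {R : Type u} [Field R] [LinearOrder R] [IsStrictOrderedRing R]

lemma QuadraticAlgebra.exists_sq_eq (hsq : ∀ x : R, 0 ≤ x → ∃ y, y ^ 2 = x)
    (z : QuadraticAlgebra R (-1) 0) : ∃ y, y ^ 2 = z := by
  have hsq' : ∀ x : R, 0 ≤ x → ∃ y, 0 ≤ y ∧ y ^ 2 = x := fun x hx => by
    obtain ⟨y, hy⟩ := hsq x hx
    exact ⟨|y|, abs_nonneg y, by rw [sq_abs, hy]⟩
  obtain ⟨u, v⟩ := z
  obtain ⟨r, hr0, hr⟩ := hsq' (u ^ 2 + v ^ 2) (by positivity)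
  have hru : |u| ≤ r := abs_le_of_sq_le_sq (by nlinarith [sq_nonneg v]) hr0
  have h1 := abs_le.1 hru
  obtain ⟨a, ha0, ha⟩ := hsq' ((r + u) / 2) (by linarith)
  obtain ⟨b, hb0, hb⟩ := hsq' ((r - u) / 2) (by linarith)
  have hab : 2 * a * b = |v| := by
    rw [← abs_of_nonneg (show 0 ≤ 2 * a * b by positivity), ← sq_eq_sq_iff_abs_eq_abs]
    calc (2 * a * b) ^ 2 = 4 * (a ^ 2 * b ^ 2) := by ring
      _ = r ^ 2 - u ^ 2 := by rw [ha, hb]; ring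
      _ = v ^ 2 := by rw [hr]; ring
  rcases abs_choice v with hv | hv
  · refine ⟨⟨a, b⟩, ?_⟩
    rw [sq]
    ext
    · simp; linear_combination ha - hb
    · simp; linear_combination hab + hv
  · refine ⟨⟨a, -b⟩, ?_⟩
    rw [sq]
    ext
    · simp; linear_combination ha - hb
    · simp; linear_combination -hab - hv

lemma finrank_quadraticAlgebra_eq_one_of_isGalois (hsq : ∀ x : R, 0 ≤ x → ∃ y, y ^ 2 = x)
    (hodd : ∀ (E : Type u) [Field E] [Algebra R E] [FiniteDimensional R E],
      Odd (Module.finrank R E) → Module.finrank R E = 1)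
    (N : Type u) [Field N] [Algebra R N] [Algebra (QuadraticAlgebra R (-1) 0) N]
    [IsScalarTower R (QuadraticAlgebra R (-1) 0) N] [FiniteDimensional R N] [IsGalois R N] :
    Module.finrank (QuadraticAlgebra R (-1) 0) N = 1 := by
  have : Fact (Nat.Prime 2) := ⟨Nat.prime_two⟩
  let P : Sylow 2 (N ≃ₐ[R] N) := default
  let F := IntermediateField.fixedField (P : Subgroup (N ≃ₐ[R] N))
  have hF : Module.finrank F N = Nat.card P := IntermediateField.finrank_fixedField_eq_card _
  have hG : Nat.card (N ≃ₐ[R] N) = Module.finrank R N := IsGalois.card_aut_eq_finrank R N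
  have hmul : Module.finrank R F * Module.finrank F N = Module.finrank R N :=
    Module.finrank_mul_finrank R F N
  have hPi := (P : Subgroup (N ≃ₐ[R] N)).card_mul_index
  have hP0 : 0 < Nat.card P := Nat.card_pos
  have hind : Module.finrank R F = (P : Subgroup (N ≃ₐ[R] N)).index := by
    rw [hF, ← hG, ← hPi, mul_comm] at hmul
    exact Nat.eq_of_mul_eq_mul_left hP0 hmul
  have hodd' : Odd (Module.finrank R F) := by
    rw [hind, ← Nat.not_even_iff_odd, even_iff_two_dvd]
    exact P.not_dvd_index
  rw [hodd F hodd', one_mul, hF] at hmul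
  obtain ⟨k, hk⟩ := IsPGroup.iff_card.1 P.isPGroup'
  rw [hk] at hmul
  have htower : Module.finrank R (QuadraticAlgebra R (-1) 0) *
      Module.finrank (QuadraticAlgebra R (-1) 0) N = Module.finrank R N :=
    Module.finrank_mul_finrank R (QuadraticAlgebra R (-1) 0) N
  have hdvd : Module.finrank (QuadraticAlgebra R (-1) 0) N ∣ 2 ^ k :=
    ⟨_, by rw [hmul, ← htower, mul_comm]⟩
  obtain ⟨m, -, hm⟩ := (Nat.dvd_prime_pow Nat.prime_two).1 hdvd
  rcases m with _ | m
  · simpa using hm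
  exfalso
  have : FiniteDimensional (QuadraticAlgebra R (-1) 0) N := FiniteDimensional.right R _ N
  have : IsGalois (QuadraticAlgebra R (-1) 0) N := IsGalois.tower_top_of_isGalois R _ N
  have hG' := IsGalois.card_aut_eq_finrank (QuadraticAlgebra R (-1) 0) N
  obtain ⟨H, hH⟩ := Sylow.exists_subgroup_card_pow_prime (G := N ≃ₐ[QuadraticAlgebra R (-1) 0] N) 2
    (n := m) (by rw [hG', hm]; exact pow_dvd_pow 2 m.le_succ)
  have hF' := IntermediateField.finrank_fixedField_eq_card H
  have hmul' : Module.finrank (QuadraticAlgebra R (-1) 0) (IntermediateField.fixedField H) *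
      Module.finrank (IntermediateField.fixedField H) N = _ :=
    Module.finrank_mul_finrank (QuadraticAlgebra R (-1) 0) (IntermediateField.fixedField H) N
  rw [hF', hH, hm, pow_succ, mul_comm] at hmul'
  refine finrank_ne_two_of_forall_isSquare ?_ (QuadraticAlgebra.exists_sq_eq hsq)
    (Nat.eq_of_mul_eq_mul_left (by positivity) hmul')
  intro h
  refine two_ne_zero (α := R) ((map_eq_zero (algebraMap R (QuadraticAlgebra R (-1) 0))).1 ?_)
  rwa [map_ofNat]

/-- The fundamental theorem of algebra over a field which admits square roots of nonnegative
elements and has no proper extension of odd degree. -/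
theorem isAlgClosed_quadraticAlgebra (hsq : ∀ x : R, 0 ≤ x → ∃ y, y ^ 2 = x)
    (hodd : ∀ (E : Type u) [Field E] [Algebra R E] [FiniteDimensional R E],
      Odd (Module.finrank R E) → Module.finrank R E = 1) :
    IsAlgClosed (QuadraticAlgebra R (-1) 0) := by
  refine IsAlgClosed.of_exists_root _ fun p hp hirr => ?_
  have := Fact.mk hirr
  let E := AdjoinRoot p
  have : FiniteDimensional (QuadraticAlgebra R (-1) 0) E :=
    (AdjoinRoot.powerBasis hirr.ne_zero).finite
  have : FiniteDimensional R E := FiniteDimensional.trans R (QuadraticAlgebra R (-1) 0) E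
  let N := IntermediateField.normalClosure R E (AlgebraicClosure E)
  let _ : Algebra (QuadraticAlgebra R (-1) 0) N :=
    ((algebraMap E N).comp (algebraMap (QuadraticAlgebra R (-1) 0) E)).toAlgebra
  have : IsScalarTower (QuadraticAlgebra R (-1) 0) E N := IsScalarTower.of_algebraMap_eq' rfl
  have : IsScalarTower R (QuadraticAlgebra R (-1) 0) N := by
    refine IsScalarTower.of_algebraMap_eq fun x => ?_
    rw [IsScalarTower.algebraMap_apply R E N,
      IsScalarTower.algebraMap_apply R (QuadraticAlgebra R (-1) 0) E]
    rfl
  have h1 := finrank_quadraticAlgebra_eq_one_of_isGalois hsq hodd N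
  have h2 : Module.finrank (QuadraticAlgebra R (-1) 0) E * Module.finrank E N = _ :=
    Module.finrank_mul_finrank (QuadraticAlgebra R (-1) 0) E N
  rw [h1] at h2
  have h3 : p.natDegree = 1 := by
    have := (AdjoinRoot.powerBasis hirr.ne_zero).finrank
    rw [AdjoinRoot.powerBasis_dim] at this
    rw [← this]
    exact Nat.eq_one_of_mul_eq_one_right h2
  exact Polynomial.exists_root_of_degree_eq_one
    ((Polynomial.degree_eq_iff_natDegree_eq hirr.ne_zero).2 h3)

end FundamentalTheorem

/-- A preordering of a field which does not contain `-1` is induced by a real closed field. -/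
theorem exists_real_closed_field {K : Type u} [Field K] (T₀ : Set K)
    (hadd : ∀ a ∈ T₀, ∀ b ∈ T₀, a + b ∈ T₀) (hmul : ∀ a ∈ T₀, ∀ b ∈ T₀, a * b ∈ T₀)
    (hsq : ∀ a : K, a ^ 2 ∈ T₀) (h1 : -1 ∉ T₀) :
    ∃ (R : Type u) (_ : Field R) (_ : LinearOrder R) (_ : IsStrictOrderedRing R)
      (_ : IsAlgClosed (QuadraticAlgebra R (-1) 0)) (f : K →+* R), ∀ x ∈ T₀, 0 ≤ f x := by
  let Ω := AlgebraicClosure K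
  have hT₀ : IsFieldCone (algebraMap K Ω '' T₀) := by
    refine .of_subfield (S := (algebraMap K Ω).fieldRange) ?_ ?_ ?_ ?_ ?_
    · rintro _ ⟨x, -, rfl⟩
      exact ⟨x, rfl⟩
    · rintro _ ⟨x, hx, rfl⟩ _ ⟨y, hy, rfl⟩
      exact ⟨x + y, hadd x hx y hy, map_add _ _ _⟩
    · rintro _ ⟨x, hx, rfl⟩ _ ⟨y, hy, rfl⟩
      exact ⟨x * y, hmul x hx y hy, map_mul _ _ _⟩
    · rintro _ ⟨x, rfl⟩
      exact ⟨x ^ 2, hsq x, map_pow _ _ _⟩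
    · rintro ⟨x, hx, hx1⟩
      have : x = -1 := (algebraMap K Ω).injective (by simpa using hx1)
      exact h1 (this ▸ hx)
  obtain ⟨T, hT₀T, hT⟩ := hT₀.exists_maximal
  have hc := hT.prop
  let R := hc.subfield
  obtain ⟨ord, hord, hnonneg⟩ := exists_linearOrder_of_cone (R := R) {x | (x : Ω) ∈ T}
    hc.zero_mem hc.one_mem (fun a ha b hb => hc.add_mem _ ha _ hb)
    (fun a ha b hb => hc.mul_mem _ ha _ hb)
    (fun a => IsFieldCone.mem_or_neg_mem_of_maximal hT a.2)
    (fun a ha hb => Subtype.ext (hc.eq_zero_of_mem_of_neg_mem ha hb))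
  have hKR : ∀ x : K, algebraMap K Ω x ∈ R := fun x => by
    have h2 : (2 : K) ≠ 0 := fun h => hc.two_ne_zero (by
      rw [← map_ofNat (algebraMap K Ω), h, map_zero])
    have hx : x = ((x + 1) / 2) ^ 2 - ((x - 1) / 2) ^ 2 := by field_simp; ring
    exact ⟨_, hT₀T ⟨_, hsq ((x + 1) / 2), rfl⟩, _, hT₀T ⟨_, hsq ((x - 1) / 2), rfl⟩, by
      rw [← map_sub, ← hx]⟩
  refine ⟨R, inferInstance, ord, hord, ?_,
    (algebraMap K Ω).codRestrict R hKR, fun x hx => (hnonneg _).2 (hT₀T ⟨x, hx, rfl⟩)⟩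
  refine isAlgClosed_quadraticAlgebra (fun x hx => ?_) fun E _ _ _ hE => ?_
  · obtain ⟨w, hw, hw2⟩ := IsFieldCone.exists_sq_eq_of_maximal hT ((hnonneg x).1 hx)
    exact ⟨⟨w, hw⟩, Subtype.ext hw2⟩
  · have hns := not_isSumSq_neg_one_of_odd_finrank hE
    let g : E →ₐ[R] Ω := IsAlgClosed.lift
    let e : E ≃ₐ[R] g.fieldRange := AlgEquiv.ofInjectiveField g
    have hmap : ∀ x : g.fieldRange, IsSumSq x → IsSumSq (e.symm x) := by
      intro x hx
      induction hx with
      | zero => simp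
      | sq_add a t ih =>
        rw [map_add, map_mul]
        exact .sq_add _ ih
    have hbot := IsFieldCone.eq_bot_of_maximal hT g.fieldRange fun h => hns (by
      simpa using hmap _ h)
    rw [LinearEquiv.finrank_eq e.toLinearEquiv, hbot, IntermediateField.finrank_bot]

section RealRings

variable {E : Type*} [CommRing E]

lemma IsRealRing.eq_zero_of_sq_add_sq (hE : IsRealRing E) {x y : E} (h : x ^ 2 + y ^ 2 = 0) :
    x = 0 := by
  simpa using hE 2 ![x, y] (by simpa using h) 0

lemma IsRealRing.isReduced (hE : IsRealRing E) : IsReduced E := by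
  refine isReduced_iff_pow_one_lt 2 one_lt_two |>.2 fun x hx => ?_
  exact hE.eq_zero_of_sq_add_sq (y := 0) (by simpa using hx)

lemma IsRealRing.prod_mul_eq_zero (hE : IsRealRing E) {ι : Type*} (s : Finset ι) (x y : ι → E)
    (k : E) (h : (∏ j ∈ s, ((x j) ^ 2 + (y j) ^ 2)) * k = 0) : (∏ j ∈ s, x j) * k = 0 := by
  classical
  induction s using Finset.induction_on generalizing k with
  | empty => simpa using h
  | insert j s hj ih =>
    rw [Finset.prod_insert hj] at h ⊢
    have h1 := ih ((x j ^ 2 + y j ^ 2) * k) (by rw [← h]; ring)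
    refine hE.eq_zero_of_sq_add_sq (y := y j * (∏ i ∈ s, x i) * k) ?_
    linear_combination (∏ i ∈ s, x i) * k * h1

end RealRings

section VonNeumannRegular

variable {E : Type*} [CommRing E]

lemma IsVonNeumannRegular.exists_idempotent (hE : IsVonNeumannRegular E) (a : E) :
    ∃ b, IsIdempotentElem (a * b) ∧ a * b * a = a := by
  obtain ⟨b, hb⟩ := hE a
  refine ⟨b, ?_, by linear_combination -hb⟩
  change a * b * (a * b) = a * b
  linear_combination -b * hb

lemma IsVonNeumannRegular.isMaximal (hE : IsVonNeumannRegular E) (p : Ideal E) [p.IsPrime] :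
    p.IsMaximal := by
  refine Ideal.isMaximal_iff.2 ⟨p.one_notMem, fun J x hpJ hxp hxJ => ?_⟩
  obtain ⟨b, -, hb⟩ := hE.exists_idempotent x
  have h0 : x * (1 - x * b) ∈ p := by
    convert p.zero_mem using 1
    linear_combination -hb
  have h1 := hpJ ((Ideal.IsPrime.mem_or_mem ‹_› h0).resolve_left hxp)
  have := J.add_mem h1 (J.mul_mem_right b hxJ)
  simpa using this

lemma IsVonNeumannRegular.isReduced (hE : IsVonNeumannRegular E) : IsReduced E := by
  refine isReduced_iff_pow_one_lt 2 one_lt_two |>.2 fun x hx => ?_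
  obtain ⟨b, hb⟩ := hE x
  rw [hb, hx, zero_mul]

lemma IsVonNeumannRegular.exists_prime_notMem (hE : IsVonNeumannRegular E) {x : E} (hx : x ≠ 0) :
    ∃ p : PrimeSpectrum E, x ∉ p.asIdeal := by
  have := hE.isReduced
  by_contra! h
  have : x ∈ nilradical E := by
    rw [nilradical_eq_sInf, Ideal.mem_sInf]
    exact fun {I} hI => h ⟨I, hI⟩
  exact hx (mem_nilradical.1 this).eq_zero

/-- In a real von Neumann regular ring the element `2` is invertible. -/
lemma IsVonNeumannRegular.exists_half (hE : IsVonNeumannRegular E) (hr : IsRealRing E) :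
    ∃ b : E, 2 * b = 1 := by
  obtain ⟨b, -, hb⟩ := hE.exists_idempotent 2
  refine ⟨b, ?_⟩
  have h : (1 - 2 * b) ^ 2 + (1 - 2 * b) ^ 2 = 0 := by
    linear_combination (-1 + 2 * b) * hb
  linear_combination -(hr.eq_zero_of_sq_add_sq h)

lemma IsVonNeumannRegular.isRealRing_quotient (hE : IsVonNeumannRegular E) (hr : IsRealRing E)
    (J : Ideal E) : IsRealRing (E ⧸ J) := by
  intro n f hf
  choose x hx using fun i => Ideal.Quotient.mk_surjective (f i)
  obtain rfl : f = fun i => Ideal.Quotient.mk J (x i) := funext fun i => (hx i).symm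
  set s := ∑ i, x i ^ 2 with hs
  have hsJ : s ∈ J := by
    rw [← Ideal.Quotient.eq_zero_iff_mem, hs]
    simpa using hf
  obtain ⟨b, hid, hb⟩ := hE.exists_idempotent s
  have h0 : ∑ i, ((1 - s * b) * x i) ^ 2 = 0 := by
    simp_rw [mul_pow]
    rw [← Finset.mul_sum, ← hs]
    linear_combination (s * b - 1) * hb
  intro i
  have hi := hr n _ h0 i
  rw [Ideal.Quotient.eq_zero_iff_mem]
  have : x i = s * (b * x i) := by linear_combination hi
  rw [this]
  exact J.mul_mem_right _ hsJ

/-- Partial orderings descend to quotients of von Neumann regular rings. -/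
lemma IsPartialOrdering.map_quotient {Q : Set E} (hQ : IsPartialOrdering Q)
    (hE : IsVonNeumannRegular E) (J : Ideal E) :
    IsPartialOrdering (Ideal.Quotient.mk J '' Q) := by
  refine ⟨?_, ?_, ?_, ?_⟩
  · rintro _ ⟨a, ha, rfl⟩ _ ⟨b, hb, rfl⟩
    exact ⟨a + b, hQ.1 a ha b hb, map_add _ _ _⟩
  · rintro _ ⟨a, ha, rfl⟩ _ ⟨b, hb, rfl⟩
    exact ⟨a * b, hQ.2.1 a ha b hb, map_mul _ _ _⟩
  · intro a
    obtain ⟨a, rfl⟩ := Ideal.Quotient.mk_surjective a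
    exact ⟨a ^ 2, hQ.2.2.1 a, map_pow _ _ _⟩
  · rintro _ ⟨x, hx, rfl⟩ ⟨y, hy, hxy⟩
    have hJ : x + y ∈ J := by
      rw [← Ideal.Quotient.eq_zero_iff_mem, map_add, hxy, add_neg_cancel]
    obtain ⟨b, hid, hb⟩ := hE.exists_idempotent (x + y)
    set e := (x + y) * b with he
    have heQ : 1 - e ∈ Q := by
      have := hQ.2.2.1 (1 - e)
      rwa [sq, hid.one_sub.eq] at this
    have h0 : (1 - e) * x = 0 := by
      refine hQ.2.2.2 _ (hQ.2.1 _ heQ _ hx) ?_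
      have : -((1 - e) * x) = (1 - e) * y := by linear_combination hb
      rw [this]
      exact hQ.2.1 _ heQ _ hy
    rw [Ideal.Quotient.eq_zero_iff_mem]
    have : x = (x + y) * (b * x) := by rw [he] at h0; linear_combination h0
    rw [this]
    exact J.mul_mem_right _ hJ

/-- A reduced integral extension of a von Neumann regular ring is von Neumann regular. -/
lemma IsVonNeumannRegular.of_isIntegral {A D : Type*} [CommRing A] [CommRing D]
    (hA : IsVonNeumannRegular A) [IsReduced D] {f : A →+* D} (hf : f.IsIntegral) :
    IsVonNeumannRegular D := by
  intro d
  have key : ∀ n : ℕ, ∀ g : Polynomial A, g.Monic → g.natDegree = n → ∀ (k : ℕ) (e : A),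
      f e * d ^ k * g.eval₂ f d = 0 → d ^ 2 ∣ f e * d := by
    have hnil : ∀ (k : ℕ) (y : D), y * d ^ k = 0 → y * d = 0 := by
      intro k y hy
      have : (y * d) ^ (k + 1) = 0 := by
        rw [mul_pow, pow_succ, pow_succ d]
        linear_combination y ^ k * d * hy
      exact eq_zero_of_pow_eq_zero this
    intro n
    induction n with
    | zero =>
      intro g hg hn k e h
      rw [hg.natDegree_eq_zero.1 hn, Polynomial.eval₂_one, mul_one] at h
      rw [hnil k _ h]
      exact dvd_zero _
    | succ n ih =>
      intro g hg hn k e h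
      obtain ⟨b, hid, hb⟩ := hA.exists_idempotent (g.coeff 0)
      have hsplit : g.eval₂ f d = g.divX.eval₂ f d * d + f (g.coeff 0) := by
        conv_lhs => rw [← g.divX_mul_X_add]
        simp
      have hmon : g.divX.Monic := by
        rw [Polynomial.Monic, Polynomial.leadingCoeff, Polynomial.natDegree_divX_eq_natDegree_tsub_one,
          Polynomial.coeff_divX, Nat.sub_add_cancel (by omega)]
        exact hg
      set c := g.coeff 0
      rw [hsplit] at h
      have hbf := congrArg f hb
      simp only [map_mul] at hbf
      have h1 : d ^ 2 ∣ f (e * (1 - c * b)) * d := by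
        refine ih g.divX hmon (by rw [Polynomial.natDegree_divX_eq_natDegree_tsub_one, hn]; rfl)
          (k + 1) _ ?_
        simp only [map_mul, map_sub, map_one]
        rw [pow_succ]
        linear_combination (1 - f c * f b) * h + f e * d ^ k * hbf
      have h2 : d ^ 2 ∣ f (e * (c * b)) * d := by
        have h3 : f e * f b * (f c + g.divX.eval₂ f d * d) * d ^ k = 0 := by
          linear_combination f b * h
        have h4 := hnil k _ h3
        exact ⟨-(f e * f b * g.divX.eval₂ f d), by
          simp only [map_mul]; linear_combination h4⟩
      have := dvd_add h1 h2
      rwa [← add_mul, ← map_add, ← mul_add, sub_add_cancel, mul_one] at this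
  obtain ⟨g, hg, hgd⟩ := hf d
  have h := key _ g hg rfl 0 1 (by simp [hgd])
  simpa [dvd_def] using h

end VonNeumannRegular

section RealClosedFields

variable {R : Type*} [Field R] [LinearOrder R] [IsStrictOrderedRing R]
  [IsAlgClosed (QuadraticAlgebra R (-1) 0)]

lemma exists_sq_eq_of_nonneg {x : R} (hx : 0 ≤ x) : ∃ y, y ^ 2 = x := by
  obtain ⟨z, hz⟩ := IsAlgClosed.exists_pow_nat_eq
    (algebraMap R (QuadraticAlgebra R (-1) 0) x) (n := 2) (by norm_num)
  rw [sq] at hz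
  have hre := congrArg QuadraticAlgebra.re hz
  have him := congrArg QuadraticAlgebra.im hz
  simp at hre him
  have h0 : z.re * z.im = 0 := by linarith
  rcases mul_eq_zero.1 h0 with h | h
  · refine ⟨0, ?_⟩
    rw [h] at hre
    nlinarith [mul_self_nonneg z.im]
  · exact ⟨z.re, by rw [h] at hre; linarith⟩

open Polynomial in
/-- A monic polynomial over a real closed field has a product of sums of two squares as its
square. -/
lemma exists_sq_eq_prod {g : R[X]} (hg : g.Monic) {n : ℕ} (hn : g.natDegree = n) :
    ∃ ρ : Fin n → QuadraticAlgebra R (-1) 0,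
      (∀ j, g.eval₂ (algebraMap R (QuadraticAlgebra R (-1) 0)) (ρ j) = 0) ∧
      g ^ 2 = ∏ j, ((X - C (ρ j).re) ^ 2 + C (ρ j).im ^ 2) := by
  set m := algebraMap R (QuadraticAlgebra R (-1) 0) with hm
  have hspl := IsAlgClosed.splits (g.map m)
  have hcard := hspl.natDegree_eq_card_roots
  have hprod := hspl.eq_prod_roots_of_monic (hg.map m)
  rw [natDegree_map, hn] at hcard
  have hmem : ∀ z ∈ (g.map m).roots, g.eval₂ m z = 0 := fun z hz => by
    rw [← eval_map]
    exact (mem_roots'.1 hz).2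
  generalize (g.map m).roots = s at hcard hprod hmem
  induction s using Quotient.inductionOn with
  | h l =>
  change n = l.length at hcard
  subst hcard
  have hl : g.map m = ∏ j, (X - C (l.get j)) := by
    rw [hprod]
    simp only [Multiset.quot_mk_to_coe, Multiset.map_coe, Multiset.prod_coe]
    exact (Fin.prod_univ_fun_getElem l fun a => X - C a).symm
  have hstar : g.map m = ∏ j, (X - C (star (l.get j))) := by
    have h1 : (starRingEnd (QuadraticAlgebra R (-1) 0)).comp m = m := by
      ext x
      · change (star (m x)).re = _
        simp [hm]
      · change (star (m x)).im = _
        simp [hm]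
    have h2 := congrArg (map (starRingEnd (QuadraticAlgebra R (-1) 0))) hl
    rw [map_map, h1, Polynomial.map_prod] at h2
    rw [h2]
    refine Finset.prod_congr rfl fun j _ => ?_
    rw [Polynomial.map_sub, map_X, map_C]
    rfl
  refine ⟨l.get, fun j => hmem _ (List.get_mem l j), ?_⟩
  apply map_injective m m.injective
  rw [Polynomial.map_pow, sq]
  conv_lhs => lhs; rw [hl]
  rw [hstar, ← Finset.prod_mul_distrib, Polynomial.map_prod]
  refine Finset.prod_congr rfl fun j _ => ?_
  simp only [Polynomial.map_add, Polynomial.map_pow, Polynomial.map_sub, map_X, map_C]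
  have hadd : C (l.get j) + C (star (l.get j)) = 2 * C (m (l.get j).re) := by
    have : l.get j + star (l.get j) = 2 * m (l.get j).re := by
      rw [two_mul]
      ext <;> simp [hm]
    rw [← C_add, this, C_mul]
    rfl
  have hmul : C (l.get j) * C (star (l.get j)) =
      C (m (l.get j).re) ^ 2 + C (m (l.get j).im) ^ 2 := by
    rw [← C_mul, ← C_pow, ← C_pow, ← C_add]
    congr 1
    rw [sq, sq]
    ext <;> simp [hm]
    ring
  linear_combination -X * hadd + hmul

end RealClosedFields

/-- A ring homomorphism from `A` to a real closed field with prescribed kernel, nonnegative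
on `P`. -/
structure RealClosedPoint (A : Type u) [CommRing A] (P : Set A) (p : Ideal A) where
  /-- the underlying field -/
  carrier : Type u
  [field : Field carrier]
  [linearOrder : LinearOrder carrier]
  [isStrictOrderedRing : IsStrictOrderedRing carrier]
  [isAlgClosed : IsAlgClosed (QuadraticAlgebra carrier (-1) 0)]
  /-- the homomorphism -/
  toHom : A →+* carrier
  ker_eq : RingHom.ker toHom = p
  nonneg : ∀ a ∈ P, 0 ≤ toHom a

attribute [instance] RealClosedPoint.field RealClosedPoint.linearOrder
  RealClosedPoint.isStrictOrderedRing RealClosedPoint.isAlgClosed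

lemma RealClosedPoint.toHom_eq_zero_iff {A : Type u} [CommRing A] {P : Set A} {p : Ideal A}
    (R : RealClosedPoint A P p) {x : A} : R.toHom x = 0 ↔ x ∈ p := by
  rw [← RingHom.mem_ker, R.ker_eq]

lemma IsVonNeumannRegular.nonempty_realClosedPoint {A : Type u} [CommRing A]
    (hA : IsVonNeumannRegular A) {P : Set A} (hP : IsPartialOrdering P) (p : Ideal A)
    [p.IsPrime] : Nonempty (RealClosedPoint A P p) := by
  have := hA.isMaximal p
  let _ : Field (A ⧸ p) := Ideal.Quotient.field p
  have hQ := hP.map_quotient hA p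
  obtain ⟨R, _, _, _, _, f, hf⟩ := exists_real_closed_field (Ideal.Quotient.mk p '' P)
    hQ.1 hQ.2.1 hQ.2.2.1 fun h => by
      have h1 := hQ.2.2.2 (-1) h (by simpa using hQ.2.2.1 1)
      exact one_ne_zero (neg_eq_zero.1 h1)
  exact ⟨{  carrier := R
            toHom := f.comp (Ideal.Quotient.mk p)
            ker_eq := by
              ext x
              rw [RingHom.mem_ker, RingHom.comp_apply, map_eq_zero, Ideal.Quotient.eq_zero_iff_mem]
            nonneg := fun a ha => hf _ ⟨a, ha, rfl⟩ }⟩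

section Essential

variable {A C : Type*} [CommRing A] [CommRing C]

/-- Idempotents of an essential extension of a Baer ring come from the base. -/
lemma IsBaerRing.exists_idempotent_eq (hA : IsBaerRing A) {f : A →+* C}
    (hf : IsEssentialExtension f) {e : C} (he : IsIdempotentElem e) :
    ∃ a, IsIdempotentElem a ∧ f a = e := by
  obtain ⟨g, hg, hann⟩ := hA {a | f a * (1 - e) = 0}
  have hgI : ∀ s, f s * (1 - e) = 0 → g * s = 0 := (hann g).2 ⟨1, by rw [mul_one]⟩
  have hfg : f g * f g = f g := by rw [← map_mul, hg]
  have he' : e * e = e := he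
  have h1 : e * f g = 0 := by
    by_contra hne
    obtain ⟨a, ha, ha0⟩ := hf.2 (Ideal.span {e * f g}) (by simpa using hne)
    obtain ⟨c, hc⟩ := Ideal.mem_span_singleton.1 ha
    refine ha0 ?_
    have h2 := congrArg f (hgI a (by rw [hc]; linear_combination -f g * c * he'))
    rw [map_mul, map_zero] at h2
    rw [hc] at h2 ⊢
    linear_combination h2 - e * c * hfg
  have h2 : (1 - e) * (1 - f g) = 0 := by
    by_contra hne
    obtain ⟨a, ha, ha0⟩ := hf.2 (Ideal.span {(1 - e) * (1 - f g)}) (by simpa using hne)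
    obtain ⟨c, hc⟩ := Ideal.mem_span_singleton.1 ha
    refine ha0 ?_
    have hae : f a * e = 0 := by rw [hc]; linear_combination -(1 - f g) * c * he'
    have hag : f a * f g = 0 := by rw [hc]; linear_combination -(1 - e) * c * hfg
    obtain ⟨y, hy⟩ := (hann a).1 fun s hs => by
      apply hf.1
      rw [map_mul, map_zero]
      have : f s * (1 - e) = 0 := hs
      linear_combination f a * this + f s * hae
    rw [hy, map_mul] at hag ⊢
    linear_combination hag - f y * hfg
  refine ⟨1 - g, (show IsIdempotentElem g from hg).one_sub, ?_⟩
  rw [map_sub, map_one]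
  linear_combination h2 + h1 - 2 * h1

/-- Every injective ring homomorphism becomes essential after passing to a suitable quotient. -/
lemma exists_isEssentialExtension_mk_comp {f : A →+* C} (hf : Function.Injective f) :
    ∃ J : Ideal C, IsEssentialExtension ((Ideal.Quotient.mk J).comp f) := by
  obtain ⟨J, -, hJ⟩ := zorn_le_nonempty₀ {J : Ideal C | ∀ a, f a ∈ J → a = 0}
    (fun c hc hchain y hy => ⟨sSup c, fun a ha => by
      obtain ⟨I, hI, haI⟩ := (Submodule.mem_sSup_of_directed ⟨y, hy⟩ hchain.directedOn).1 ha
      exact hc hI a haI, fun z hz => le_sSup hz⟩) ⊥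
    (fun a ha => (map_eq_zero_iff f hf).1 (by simpa using ha))
  have hinj : Function.Injective ((Ideal.Quotient.mk J).comp f) := by
    rw [injective_iff_map_eq_zero]
    intro a ha
    exact hJ.prop a (Ideal.Quotient.eq_zero_iff_mem.1 ha)
  refine ⟨J, hinj, fun J' hJ' => ?_⟩
  by_contra! hcon
  refine hJ' ?_
  have h1 : J ≤ J'.comap (Ideal.Quotient.mk J) := fun x hx => by
    rw [Ideal.mem_comap, Ideal.Quotient.eq_zero_iff_mem.2 hx]
    exact J'.zero_mem
  have h2 := hJ.le_of_ge (fun a ha => hinj (by rw [map_zero]; exact hcon a ha)) h1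
  rw [eq_bot_iff]
  intro x hx
  obtain ⟨x, rfl⟩ := Ideal.Quotient.mk_surjective x
  exact Ideal.Quotient.eq_zero_iff_mem.2 (h2 hx)

/-- An element of a von Neumann regular ring which is annihilated by a product of linear
polynomials over a subring containing all idempotents lies in the subring. -/
lemma IsVonNeumannRegular.idempotent_mul_mem_subring (hC : IsVonNeumannRegular C) (S : Subring C)
    (hS : ∀ e, IsIdempotentElem e → e ∈ S) {ι : Type*} (s : Finset ι) (α : ι → C)
    (hα : ∀ j, α j ∈ S) (c e : C) (he : IsIdempotentElem e)
    (h : e * ∏ j ∈ s, (c - α j) = 0) : e * c ∈ S := by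
  classical
  induction s using Finset.induction_on generalizing e with
  | empty =>
    have : e = 0 := by simpa using h
    simp [this]
  | insert j s hj ih =>
    rw [Finset.prod_insert hj] at h
    obtain ⟨b, hid, hb⟩ := hC.exists_idempotent (c - α j)
    set u := (c - α j) * b with hu
    have h1 : e * u * c ∈ S := by
      refine ih _ (he.mul hid) ?_
      rw [hu]
      linear_combination b * h
    have h2 : e * c = e * u * c + e * (1 - u) * α j := by
      linear_combination -e * hb
    rw [h2]
    exact add_mem h1 (mul_mem (hS _ (he.mul hid.one_sub)) (hα j))

end Essential

section EssentialTrans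

variable {A B C : Type*} [CommRing A] [CommRing B] [CommRing C] {f : A →+* B} {g : B →+* C}

lemma IsEssentialExtension.trans (hf : IsEssentialExtension f) (hg : IsEssentialExtension g) :
    IsEssentialExtension (g.comp f) := by
  refine ⟨hg.1.comp hf.1, fun J hJ => ?_⟩
  obtain ⟨b, hb, hb0⟩ := hg.2 J hJ
  obtain ⟨a, ha, ha0⟩ := hf.2 (J.comap g) fun h => by
    have : b ∈ J.comap g := hb
    rw [h, Ideal.mem_bot] at this
    exact hb0 (by rw [this, map_zero])
  exact ⟨a, ha, fun h => ha0 (hg.1 (by rw [map_zero]; exact h))⟩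

lemma IsEssentialExtension.injective_of_comp (hf : IsEssentialExtension f)
    (h : Function.Injective (g.comp f)) : Function.Injective g := by
  rw [RingHom.injective_iff_ker_eq_bot]
  by_contra hne
  obtain ⟨a, ha, ha0⟩ := hf.2 _ hne
  exact ha0 (by rw [h (a₁ := a) (a₂ := 0) (by rw [map_zero]; exact ha), map_zero])

lemma IsEssentialExtension.of_comp (h : IsEssentialExtension (g.comp f))
    (hg : Function.Injective g) : IsEssentialExtension g := by
  refine ⟨hg, fun J hJ => ?_⟩
  obtain ⟨a, ha, ha0⟩ := h.2 J hJ
  exact ⟨f a, ha, ha0⟩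

end EssentialTrans

section ProductOfRealClosedFields

variable {A : Type u} [CommRing A] {ι : Type u} (R : ι → Type u) [∀ i, Field (R i)]
  [∀ i, LinearOrder (R i)] [∀ i, IsStrictOrderedRing (R i)] [∀ i, Algebra A (R i)]

lemma isRealRing_integralClosure_pi : IsRealRing (integralClosure A (∀ i, R i)) := by
  intro n f hf j
  apply Subtype.ext
  funext i
  have h1 := congrFun (congrArg Subtype.val hf) i
  simp only [AddSubmonoidClass.coe_finsetSum, Finset.sum_apply] at h1
  have h2 := (Finset.sum_eq_zero_iff_of_nonneg fun k _ => sq_nonneg ((f k).1 i)).1 h1 j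
    (Finset.mem_univ j)
  exact pow_eq_zero_iff two_ne_zero |>.1 h2

lemma isPartialOrdering_integralClosure_pi :
    IsPartialOrdering {x : integralClosure A (∀ i, R i) | ∀ i, 0 ≤ x.1 i} := by
  refine ⟨fun a ha b hb i => add_nonneg (ha i) (hb i), fun a ha b hb i => mul_nonneg (ha i) (hb i),
    fun a i => sq_nonneg (a.1 i), fun a ha hb => Subtype.ext (funext fun i => ?_)⟩
  exact le_antisymm (neg_nonneg.1 (hb i)) (ha i)

/-- The integral closure of `A` in a product of ordered fields has a quotient which is an
essential extension of `A`. -/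
theorem exists_essential_quotient (hA : IsVonNeumannRegular A)
    (hinj : Function.Injective (algebraMap A (∀ i, R i))) :
    ∃ (D : Type u) (_ : CommRing D) (Q : Set D) (r : integralClosure A (∀ i, R i) →+* D),
      Function.Surjective r ∧ IsPartialOrdering Q ∧ (∀ x, (∀ i, 0 ≤ x.1 i) → r x ∈ Q) ∧
      IsRealRing D ∧
      IsEssentialExtension (r.comp (algebraMap A (integralClosure A (∀ i, R i)))) ∧
      (r.comp (algebraMap A (integralClosure A (∀ i, R i)))).IsIntegral := by
  have hreal := isRealRing_integralClosure_pi (A := A) R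
  have hred := hreal.isReduced
  have hinteg : (algebraMap A (integralClosure A (∀ i, R i))).IsIntegral :=
    fun x => Algebra.IsIntegral.isIntegral x
  have hE := hA.of_isIntegral hinteg
  obtain ⟨J, hJ⟩ := exists_isEssentialExtension_mk_comp
    (f := algebraMap A (integralClosure A (∀ i, R i))) (fun x y h => hinj (congrArg Subtype.val h))
  exact ⟨_, inferInstance, _, Ideal.Quotient.mk J, Ideal.Quotient.mk_surjective,
    (isPartialOrdering_integralClosure_pi R).map_quotient hE J, fun x hx => ⟨x, hx, rfl⟩,
    hE.isRealRing_quotient hreal J, hJ,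
    hinteg.trans _ _ (RingHom.isIntegral_of_surjective _ Ideal.Quotient.mk_surjective)⟩

variable [∀ i, IsAlgClosed (QuadraticAlgebra (R i) (-1) 0)]

open Polynomial in
lemma exists_integralClosure_sq_eq_prod (hA : IsVonNeumannRegular A) (hreal : IsRealRing A)
    {g : A[X]} (hg : g.Monic) :
    ∃ α β : Fin g.natDegree → integralClosure A (∀ i, R i),
      (g.map (algebraMap A (integralClosure A (∀ i, R i)))) ^ 2 =
        ∏ j, ((X - C (α j)) ^ 2 + C (β j) ^ 2) := by
  have key := fun i => exists_sq_eq_prod (hg.map (algebraMap A (R i)))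
    (hg.natDegree_map (algebraMap A (R i)))
  choose ρ hroot hprod using key
  obtain ⟨t, ht⟩ := hA.exists_half hreal
  let Φ : A →+* ∀ i, QuadraticAlgebra (R i) (-1) 0 :=
    RingHom.pi fun i => (algebraMap (R i) _).comp (algebraMap A (R i))
  let Ψ : (∀ i, R i) →+* ∀ i, QuadraticAlgebra (R i) (-1) 0 :=
    RingHom.pi fun i => (algebraMap (R i) _).comp (Pi.evalRingHom R i)
  have hΨ : Function.Injective Ψ := fun x y h => funext fun i =>
    (algebraMap (R i) (QuadraticAlgebra (R i) (-1) 0)).injective (congrFun h i)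
  have hΨΦ : Ψ.comp (algebraMap A _) = Φ := rfl
  have hdesc : ∀ (x : ∀ i, R i) (z), Φ.IsIntegralElem z → Ψ x = z → IsIntegral A x := by
    rintro x _ ⟨p, hp, hpx⟩ rfl
    refine ⟨p, hp, hΨ ?_⟩
    rw [hom_eval₂, map_zero, hΨΦ, hpx]
  have hrt : ∀ (z : ∀ i, QuadraticAlgebra (R i) (-1) 0),
      (∀ i, (g.map (algebraMap A (R i))).eval₂ (algebraMap (R i) _) (z i) = 0) →
      Φ.IsIntegralElem z := by
    intro z hz
    refine ⟨g, hg, funext fun i => ?_⟩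
    have h1 := hom_eval₂ g Φ (Pi.evalRingHom (fun i => QuadraticAlgebra (R i) (-1) 0) i) z
    have h2 := hz i
    rw [eval₂_map] at h2
    exact h1.trans h2
  have hz1 : ∀ j, Φ.IsIntegralElem fun i => ρ i j := fun j => hrt _ fun i => hroot i j
  have hstar : ∀ i, (starRingEnd (QuadraticAlgebra (R i) (-1) 0)).comp (algebraMap (R i) _) =
      algebraMap (R i) _ := by
    intro i
    ext x
    · change (star (algebraMap (R i) (QuadraticAlgebra (R i) (-1) 0) x)).re = _
      simp
    · change (star (algebraMap (R i) (QuadraticAlgebra (R i) (-1) 0) x)).im = _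
      simp
  have hz2 : ∀ j, Φ.IsIntegralElem fun i => star (ρ i j) := fun j => hrt _ fun i => by
    have h1 := congrArg (starRingEnd _) (hroot i j)
    rw [hom_eval₂, hstar, map_zero] at h1
    exact h1
  have hI : Φ.IsIntegralElem fun i => (⟨0, 1⟩ : QuadraticAlgebra (R i) (-1) 0) := by
    refine ⟨X ^ 2 + 1, by monicity!, ?_⟩
    simp only [eval₂_add, eval₂_pow, eval₂_X, eval₂_one]
    funext i
    change (⟨0, 1⟩ : QuadraticAlgebra (R i) (-1) 0) ^ 2 + 1 = 0
    ext
    · simp [sq]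
      exact neg_add_cancel (1 : R i)
    · simp [sq]
      rfl
  have ht2 : ∀ i, 2 * algebraMap A (R i) t = 1 := fun i => by
    rw [← map_one (algebraMap A (R i)), ← ht, map_mul, map_ofNat]
  have hre : ∀ j, IsIntegral A fun i => (ρ i j).re := fun j => by
    refine hdesc _ _ ((Φ.isIntegralElem_map (x := t)).mul Φ ((hz1 j).add Φ (hz2 j))) ?_
    funext i
    ext
    · simp [Φ, Ψ]
      linear_combination -(ρ i j).re * ht2 i
    · simp [Φ, Ψ]
  have him : ∀ j, IsIntegral A fun i => (ρ i j).im := fun j => by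
    refine hdesc _ _
      (((Φ.isIntegralElem_map (x := t)).mul Φ ((hz2 j).sub Φ (hz1 j))).mul Φ hI) ?_
    funext i
    ext
    · simp [Φ, Ψ]
      linear_combination -(ρ i j).im * ht2 i
    · simp [Φ, Ψ]
  refine ⟨fun j => ⟨_, hre j⟩, fun j => ⟨_, him j⟩, ?_⟩
  have hev : ∀ i, ∃ ev : integralClosure A (∀ i, R i) →+* R i, ∀ x, ev x = x.1 i := fun i =>
    ⟨(Pi.evalRingHom R i).comp (integralClosure A (∀ i, R i)).val.toRingHom, fun x => rfl⟩
  choose ev hev using hev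
  ext k i
  rw [← hev, ← hev, ← coeff_map, ← coeff_map]
  congr 1
  have h1 : (ev i).comp (algebraMap A _) = algebraMap A (R i) := by
    ext x
    rw [RingHom.comp_apply, hev]
    rfl
  rw [Polynomial.map_pow, map_map, h1, hprod, Polynomial.map_prod]
  simp [hev]

/-- Essential quotients of the integral closure of a Baer von Neumann regular ring in a product
of real closed fields are real closed *. -/
theorem isRealClosedStar_of_integralClosure_pi (hA : IsVonNeumannRegular A) (hreal : IsRealRing A)
    (hBaer : IsBaerRing A) {D : Type u} [CommRing D] (hD : IsRealRing D)
    (r : integralClosure A (∀ i, R i) →+* D)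
    (hess : IsEssentialExtension (r.comp (algebraMap A (integralClosure A (∀ i, R i)))))
    (hinteg : (r.comp (algebraMap A (integralClosure A (∀ i, R i)))).IsIntegral) :
    IsRealClosedStar D := by
  refine ⟨hD, fun C _ f hC hf hfi c => ?_⟩
  set h := r.comp (algebraMap A (integralClosure A (∀ i, R i))) with hh
  have hess' := hess.trans hf
  have hinteg' := hinteg.trans h f hfi
  have := hC.isReduced
  have hCr := hA.of_isIntegral hinteg'
  obtain ⟨g, hg, hgc⟩ := hinteg' c
  obtain ⟨α, β, hαβ⟩ := exists_integralClosure_sq_eq_prod R hA hreal hg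
  have h1 := congrArg (Polynomial.eval₂ (f.comp r) c) hαβ
  rw [Polynomial.eval₂_pow, Polynomial.eval₂_map, RingHom.comp_assoc, ← hh, hgc,
    Polynomial.eval₂_finsetProd] at h1
  simp only [Polynomial.eval₂_add, Polynomial.eval₂_pow, Polynomial.eval₂_sub, Polynomial.eval₂_X,
    Polynomial.eval₂_C] at h1
  have h2 := hC.prod_mul_eq_zero Finset.univ (fun j => c - f.comp r (α j))
    (fun j => f.comp r (β j)) 1 (by rw [← h1]; simp)
  have h3 := hCr.idempotent_mul_mem_subring f.range (fun e he => by
    obtain ⟨a, -, ha⟩ := hBaer.exists_idempotent_eq hess' he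
    exact ⟨h a, ha⟩) Finset.univ (fun j => f.comp r (α j)) (fun j => ⟨r (α j), rfl⟩) c 1
    IsIdempotentElem.one (by rwa [mul_comm])
  rwa [one_mul] at h3

end ProductOfRealClosedFields

section RealClosures

variable {A : Type u} [CommRing A]

/-- A family of real closed points, one for every prime ideal, separates the elements of a
von Neumann regular ring. -/
lemma IsVonNeumannRegular.injective_realClosedPoint (hA : IsVonNeumannRegular A) {P : Set A}
    (R : ∀ p : PrimeSpectrum A, RealClosedPoint A P p.asIdeal) :
    Function.Injective (RingHom.pi fun p => (R p).toHom) := by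
  rw [injective_iff_map_eq_zero]
  intro x hx
  by_contra hne
  obtain ⟨p, hp⟩ := hA.exists_prime_notMem hne
  exact hp ((R p).toHom_eq_zero_iff.1 (congrFun hx p))

theorem nonempty_realClosureStar (hA : IsVonNeumannRegular A) (hreal : IsRealRing A)
    (hBaer : IsBaerRing A) {P : Set A} (hP : IsPartialOrdering P) :
    Nonempty (RealClosureStar A P) := by
  have R : ∀ p : PrimeSpectrum A, RealClosedPoint A P p.asIdeal := fun p =>
    (hA.nonempty_realClosedPoint hP p.asIdeal).some
  let _ : ∀ p : PrimeSpectrum A, Algebra A (R p).carrier := fun p => (R p).toHom.toAlgebra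
  obtain ⟨D, _, Q, r, -, hQ, hpos, hD, hess, hinteg⟩ :=
    exists_essential_quotient (fun p => (R p).carrier) hA (hA.injective_realClosedPoint R)
  exact ⟨{  carrier := D
            pos := Q
            emb := r.comp (algebraMap A _)
            is :=
            { pos_partial := hQ
              rcs := isRealClosedStar_of_integralClosure_pi _ hA hreal hBaer hD r hess hinteg
              essential := hess
              integral := hinteg
              mono := fun a ha => hpos _ fun p => (R p).nonneg a ha } }⟩

/-- In a real closed * von Neumann regular ring every element is a difference of two orthogonal
squares. -/
theorem IsRealClosedStar.exists_eq_sq_sub_sq (hA : IsRealClosedStar A)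
    (hvnr : IsVonNeumannRegular A) {P : Set A} (hP : IsPartialOrdering P) (x : A) :
    ∃ s t, x = s ^ 2 - t ^ 2 ∧ s * t = 0 := by
  have R : ∀ p : PrimeSpectrum A, RealClosedPoint A P p.asIdeal := fun p =>
    (hvnr.nonempty_realClosedPoint hP p.asIdeal).some
  let _ : ∀ p : PrimeSpectrum A, Algebra A (R p).carrier := fun p => (R p).toHom.toAlgebra
  obtain ⟨D, _, Q, r, -, hQ, hpos, hD, hess, hinteg⟩ :=
    exists_essential_quotient (fun p => (R p).carrier) hvnr (hvnr.injective_realClosedPoint R)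
  have hsurj := hA.2 D _ hD hess hinteg
  set y : ∀ p, (R p).carrier := algebraMap A _ x with hy
  choose s hs using fun p => exists_sq_eq_of_nonneg (le_max_right (y p) 0)
  choose t ht using fun p => exists_sq_eq_of_nonneg (le_max_right (-y p) 0)
  have hcases : ∀ p, s p ^ 2 = 0 ∧ t p ^ 2 = -y p ∨ s p ^ 2 = y p ∧ t p ^ 2 = 0 := fun p => by
    rw [hs, ht]
    rcases le_total (y p) 0 with h | h
    · exact Or.inl ⟨max_eq_right h, max_eq_left (by linarith)⟩
    · exact Or.inr ⟨max_eq_left h, max_eq_right (by linarith)⟩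
  have hroot : ∀ (a : A) (z : ∀ p, (R p).carrier), z * z = algebraMap A _ a * z →
      IsIntegral A z := fun a z hz => by
    refine ⟨Polynomial.X ^ 2 - Polynomial.C a * Polynomial.X, by monicity!, ?_⟩
    simp [sq, hz]
  have hsi : IsIntegral A s := by
    refine IsIntegral.of_pow two_pos (hroot x _ (funext fun p => ?_))
    change s p ^ 2 * s p ^ 2 = y p * s p ^ 2
    rcases hcases p with h | h <;> simp [h.1]
  have hti : IsIntegral A t := by
    refine IsIntegral.of_pow two_pos (hroot (-x) _ (funext fun p => ?_))
    rw [map_neg]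
    change t p ^ 2 * t p ^ 2 = -y p * t p ^ 2
    rcases hcases p with h | h <;> simp [h.2]
  let S : integralClosure A (∀ p, (R p).carrier) := ⟨s, hsi⟩
  let T : integralClosure A (∀ p, (R p).carrier) := ⟨t, hti⟩
  obtain ⟨s', hs'⟩ := hsurj (r S)
  obtain ⟨t', ht'⟩ := hsurj (r T)
  refine ⟨s', t', hess.1 ?_, hess.1 ?_⟩
  · rw [map_sub, map_pow, map_pow, hs', ht', ← map_pow, ← map_pow, ← map_sub, RingHom.comp_apply]
    congr 1
    refine Subtype.ext (funext fun p => ?_)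
    change y p = s p ^ 2 - t p ^ 2
    rcases hcases p with h | h <;> simp [h.1, h.2]
  · rw [map_mul, hs', ht', ← map_mul, map_zero, ← map_zero r]
    congr 1
    refine Subtype.ext (funext fun p => ?_)
    change s p * t p = 0
    rcases hcases p with h | h
    · rw [pow_eq_zero_iff two_ne_zero |>.1 h.1, zero_mul]
    · rw [pow_eq_zero_iff two_ne_zero |>.1 h.2, mul_zero]

/-- The only partial ordering on a real closed * von Neumann regular ring is the set of squares. -/
theorem IsRealClosedStar.mem_iff_isSquare (hA : IsRealClosedStar A) (hvnr : IsVonNeumannRegular A)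
    {P : Set A} (hP : IsPartialOrdering P) {x : A} : x ∈ P ↔ IsSquare x := by
  constructor
  · intro hx
    obtain ⟨s, t, rfl, hst⟩ := hA.exists_eq_sq_sub_sq hvnr hP x
    have := hA.1.isReduced
    have h1 : t ^ 4 = 0 := by
      refine hP.2.2.2 _ (by
      rw [show t ^ 4 = (t ^ 2) ^ 2 by ring]
      exact hP.2.2.1 _) ?_
      convert hP.2.1 _ hx _ (hP.2.2.1 t) using 1
      linear_combination -s * t * hst
    rw [eq_zero_of_pow_eq_zero h1]
    exact ⟨s, by ring⟩
  · rintro ⟨s, rfl⟩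
    rw [← sq]
    exact hP.2.2.1 s

end RealClosures

section PositiveSupport

variable {A : Type u} [CommRing A] {P : Set A}

/-- The prime cone obtained by pulling back the nonnegative elements of an ordered field. -/
def PrimeCone.comap {R : Type*} [Field R] [LinearOrder R] [IsStrictOrderedRing R] (φ : A →+* R) :
    PrimeCone A where
  carrier := {a | 0 ≤ φ a}
  add_mem a ha b hb := by
    rw [Set.mem_ofPred_eq, map_add]
    exact add_nonneg ha hb
  mul_mem a ha b hb := by
    rw [Set.mem_ofPred_eq, map_mul]
    exact mul_nonneg ha hb
  sq_mem a := by
    rw [Set.mem_ofPred_eq, map_pow]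
    exact sq_nonneg _
  mem_or_neg_mem a := by
    rw [Set.mem_ofPred_eq, Set.mem_ofPred_eq, map_neg, neg_nonneg]
    exact le_total _ _
  support := RingHom.ker φ
  mem_support a := by
    rw [Set.mem_ofPred_eq, Set.mem_ofPred_eq, map_neg, neg_nonneg, RingHom.mem_ker]
    exact ⟨fun h => ⟨h.ge, h.le⟩, fun h => le_antisymm h.2 h.1⟩
  support_isPrime := RingHom.ker_isPrime φ

variable (P) in
/-- The supports of the points of the real spectrum at which `x` is positive. -/
def positiveSupport (x : A) : Set (PrimeSpectrum A) :=
  {p | ∃ α : RealSpectrum A P, α.1.support = p.asIdeal ∧ x ∈ α.1.carrier ∧ x ∉ α.1.support}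

lemma mem_positiveSupport {R : Type*} [Field R] [LinearOrder R] [IsStrictOrderedRing R]
    (φ : A →+* R) (hφ : ∀ a ∈ P, 0 ≤ φ a) {p : PrimeSpectrum A} (hp : RingHom.ker φ = p.asIdeal)
    {x : A} (hx : 0 ≤ φ x) (hxp : x ∉ p.asIdeal) : p ∈ positiveSupport P x :=
  ⟨⟨PrimeCone.comap φ, hφ⟩, hp, hx, fun h => hxp (hp.le h)⟩

end PositiveSupport

namespace RealClosureStar

variable {A : Type u} [CommRing A] {P : Set A}

lemma isVonNeumannRegular (B : RealClosureStar A P) (hA : IsVonNeumannRegular A) :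
    IsVonNeumannRegular B.carrier :=
  have := B.is.rcs.1.isReduced
  hA.of_isIntegral B.is.integral

lemma exists_realClosedPoint (B : RealClosureStar A P) (hA : IsVonNeumannRegular A)
    (p : PrimeSpectrum A) : ∃ (q : Ideal B.carrier) (R : RealClosedPoint B.carrier B.pos q),
      RingHom.ker (R.toHom.comp B.emb) = p.asIdeal := by
  obtain ⟨q, rfl⟩ := B.is.integral.comap_surjective B.is.essential.1 p
  obtain ⟨R⟩ := (B.isVonNeumannRegular hA).nonempty_realClosedPoint B.is.pos_partial q.asIdeal
  refine ⟨q.asIdeal, R, ?_⟩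
  rw [← RingHom.comap_ker, R.ker_eq]
  rfl

lemma mem_positiveSupport (B : RealClosureStar A P) (hA : IsVonNeumannRegular A) {x : A}
    (hx : B.emb x ∈ B.pos) {p : PrimeSpectrum A} (hxp : x ∉ p.asIdeal) :
    p ∈ positiveSupport P x := by
  obtain ⟨q, R, hR⟩ := B.exists_realClosedPoint hA p
  exact _root_.mem_positiveSupport (R.toHom.comp B.emb)
    (fun a ha => R.nonneg _ (B.is.mono a ha)) hR (R.nonneg _ hx) hxp

lemma interior_nonempty (B C : RealClosureStar A P) (hA : IsVonNeumannRegular A) {x : A}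
    (h0 : x ≠ 0) (hB : B.emb x ∈ B.pos) (hC : C.emb (-x) ∈ C.pos) :
    (interior (positiveSupport P x ∩ positiveSupport P (-x))).Nonempty := by
  obtain ⟨p, hp⟩ := hA.exists_prime_notMem h0
  refine ⟨p, mem_interior.2 ⟨PrimeSpectrum.basicOpen x, fun q hq => ?_,
    (PrimeSpectrum.basicOpen x).isOpen, hp⟩⟩
  exact ⟨B.mem_positiveSupport hA hB hq, C.mem_positiveSupport hA hC fun h => hq (by
    simpa using q.asIdeal.neg_mem h)⟩

lemma exists_idempotent (B : RealClosureStar A P) (hA : IsVonNeumannRegular A)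
    (hBaer : IsBaerRing A) (x : A) :
    ∃ e, IsIdempotentElem e ∧ B.emb (e * x) ∈ B.pos ∧ B.emb (-((1 - e) * x)) ∈ B.pos := by
  obtain ⟨s, t, hx, hst⟩ := B.is.rcs.exists_eq_sq_sub_sq (B.isVonNeumannRegular hA)
    B.is.pos_partial (B.emb x)
  obtain ⟨b, hid, hb⟩ := (B.isVonNeumannRegular hA).exists_idempotent s
  obtain ⟨e, he, hes⟩ := hBaer.exists_idempotent_eq B.is.essential hid
  refine ⟨e, he, ?_, ?_⟩
  · convert B.is.pos_partial.2.2.1 s using 1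
    rw [map_mul, hes, hx]
    linear_combination s * hb - b * t * hst
  · convert B.is.pos_partial.2.2.1 t using 1
    rw [map_neg, map_mul, map_sub, map_one, hes, hx]
    linear_combination s * hb - b * t * hst

lemma emb_mem_pos (B C : RealClosureStar A P) (hA : IsVonNeumannRegular A) (hBaer : IsBaerRing A)
    (h : ∀ x, ¬(interior (positiveSupport P x ∩ positiveSupport P (-x))).Nonempty) {x : A}
    (hx : B.emb x ∈ B.pos) : C.emb x ∈ C.pos := by
  obtain ⟨e, he, h1, h2⟩ := C.exists_idempotent hA hBaer x
  have h0 : (1 - e) * x = 0 := by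
    by_contra h0
    refine h _ (B.interior_nonempty C hA h0 ?_ h2)
    rw [map_mul]
    refine B.is.pos_partial.2.1 _ ?_ _ hx
    have := B.is.pos_partial.2.2.1 (B.emb (1 - e))
    rwa [← map_pow, sq, he.one_sub.eq] at this
  rwa [← show e * x = x by linear_combination -h0]

lemma nonneg_of_nonneg (B C : RealClosureStar A P) (hA : IsVonNeumannRegular A)
    (hBaer : IsBaerRing A) (h : ∀ x, B.emb x ∈ B.pos → C.emb x ∈ C.pos) {q₁ : Ideal B.carrier}
    {q₂ : Ideal C.carrier} (R₁ : RealClosedPoint B.carrier B.pos q₁)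
    (R₂ : RealClosedPoint C.carrier C.pos q₂)
    (hker : RingHom.ker (R₁.toHom.comp B.emb) = RingHom.ker (R₂.toHom.comp C.emb)) {x : A}
    (hx : 0 ≤ R₁.toHom.comp B.emb x) : 0 ≤ R₂.toHom.comp C.emb x := by
  obtain ⟨e, he, h1, h2⟩ := B.exists_idempotent hA hBaer x
  have h1' : 0 ≤ R₂.toHom.comp C.emb (e * x) := R₂.nonneg _ (h _ h1)
  have h2' : 0 ≤ R₁.toHom.comp B.emb (-((1 - e) * x)) := R₁.nonneg _ h2
  rw [map_mul] at h1'
  rw [map_neg, map_mul] at h2'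
  rcases IsIdempotentElem.iff_eq_zero_or_one.1 (he.map (R₁.toHom.comp B.emb)) with h0 | h0
  · rw [map_sub, map_one, h0] at h2'
    have hx0 : x ∈ RingHom.ker (R₁.toHom.comp B.emb) := le_antisymm (by linarith) hx
    rw [hker] at hx0
    exact hx0.ge
  · have he1 : 1 - e ∈ RingHom.ker (R₁.toHom.comp B.emb) := by
      rw [RingHom.mem_ker, map_sub, map_one, h0, sub_self]
    rw [hker, RingHom.mem_ker, map_sub, map_one, sub_eq_zero] at he1
    rwa [← he1, one_mul] at h1'

end RealClosureStar

section Uniqueness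

variable {A B : Type u} [CommRing A] [CommRing B]

/-- A homomorphism from a von Neumann regular ring to a real closed field extends to an integral
extension along which the induced ordering extends. -/
lemma exists_comp_eq_of_nonneg_iff (hA : IsVonNeumannRegular A) (hB : IsVonNeumannRegular B)
    {f : A →+* B} (hf : f.IsIntegral) {R₁ R₂ : Type*}
    [Field R₁] [LinearOrder R₁] [IsStrictOrderedRing R₁]
    [IsAlgClosed (QuadraticAlgebra R₁ (-1) 0)]
    [Field R₂] [LinearOrder R₂] [IsStrictOrderedRing R₂]
    [IsAlgClosed (QuadraticAlgebra R₂ (-1) 0)] (φ₁ : B →+* R₁) (φ₂ : A →+* R₂)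
    (h : ∀ x, 0 ≤ φ₁ (f x) ↔ 0 ≤ φ₂ x) : ∃ ψ : B →+* R₂, ψ.comp f = φ₂ := by
  have hker : ∀ x, φ₁ (f x) = 0 ↔ φ₂ x = 0 := fun x => by
    have h1 := h (-x)
    rw [map_neg, map_neg, map_neg, neg_nonneg, neg_nonneg] at h1
    rw [le_antisymm_iff, le_antisymm_iff, h, h1]
  have := RingHom.ker_isPrime φ₁
  have := RingHom.ker_isPrime φ₂
  have := hB.isMaximal (RingHom.ker φ₁)
  have := hA.isMaximal (RingHom.ker φ₂)
  let _ : Field (A ⧸ RingHom.ker φ₂) := Ideal.Quotient.field _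
  let _ : Field (B ⧸ RingHom.ker φ₁) := Ideal.Quotient.field _
  have hle : RingHom.ker φ₂ ≤ (RingHom.ker φ₁).comap f := fun x hx => (hker x).2 hx
  let i : A ⧸ RingHom.ker φ₂ →+* B ⧸ RingHom.ker φ₁ := Ideal.quotientMap _ f hle
  let _ : Algebra (A ⧸ RingHom.ker φ₂) (B ⧸ RingHom.ker φ₁) := i.toAlgebra
  let l₁ : B ⧸ RingHom.ker φ₁ →+* R₁ := RingHom.kerLift φ₁
  let l₂ : A ⧸ RingHom.ker φ₂ →+* R₂ := RingHom.kerLift φ₂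
  let _ : Algebra (A ⧸ RingHom.ker φ₂) R₁ := (l₁.comp i).toAlgebra
  let _ : Algebra (A ⧸ RingHom.ker φ₂) R₂ := l₂.toAlgebra
  have : Algebra.IsAlgebraic (A ⧸ RingHom.ker φ₂) (B ⧸ RingHom.ker φ₁) := by
    refine ⟨fun y => IsIntegral.isAlgebraic ?_⟩
    obtain ⟨y, rfl⟩ := Ideal.Quotient.mk_surjective y
    obtain ⟨g, hg, hgy⟩ := hf y
    refine ⟨g.map (Ideal.Quotient.mk _), hg.map _, ?_⟩
    rw [Polynomial.eval₂_map]
    have h1 := Polynomial.hom_eval₂ g f (Ideal.Quotient.mk (RingHom.ker φ₁)) y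
    rw [hgy, map_zero] at h1
    exact h1.symm
  obtain ⟨ψ⟩ := nonempty_algHom_of_isAlgebraic (K := A ⧸ RingHom.ker φ₂)
    (L := B ⧸ RingHom.ker φ₁) (R₁ := R₁) (R₂ := R₂) (fun x => by
      obtain ⟨x, rfl⟩ := Ideal.Quotient.mk_surjective x
      exact h x) ⟨l₁, fun x => rfl⟩
  refine ⟨ψ.toRingHom.comp (Ideal.Quotient.mk _), RingHom.ext fun x => ?_⟩
  exact ψ.commutes (Ideal.Quotient.mk _ x)

/-- A homomorphism of extensions of `A` from a real closed * ring to a real ring is bijective if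
both extensions are essential and the target is integral over `A`. -/
lemma IsRealClosedStar.bijective (hB : IsRealClosedStar B) {f : A →+* B}
    (hf : IsEssentialExtension f) {D : Type u} [CommRing D] (hD : IsRealRing D) {m : B →+* D}
    (hm : IsEssentialExtension (m.comp f)) (hmi : (m.comp f).IsIntegral) :
    Function.Bijective m :=
  have hinj := hf.injective_of_comp hm.1
  ⟨hinj, hB.2 D m hD (hm.of_comp hinj) (hmi.tower_top f m)⟩

lemma exists_lift_integralClosure {S : Type*} [CommRing S] [Algebra A S] {f : A →+* B}
    (hf : f.IsIntegral) (ψ : B →+* S) (h : ψ.comp f = algebraMap A S) :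
    ∃ ψ' : B →+* integralClosure A S, ψ'.comp f = algebraMap A (integralClosure A S) := by
  refine ⟨ψ.codRestrict (integralClosure A S) fun b => ?_, ?_⟩
  · obtain ⟨g, hg, hgb⟩ := hf b
    refine ⟨g, hg, ?_⟩
    rw [← h, ← Polynomial.hom_eval₂, hgb, map_zero]
  · ext x
    exact RingHom.congr_fun h x

theorem RealClosureStar.aIso_of_interior_empty {P : Set A} (hA : IsVonNeumannRegular A)
    (hBaer : IsBaerRing A)
    (h : ∀ x, ¬(interior (positiveSupport P x ∩ positiveSupport P (-x))).Nonempty)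
    (B C : RealClosureStar A P) : B.AIso C := by
  have hBr := B.isVonNeumannRegular hA
  have hCr := C.isVonNeumannRegular hA
  choose q₁ R₁ hR₁ using B.exists_realClosedPoint hA
  choose q₂ R₂ hR₂ using C.exists_realClosedPoint hA
  have hψ : ∀ p, ∃ ψ : B.carrier →+* (R₂ p).carrier, ψ.comp B.emb = (R₂ p).toHom.comp C.emb :=
    fun p => exists_comp_eq_of_nonneg_iff hA hBr B.is.integral (R₁ p).toHom _ fun x =>
      ⟨B.nonneg_of_nonneg C hA hBaer (fun _ => B.emb_mem_pos C hA hBaer h) (R₁ p) (R₂ p)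
          ((hR₁ p).trans (hR₂ p).symm),
        C.nonneg_of_nonneg B hA hBaer (fun _ => C.emb_mem_pos B hA hBaer h) (R₂ p) (R₁ p)
          ((hR₂ p).trans (hR₁ p).symm)⟩
  choose ψ hψ using hψ
  let _ : ∀ p, Algebra A (R₂ p).carrier := fun p => ((R₂ p).toHom.comp C.emb).toAlgebra
  have hinj : Function.Injective (algebraMap A (∀ p, (R₂ p).carrier)) := by
    rw [injective_iff_map_eq_zero]
    intro x hx
    by_contra hne
    obtain ⟨p, hp⟩ := hA.exists_prime_notMem hne
    exact hp (hR₂ p ▸ congrFun hx p)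
  obtain ⟨D, _, -, r, -, -, -, hD, hess, hinteg⟩ :=
    exists_essential_quotient (fun p => (R₂ p).carrier) hA hinj
  obtain ⟨m₁, hm₁⟩ := exists_lift_integralClosure (S := ∀ p, (R₂ p).carrier) B.is.integral
    (RingHom.pi ψ) (RingHom.ext fun x => funext fun p => RingHom.congr_fun (hψ p) x)
  obtain ⟨m₂, hm₂⟩ := exists_lift_integralClosure (S := ∀ p, (R₂ p).carrier) C.is.integral
    (RingHom.pi fun p => (R₂ p).toHom) rfl
  have hb₁ : Function.Bijective (r.comp m₁) := B.is.rcs.bijective B.is.essential hD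
    (by rwa [RingHom.comp_assoc, hm₁]) (by rwa [RingHom.comp_assoc, hm₁])
  have hb₂ : Function.Bijective (r.comp m₂) := C.is.rcs.bijective C.is.essential hD
    (by rwa [RingHom.comp_assoc, hm₂]) (by rwa [RingHom.comp_assoc, hm₂])
  let e : B.carrier ≃+* C.carrier :=
    (RingEquiv.ofBijective (r.comp m₁) hb₁).trans (RingEquiv.ofBijective (r.comp m₂) hb₂).symm
  refine ⟨e, fun a => ?_, fun b => ?_⟩
  · refine (RingEquiv.symm_apply_eq (RingEquiv.ofBijective (r.comp m₂) hb₂)).2 ?_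
    change r (m₁.comp B.emb a) = r (m₂.comp C.emb a)
    rw [hm₁, hm₂]
  · rw [B.is.rcs.mem_iff_isSquare hBr B.is.pos_partial,
      C.is.rcs.mem_iff_isSquare hCr C.is.pos_partial]
    exact ⟨fun h => h.map e, fun (h : IsSquare (e b)) => by simpa using h.map e.symm⟩

end Uniqueness

section Adjoin

variable {A : Type u} [CommRing A] {P : Set A}

/-- If every prime ideal supports a prime cone containing `y`, then `y` is positive in some
partial ordering. -/
lemma exists_isPartialOrdering_mem (hA : IsVonNeumannRegular A) {y : A}
    (hy : ∀ p : PrimeSpectrum A, ∃ α : RealSpectrum A P,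
      α.1.support = p.asIdeal ∧ y ∈ α.1.carrier) :
    ∃ Q, P ⊆ Q ∧ IsPartialOrdering Q ∧ y ∈ Q := by
  refine ⟨{w | ∀ α : RealSpectrum A P, y ∈ α.1.carrier → w ∈ α.1.carrier},
    fun w hw α _ => α.2 hw,
    ⟨fun a ha b hb α hα => α.1.add_mem _ (ha α hα) _ (hb α hα),
      fun a ha b hb α hα => α.1.mul_mem _ (ha α hα) _ (hb α hα),
      fun a α _ => α.1.sq_mem a, fun a ha hna => ?_⟩, fun α hα => hα⟩
  by_contra hne
  obtain ⟨p, hp⟩ := hA.exists_prime_notMem hne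
  obtain ⟨α, hα, hyα⟩ := hy p
  exact hp (hα ▸ (α.1.mem_support a).2 ⟨ha α hyα, hna α hyα⟩)

lemma exists_realClosureStar_emb_mem (hA : IsVonNeumannRegular A) (hreal : IsRealRing A)
    (hBaer : IsBaerRing A) {y : A}
    (hy : ∀ p : PrimeSpectrum A, ∃ α : RealSpectrum A P,
      α.1.support = p.asIdeal ∧ y ∈ α.1.carrier) :
    ∃ B : RealClosureStar A P, B.emb y ∈ B.pos := by
  obtain ⟨Q, hPQ, hQ, hyQ⟩ := exists_isPartialOrdering_mem hA hy
  obtain ⟨B⟩ := nonempty_realClosureStar hA hreal hBaer hQ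
  exact ⟨⟨B.carrier, B.pos, B.emb, ⟨B.is.pos_partial, B.is.rcs, B.is.essential, B.is.integral,
    fun a ha => B.is.mono a (hPQ ha)⟩⟩, B.is.mono y hyQ⟩

lemma exists_realSpectrum_sq_mul_mem (hA : IsVonNeumannRegular A) (hP : IsPartialOrdering P)
    {a x : A} (h : ∀ p : PrimeSpectrum A, a ∉ p.asIdeal → p ∈ positiveSupport P x)
    (p : PrimeSpectrum A) :
    ∃ α : RealSpectrum A P, α.1.support = p.asIdeal ∧ a ^ 2 * x ∈ α.1.carrier := by
  by_cases hap : a ∈ p.asIdeal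
  · obtain ⟨R⟩ := hA.nonempty_realClosedPoint hP p.asIdeal
    refine ⟨⟨PrimeCone.comap R.toHom, R.nonneg⟩, R.ker_eq, ?_⟩
    change 0 ≤ R.toHom (a ^ 2 * x)
    rw [map_mul, map_pow, R.toHom_eq_zero_iff.2 hap]
    simp
  · obtain ⟨α, hα, hx, -⟩ := h p hap
    exact ⟨α, hα, α.1.mul_mem _ (α.1.sq_mem a) _ hx⟩

theorem not_hasUniqueRealClosureStar_of_interior_nonempty (hP : IsPartialOrdering P)
    (hreal : IsRealRing A) (hBaer : IsBaerRing A) (hA : IsVonNeumannRegular A) {x : A}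
    (hx : (interior (positiveSupport P x ∩ positiveSupport P (-x))).Nonempty) :
    ¬ HasUniqueRealClosureStar A P := by
  rintro ⟨-, huniq⟩
  obtain ⟨p, hp⟩ := hx
  obtain ⟨_, ⟨a, rfl⟩, hap, hsub⟩ :=
    PrimeSpectrum.isTopologicalBasis_basic_opens.exists_subset_of_mem_open hp isOpen_interior
  have hsub' := hsub.trans interior_subset
  obtain ⟨B, hB⟩ := exists_realClosureStar_emb_mem hA hreal hBaer
    (exists_realSpectrum_sq_mul_mem hA hP fun q hq => (hsub' hq).1)
  obtain ⟨C, hC⟩ := exists_realClosureStar_emb_mem hA hreal hBaer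
    (exists_realSpectrum_sq_mul_mem hA hP fun q hq => (hsub' hq).2)
  obtain ⟨e, he, hpos⟩ := huniq B C
  rw [hpos, he] at hB
  rw [mul_neg, map_neg] at hC
  have h0 : a ^ 2 * x = 0 := C.is.essential.1 (by
    rw [C.is.pos_partial.2.2.2 _ hB hC, map_zero])
  obtain ⟨α, hα, -, hxα⟩ := (hsub' hap).1
  rw [hα] at hxα
  have h1 : a ^ 2 * x ∈ p.asIdeal := h0 ▸ p.asIdeal.zero_mem
  exact (p.isPrime.mem_or_mem h1).elim (fun h => hap (p.isPrime.mem_of_pow_mem _ h)) hxα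

end Adjoin

/-- Let `(A, P)` be a formally real Baer von Neumann regular poring.
For `x ∈ A` let `P(x) = {α ∈ Sper A : x ∈ α ∖ supp α}`.  Then `A` does not have a unique
real closure * iff there is `x ∈ A` such that the interior (in `Spec A`) of
`supp (P(x)) ∩ supp (P(-x))` is nonempty. -/
theorem not_hasUniqueRealClosureStar_iff_interior_nonempty
    (A : Type u) [CommRing A] (P : Set A) (hP : IsPartialOrdering P)
    (hreal : IsRealRing A) (hBaer : IsBaerRing A) (hvnr : IsVonNeumannRegular A) :
    ¬ HasUniqueRealClosureStar A P ↔
      ∃ x : A,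
        (interior
          ({p : PrimeSpectrum A | ∃ α : RealSpectrum A P,
              α.1.support = p.asIdeal ∧ x ∈ α.1.carrier ∧ x ∉ α.1.support} ∩
           {p : PrimeSpectrum A | ∃ α : RealSpectrum A P,
              α.1.support = p.asIdeal ∧ -x ∈ α.1.carrier ∧ -x ∉ α.1.support})).Nonempty := by
  constructor
  · contrapose!
    intro h
    exact ⟨nonempty_realClosureStar hvnr hreal hBaer hP, fun B C =>
      B.aIso_of_interior_empty hvnr hBaer (fun x hx => hx.ne_empty (h x)) C⟩
  · rintro ⟨x, hx⟩
    exact not_hasUniqueRealClosureStar_of_interior_nonempty hP hreal hBaer hvnr hx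
end

section
/- Let X be a Boolean space (compact, Hausdorff, totally disconnected), K a field, and A := {f : X → K : f⁻¹({k}) is open in X for every k ∈ K} with pointwise operations. Then the map x ↦ p_x := {f ∈ A : f(x) = 0} is a homeomorphism from X onto Spec A (with the Zariski topology). -/
universe u

namespace LocallyConstant

variable {X K : Type*} [TopologicalSpace X] [Field K]

/-- The point of the prime spectrum given by the functions vanishing at `x`. -/
noncomputable def evalKernel (K : Type*) [Field K] (x : X) :
    PrimeSpectrum (LocallyConstant X K) :=
  ⟨RingHom.ker (evalRingHom x : LocallyConstant X K →+* K), RingHom.ker_isPrime _⟩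

theorem mem_evalKernel (x : X) (f : LocallyConstant X K) :
    f ∈ (evalKernel K x).asIdeal ↔ f x = 0 :=
  Iff.rfl

theorem evalKernel_preimage_basicOpen (f : LocallyConstant X K) :
    evalKernel K ⁻¹' PrimeSpectrum.basicOpen f = f ⁻¹' {0}ᶜ :=
  rfl

theorem continuous_evalKernel : Continuous (evalKernel K : X → _) := by
  rw [PrimeSpectrum.isTopologicalBasis_basic_opens.continuous_iff]
  rintro _ ⟨f, rfl⟩
  rw [evalKernel_preimage_basicOpen]
  exact f.isLocallyConstant _

theorem one_sub_mul_inv_apply (f : LocallyConstant X K) (x : X) :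
    (1 - f * f⁻¹) x = 1 - f x * (f x)⁻¹ :=
  rfl

theorem exists_le_evalKernel [CompactSpace X] (P : Ideal (LocallyConstant X K)) [P.IsPrime] :
    ∃ x : X, P ≤ (evalKernel K x).asIdeal := by
  by_contra! h
  have h' (x : X) : ∃ f ∈ P, f x ≠ 0 := Set.not_subset.mp (h x)
  choose f hfP hfx using h'
  obtain ⟨t, ht⟩ := isCompact_univ.elim_finite_subcover (fun x ↦ f x ⁻¹' {0}ᶜ)
    (fun x ↦ (f x).isLocallyConstant _)
    (fun x _ ↦ Set.mem_iUnion.mpr ⟨x, hfx x⟩)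
  have hprod : ∏ x ∈ t, (1 - f x * (f x)⁻¹) = 0 := by
    ext y
    obtain ⟨x, hxt, hxy⟩ := Set.mem_iUnion₂.mp (ht (Set.mem_univ y))
    have hxy' : f x y ≠ 0 := hxy
    have hmap : (∏ x ∈ t, (1 - f x * (f x)⁻¹)) y = ∏ x ∈ t, (1 - f x * (f x)⁻¹) y :=
      map_prod (evalRingHom y : LocallyConstant X K →+* K) _ _
    rw [hmap]
    exact Finset.prod_eq_zero hxt (by simp [one_sub_mul_inv_apply, hxy'])
  obtain ⟨x, -, hx⟩ := (Ideal.IsPrime.prod_mem_iff (p := P)).mp (hprod ▸ P.zero_mem)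
  refine Ideal.IsPrime.ne_top ‹P.IsPrime› ((Ideal.eq_top_iff_one P).mpr ?_)
  simpa using P.add_mem hx (P.mul_mem_right (f x)⁻¹ (hfP x))

theorem surjective_evalKernel [CompactSpace X] : Function.Surjective (evalKernel K : X → _) := by
  intro P
  obtain ⟨x, hx⟩ := exists_le_evalKernel P.asIdeal
  refine ⟨x, PrimeSpectrum.ext (le_antisymm (fun f hf ↦ ?_) hx)⟩
  have hmul : f * (1 - f * f⁻¹) = 0 := by
    ext y
    by_cases hy : f y = 0 <;> simp [one_sub_mul_inv_apply, hy]
  refine (P.isPrime.mem_or_mem (hmul ▸ P.asIdeal.zero_mem)).resolve_right fun hmem ↦ ?_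
  have hzero := (mem_evalKernel x _).mp (hx hmem)
  simp [one_sub_mul_inv_apply, (mem_evalKernel x f).mp hf] at hzero

theorem preimage_basicOpen_charFn {V : Set X} (hV : IsClopen V) :
    evalKernel K ⁻¹' PrimeSpectrum.basicOpen (charFn K hV) = V := by
  ext x
  rw [evalKernel_preimage_basicOpen]
  exact (charFn_eq_zero K x hV).not.trans not_not

variable [CompactSpace X] [T2Space X] [TotallyDisconnectedSpace X]

theorem injective_evalKernel : Function.Injective (evalKernel K : X → _) := by
  intro x y hxy
  by_contra hne
  obtain ⟨V, hV, hxV, hyV⟩ := exists_isClopen_of_totally_separated hne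
  rw [← preimage_basicOpen_charFn (K := K) hV] at hxV hyV
  exact hyV (by simpa only [Set.mem_preimage, ← hxy] using hxV)

theorem isOpenMap_evalKernel : IsOpenMap (evalKernel K : X → _) := by
  rw [isTopologicalBasis_isClopen.isOpenMap_iff]
  intro V hV
  rw [← preimage_basicOpen_charFn (K := K) hV, Set.image_preimage_eq _ surjective_evalKernel]
  exact (PrimeSpectrum.basicOpen _).isOpen

end LocallyConstant

/-- For a Boolean space `X` and a field `K`, with
`A = LocallyConstant X K` the ring of locally constant functions `X → K` (exactly the
functions all of whose fibres are open) under pointwise operations, the map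
`x ↦ pₓ := {f ∈ A | f x = 0}` is a homeomorphism from `X` onto `Spec A` with the
Zariski topology. -/
theorem eval_kernels_homeomorph_primeSpectrum
    (X : Type u) [TopologicalSpace X] [CompactSpace X] [T2Space X]
    [TotallyDisconnectedSpace X] (K : Type u) [Field K] :
    ∃ h : X ≃ₜ PrimeSpectrum (LocallyConstant X K),
      ∀ (x : X) (f : LocallyConstant X K), f ∈ (h x).asIdeal ↔ f x = 0 := by
  exact ⟨(Equiv.ofBijective _ ⟨LocallyConstant.injective_evalKernel,
      LocallyConstant.surjective_evalKernel⟩).toHomeomorphOfContinuousOpen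
        LocallyConstant.continuous_evalKernel LocallyConstant.isOpenMap_evalKernel,
    LocallyConstant.mem_evalKernel⟩
end

section
/- Let X be a Boolean space (compact, Hausdorff, totally disconnected), K a field, and A := {f : X → K : f⁻¹({k}) is open in X for every k ∈ K} with pointwise operations. Then for every x ∈ X, evaluation at x induces a well-defined field isomorphism A/p_x ≅ K, where p_x := {f ∈ A : f(x) = 0}; moreover, if X is in addition extremally disconnected, then A is a Baer ring. -/
universe u

/-- If `X` is extremally disconnected, the annihilator of a set of locally constant functions is
generated by the indicator of the complement of the closure of the union of their supports. -/
theorem LocallyConstant.isBaerRing_of_extremallyDisconnected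
    (X : Type*) [TopologicalSpace X] [ExtremallyDisconnected X] (K : Type*) [Field K] :
    IsBaerRing (LocallyConstant X K) := by
  intro S
  set U : Set X := ⋃ s ∈ S, {z | s z ≠ 0}
  have hU : IsOpen U := isOpen_biUnion fun s _ => s.isLocallyConstant {k | k ≠ 0}
  have hC : IsClopen (closure U)ᶜ :=
    IsClopen.compl ⟨isClosed_closure, ExtremallyDisconnected.open_closure U hU⟩
  refine ⟨LocallyConstant.charFn K hC, ?_, fun f => ⟨fun hf => ⟨f, ?_⟩, ?_⟩⟩
  · ext z
    by_cases hz : z ∈ closure U <;> simp [LocallyConstant.coe_charFn, hz]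
  · have hzero : closure U ⊆ {z | f z = 0} := by
      refine closure_minimal ?_ (f.isLocallyConstant.isClosed_fiber 0)
      intro z hz
      obtain ⟨s, hs, hsz⟩ := Set.mem_iUnion₂.mp hz
      exact (mul_eq_zero.mp (DFunLike.congr_fun (hf s hs) z)).resolve_right hsz
    ext z
    by_cases hz : z ∈ closure U
    · simpa [LocallyConstant.coe_charFn, hz] using hzero hz
    · simp [LocallyConstant.coe_charFn, hz]
  · rintro ⟨g, rfl⟩ s hs
    ext z
    by_cases hsz : s z = 0
    · simp [hsz]
    · have hz : z ∈ closure U := subset_closure (Set.mem_iUnion₂.mpr ⟨s, hs, hsz⟩)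
      simp [LocallyConstant.coe_charFn, hz]

/-- For a Boolean space `X` and a field `K`, with
`A = LocallyConstant X K` (the functions `X → K` all of whose fibres are open, with
pointwise operations): for every `x ∈ X` evaluation at `x` induces a field isomorphism
`A / pₓ ≃ K`, where `pₓ = {f | f x = 0}` is the kernel of the evaluation map; moreover if
`X` is in addition extremally disconnected then `A` is a Baer ring. -/
theorem eval_induces_residue_iso_and_baer
    (X : Type u) [TopologicalSpace X] [CompactSpace X] [T2Space X]
    [TotallyDisconnectedSpace X] (K : Type u) [Field K] :
    (∀ x : X,
      ∃ e : (LocallyConstant X K ⧸ RingHom.ker (LocallyConstant.evalRingHom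
          (X := X) (Y := K) x)) ≃+* K,
        ∀ f : LocallyConstant X K,
          e (Ideal.Quotient.mk (RingHom.ker (LocallyConstant.evalRingHom
            (X := X) (Y := K) x)) f) = f x) ∧
    (ExtremallyDisconnected X → IsBaerRing (LocallyConstant X K)) := by
  refine ⟨fun x => ?_, fun _ => LocallyConstant.isBaerRing_of_extremallyDisconnected X K⟩
  have hsurj : Function.Surjective (LocallyConstant.evalRingHom (X := X) (Y := K) x) :=
    fun k => ⟨LocallyConstant.const X k, rfl⟩
  exact ⟨RingHom.quotientKerEquivOfSurjective hsurj, fun _ => rfl⟩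
end

section
/- Let X be an extremally disconnected Boolean space with a non-isolated point y, let K = ℚ(√2), let P₀ and P₁ be the two total orderings of K determined by √2 ∈ P₀ and −√2 ∈ P₁, let A := {f : X → K : f⁻¹({k}) is open for every k ∈ K} with pointwise operations, and let A⁺ := {f ∈ A : f(x) ∈ P₀ for all x ≠ y, and f(y) ∈ ΣK²}. Then A⁺ is a partial ordering of A; the support map supp : Sper A → Spec A is injective on Sper A ∖ supp⁻¹({p_y}); and supp⁻¹({p_y}) has exactly two elements, where p_y := {f ∈ A : f(y) = 0}. -/
universe u

/-- The partial ordering of the example: `f ≥ 0` iff `f x ∈ P₀` for all `x ≠ y` and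
`f y` is a sum of squares of `K`. -/
def examplePos (X : Type u) [TopologicalSpace X] (K : Type u) [Field K]
    (y : X) (P₀ : Set K) : Set (LocallyConstant X K) :=
  {f : LocallyConstant X K | (∀ x : X, x ≠ y → f x ∈ P₀) ∧
    ∃ (n : ℕ) (g : Fin n → K), f y = ∑ i, g i ^ 2}

/-- A finite sum of squares is a sum of squares in the inductive sense. -/
theorem exists_eq_sum_sq_iff_isSumSq {R : Type*} [CommRing R] (a : R) :
    (∃ (n : ℕ) (g : Fin n → R), a = ∑ i, g i ^ 2) ↔ IsSumSq a := by
  constructor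
  · rintro ⟨n, g, rfl⟩
    exact IsSumSq.sum fun i _ => (IsSquare.sq (g i)).isSumSq
  · intro h
    induction h with
    | zero => exact ⟨0, fun _ => 0, by simp⟩
    | sq_add x _ ih =>
      obtain ⟨n, g, rfl⟩ := ih
      exact ⟨n + 1, Fin.cons x g, by simp [Fin.sum_univ_succ, sq]⟩

namespace IsTotalOrderingCone

section Ring

variable {R : Type*} [CommRing R] {T : Set R}

theorem mul_self_mem (hT : IsTotalOrderingCone T) (x : R) : x * x ∈ T := by
  rcases hT.2.2.1 x with h | h
  · exact hT.2.1 x h x h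
  · simpa using hT.2.1 _ h _ h

theorem zero_mem (hT : IsTotalOrderingCone T) : (0 : R) ∈ T := by
  simpa using hT.mul_self_mem 0

theorem isSumSq_mem (hT : IsTotalOrderingCone T) {a : R} (ha : IsSumSq a) : a ∈ T := by
  induction ha with
  | zero => exact hT.zero_mem
  | sq_add x _ ih => exact hT.1 _ (hT.mul_self_mem x) _ ih

end Ring

section Field

variable {K : Type*} [Field K] {T : Set K}

theorem inv_mem (hT : IsTotalOrderingCone T) {x : K} (hx : x ∈ T) : x⁻¹ ∈ T := by
  by_cases h : x = 0
  · simpa [h] using hT.zero_mem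
  · have h' := hT.2.1 _ hx _ (hT.mul_self_mem x⁻¹)
    rwa [← mul_assoc, mul_inv_cancel₀ h, one_mul] at h'

theorem natCast_mem (hT : IsTotalOrderingCone T) (n : ℕ) : (n : K) ∈ T := by
  induction n with
  | zero => simpa using hT.zero_mem
  | succ n ih => simpa using hT.1 _ ih _ (by simpa using hT.mul_self_mem 1)

theorem ratCast_mem [CharZero K] (hT : IsTotalOrderingCone T) {q : ℚ} (hq : 0 ≤ q) :
    (q : K) ∈ T := by
  have h : (q : K) = (q.num.toNat : K) * (q.den : K)⁻¹ := by
    rw [Rat.cast_def, div_eq_mul_inv]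
    have : (q.num.toNat : ℤ) = q.num := Int.toNat_of_nonneg (Rat.num_nonneg.2 hq)
    rw [← Int.cast_natCast q.num.toNat, this]
  rw [h]
  exact hT.2.1 _ (hT.natCast_mem _) _ (hT.inv_mem (hT.natCast_mem _))

/-- In a cone containing a square root `s` of `2`, the sign of `a - b * s` with `a, b ≥ 0` is that
of its norm `a ^ 2 - 2 * b ^ 2`. -/
theorem rat_sub_mul_mem [CharZero K] (hT : IsTotalOrderingCone T) {s : K} (hs : s ^ 2 = 2)
    (hsT : s ∈ T) {a b : ℚ} (ha : 0 ≤ a) (hb : 0 ≤ b) (h : 2 * b ^ 2 ≤ a ^ 2) :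
    (a : K) - b * s ∈ T := by
  by_cases h0 : (a : K) + b * s = 0
  · have hbs := hT.2.1 _ (hT.ratCast_mem hb) _ hsT
    have ha' : (a : K) = 0 := hT.2.2.2 _ (hT.ratCast_mem ha) (by
      rwa [← eq_neg_of_add_eq_zero_right h0])
    have : (a : K) - b * s = 0 := by linear_combination 2 * ha' - h0
    exact this ▸ hT.zero_mem
  · have hp : (a : K) + b * s ∈ T :=
      hT.1 _ (hT.ratCast_mem ha) _ (hT.2.1 _ (hT.ratCast_mem hb) _ hsT)
    have hn : ((a ^ 2 - 2 * b ^ 2 : ℚ) : K) ∈ T := hT.ratCast_mem (by linarith)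
    have : (a : K) - b * s = ((a ^ 2 - 2 * b ^ 2 : ℚ) : K) * ((a : K) + b * s)⁻¹ := by
      rw [eq_mul_inv_iff_mul_eq₀ h0]
      push_cast
      linear_combination -(b : K) ^ 2 * hs
    rw [this]
    exact hT.2.1 _ hn _ (hT.inv_mem hp)

theorem mul_sub_rat_mem [CharZero K] (hT : IsTotalOrderingCone T) {s : K} (hs : s ^ 2 = 2)
    (hsT : s ∈ T) {a b : ℚ} (ha : 0 ≤ a) (hb : 0 ≤ b) (h : a ^ 2 ≤ 2 * b ^ 2) :
    b * s - (a : K) ∈ T := by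
  have h1 : ((2 * b : ℚ) : K) - a * s ∈ T :=
    hT.rat_sub_mul_mem hs hsT (by positivity) ha (by nlinarith)
  have h2 := hT.2.1 _ (hT.2.1 _ h1 _ hsT) _ (hT.ratCast_mem (q := 1 / 2) (by norm_num))
  have : b * s - (a : K) = (((2 * b : ℚ) : K) - a * s) * s * ((1 / 2 : ℚ) : K) := by
    push_cast
    linear_combination (a : K) / 2 * hs
  rwa [this]

/-- The sign of an element of `ℚ(√2)` is the same in all orderings in which `√2` is positive. -/
theorem forall_mem_or_forall_neg_mem [CharZero K] {s : K} (hs : s ^ 2 = 2) (a b : ℚ) :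
    (∀ T : Set K, IsTotalOrderingCone T → s ∈ T → (a : K) + b * s ∈ T) ∨
    (∀ T : Set K, IsTotalOrderingCone T → s ∈ T → -((a : K) + b * s) ∈ T) := by
  rcases le_total 0 a with ha | ha <;> rcases le_total 0 b with hb | hb
  · exact .inl fun T hT hsT =>
      hT.1 _ (hT.ratCast_mem ha) _ (hT.2.1 _ (hT.ratCast_mem hb) _ hsT)
  · have hb' := neg_nonneg.2 hb
    rcases le_total (2 * (-b) ^ 2) (a ^ 2) with h | h
    · exact .inl fun T hT hsT => by simpa using hT.rat_sub_mul_mem hs hsT ha hb' h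
    · refine .inr fun T hT hsT => ?_
      have := hT.mul_sub_rat_mem hs hsT ha hb' h
      convert this using 1
      push_cast
      ring
  · have ha' := neg_nonneg.2 ha
    rcases le_total (2 * b ^ 2) ((-a) ^ 2) with h | h
    · refine .inr fun T hT hsT => ?_
      have := hT.rat_sub_mul_mem hs hsT ha' hb h
      convert this using 1
      push_cast
      ring
    · refine .inl fun T hT hsT => ?_
      have := hT.mul_sub_rat_mem hs hsT ha' hb h
      convert this using 1
      push_cast
      ring
  · refine .inr fun T hT hsT => ?_
    have := hT.1 _ (hT.ratCast_mem (neg_nonneg.2 ha)) _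
      (hT.2.1 _ (hT.ratCast_mem (neg_nonneg.2 hb)) _ hsT)
    convert this using 1
    push_cast
    ring

/-- An ordering of `ℚ(√2)` is determined by the sign of `√2`. -/
theorem eq_of_sqrt_two_mem [CharZero K] {s : K} (hs : s ^ 2 = 2)
    (hgen : ∀ x : K, ∃ a b : ℚ, x = (a : K) + (b : K) * s) {T' : Set K}
    (hT : IsTotalOrderingCone T) (hT' : IsTotalOrderingCone T') (hsT : s ∈ T) (hsT' : s ∈ T') :
    T = T' := by
  ext x
  obtain ⟨a, b, rfl⟩ := hgen x
  rcases forall_mem_or_forall_neg_mem hs a b with h | h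
  · exact iff_of_true (h T hT hsT) (h T' hT' hsT')
  · constructor
    · intro hx
      rw [hT.2.2.2 _ hx (h T hT hsT)]
      exact hT'.zero_mem
    · intro hx
      rw [hT'.2.2.2 _ hx (h T' hT' hsT')]
      exact hT.zero_mem

end Field

end IsTotalOrderingCone

namespace PrimeCone

variable {A : Type u} [CommRing A]

theorem eq_of_carrier_eq {α β : PrimeCone A} (h : α.carrier = β.carrier) : α = β := by
  have hs : α.support = β.support := by
    ext a
    rw [α.mem_support, β.mem_support, h]
  cases α
  cases β
  simp only at h hs
  subst h hs
  rfl

theorem mem_iff_of_sub_mem_support (α : PrimeCone A) {a b : A} (h : a - b ∈ α.support) :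
    a ∈ α.carrier ↔ b ∈ α.carrier := by
  obtain ⟨h₁, h₂⟩ := (α.mem_support _).1 h
  constructor
  · intro ha
    simpa using α.add_mem _ ha _ h₂
  · intro hb
    simpa using α.add_mem _ hb _ h₁

/-- The ordering of a field induced by a prime cone along a ring homomorphism. -/
theorem isTotalOrderingCone_preimage {K : Type*} [Field K] (α : PrimeCone A) (φ : K →+* A) :
    IsTotalOrderingCone (φ ⁻¹' α.carrier) := by
  refine ⟨fun a ha b hb => ?_, fun a ha b hb => ?_, fun x => ?_, fun x hx hx' => ?_⟩
  · simpa using α.add_mem _ ha _ hb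
  · simpa using α.mul_mem _ ha _ hb
  · simpa using α.mem_or_neg_mem (φ x)
  · by_contra h0
    have hmem : φ x ∈ α.support := (α.mem_support _).2 ⟨hx, by simpa using hx'⟩
    exact α.support_isPrime.ne_top
      (Ideal.eq_top_of_isUnit_mem _ hmem ((Ne.isUnit h0).map φ))

/-- The prime cone obtained by pulling back an ordering of a field. -/
def ofRingHom {K : Type*} [Field K] {T : Set K} (hT : IsTotalOrderingCone T) (φ : A →+* K) :
    PrimeCone A where
  carrier := φ ⁻¹' T
  add_mem a ha b hb := by simpa using hT.1 _ ha _ hb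
  mul_mem a ha b hb := by simpa using hT.2.1 _ ha _ hb
  sq_mem a := by simpa [sq] using hT.mul_self_mem (φ a)
  mem_or_neg_mem a := by simpa using hT.2.2.1 (φ a)
  support := RingHom.ker φ
  mem_support a := by
    simp only [RingHom.mem_ker, Set.mem_preimage, map_neg]
    refine ⟨fun h => ?_, fun h => hT.2.2.2 _ h.1 h.2⟩
    simpa [h] using hT.zero_mem
  support_isPrime := RingHom.ker_isPrime φ

end PrimeCone

namespace LocallyConstant

variable {X : Type*} [TopologicalSpace X] {K : Type*} [Field K]

/-- Modulo a prime ideal, every locally constant function on a compact space is constant. -/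
theorem exists_sub_const_mem [CompactSpace X] (p : Ideal (LocallyConstant X K)) (hp : p.IsPrime)
    (f : LocallyConstant X K) : ∃ k : K, f - constRingHom k ∈ p := by
  have h : ∏ k ∈ f.range_finite.toFinset, (f - constRingHom k) = 0 := by
    ext x
    change evalRingHom x (∏ k ∈ f.range_finite.toFinset, (f - constRingHom k)) = 0
    rw [map_prod]
    exact Finset.prod_eq_zero (i := f x) (by simp) (by simp [sub_apply])
  obtain ⟨k, -, hk⟩ := (hp.prod_mem_iff).1 (h ▸ p.zero_mem)
  exact ⟨k, hk⟩

/-- An ideal is the ideal of functions vanishing at `y` as soon as it is proper and contains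
that ideal. -/
theorem eq_ker_evalRingHom {y : X} {p : Ideal (LocallyConstant X K)} (hp : p ≠ ⊤)
    (h : RingHom.ker (evalRingHom (Y := K) y) ≤ p) :
    p = RingHom.ker (evalRingHom (Y := K) y) :=
  ((RingHom.ker_isMaximal_of_surjective (evalRingHom (Y := K) y)
    fun k => ⟨constRingHom k, rfl⟩).eq_of_le hp h).symm

end LocallyConstant

section Example

open LocallyConstant

variable {X : Type u} [TopologicalSpace X] {K : Type u} [Field K] {y : X} {P₀ : Set K}

theorem mem_examplePos_iff {f : LocallyConstant X K} :
    f ∈ examplePos X K y P₀ ↔ (∀ x, x ≠ y → f x ∈ P₀) ∧ IsSumSq (f y) := by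
  rw [← exists_eq_sum_sq_iff_isSumSq]
  rfl

theorem isPartialOrdering_examplePos (hP₀ : IsTotalOrderingCone P₀) :
    IsPartialOrdering (examplePos X K y P₀) := by
  simp only [IsPartialOrdering, mem_examplePos_iff]
  refine ⟨fun a ha b hb => ⟨fun x hx => hP₀.1 _ (ha.1 x hx) _ (hb.1 x hx), ha.2.add hb.2⟩,
    fun a ha b hb => ⟨fun x hx => hP₀.2.1 _ (ha.1 x hx) _ (hb.1 x hx), ha.2.mul hb.2⟩,
    fun a => ⟨fun x _ => ?_, ?_⟩, fun a ha hb => ?_⟩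
  · simpa [sq] using hP₀.mul_self_mem (a x)
  · simp [sq]
  · ext x
    by_cases hx : x = y
    · subst hx
      exact hP₀.2.2.2 _ (hP₀.isSumSq_mem ha.2) (hP₀.isSumSq_mem hb.2)
    · exact hP₀.2.2.2 _ (ha.1 x hx) (hb.1 x hx)

/-- Away from the point `y`, a prime cone over `examplePos` restricts on constants to a cone
containing `P₀`. -/
theorem constRingHom_mem_of_support_ne [CompactSpace X] (hP₀ : IsTotalOrderingCone P₀)
    (α : RealSpectrum (LocallyConstant X K) (examplePos X K y P₀))
    (hα : α.1.support ≠ RingHom.ker (evalRingHom (X := X) (Y := K) y)) {t : K} (ht : t ∈ P₀) :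
    constRingHom t ∈ α.1.carrier := by
  have hT := α.1.isTotalOrderingCone_preimage (constRingHom (X := X) (Y := K))
  obtain ⟨f, hfy, hf⟩ := SetLike.not_le_iff_exists.1 fun h =>
    hα (eq_ker_evalRingHom α.1.support_isPrime.ne_top h)
  replace hfy : f y = 0 := hfy
  obtain ⟨k, hk⟩ := exists_sub_const_mem _ α.1.support_isPrime f
  have hk0 : k ≠ 0 := by
    rintro rfl
    rw [map_zero, sub_zero] at hk
    exact hf hk
  have hpos : f * f * constRingHom t ∈ α.1.carrier := α.2 <| mem_examplePos_iff.2
    ⟨fun x _ => hP₀.2.1 _ (hP₀.mul_self_mem _) _ ht, by simp [hfy]⟩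
  have hmem : constRingHom (k * k * t) ∈ α.1.carrier := by
    refine (α.1.mem_iff_of_sub_mem_support ?_).1 hpos
    have := α.1.support.mul_mem_left ((f + constRingHom k) * constRingHom t) hk
    convert this using 1
    simp only [map_mul]
    ring
  have h := hT.2.1 _ hmem _ (hT.mul_self_mem k⁻¹)
  have hkt : k * k * t * (k⁻¹ * k⁻¹) = t := by field_simp
  rwa [hkt] at h

end Example

/-- Let `X` be an extremally disconnected Boolean space with a
non-isolated point `y`, let `K = ℚ(√2)`, let `P₀`, `P₁` be the two total orderings of `K`
with `√2 ∈ P₀` and `-√2 ∈ P₁`, let `A` be the ring of locally constant functions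
`X → K`, and let `A⁺` be as in `examplePos`.  Then `A⁺` is a partial ordering of `A`;
the support map is injective on `Sper A ∖ supp⁻¹ {p_y}`; and `supp⁻¹ {p_y}` has exactly
two elements, where `p_y = {f | f y = 0}`. -/
theorem examplePos_isPartialOrdering_and_support_fibres
    (X : Type u) [TopologicalSpace X] [CompactSpace X] [T2Space X]
    [TotallyDisconnectedSpace X] [ExtremallyDisconnected X]
    (y : X) (hy : ¬ IsOpen ({y} : Set X))
    (K : Type u) [Field K] [CharZero K]
    (sqrt2 : K) (hsqrt2 : sqrt2 ^ 2 = 2)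
    (hgen : ∀ x : K, ∃ a b : ℚ, x = (a : K) + (b : K) * sqrt2)
    (P₀ P₁ : Set K) (hP₀ : IsTotalOrderingCone P₀) (hP₁ : IsTotalOrderingCone P₁)
    (hs₀ : sqrt2 ∈ P₀) (hs₁ : -sqrt2 ∈ P₁) :
    IsPartialOrdering (examplePos X K y P₀) ∧
    (∀ α β : RealSpectrum (LocallyConstant X K) (examplePos X K y P₀),
      α.1.support ≠ RingHom.ker (LocallyConstant.evalRingHom (X := X) (Y := K) y) →
      β.1.support ≠ RingHom.ker (LocallyConstant.evalRingHom (X := X) (Y := K) y) →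
      α.1.support = β.1.support → α = β) ∧
    (∃ α β : RealSpectrum (LocallyConstant X K) (examplePos X K y P₀),
      α ≠ β ∧
      α.1.support = RingHom.ker (LocallyConstant.evalRingHom (X := X) (Y := K) y) ∧
      β.1.support = RingHom.ker (LocallyConstant.evalRingHom (X := X) (Y := K) y) ∧
      ∀ γ : RealSpectrum (LocallyConstant X K) (examplePos X K y P₀),
        γ.1.support = RingHom.ker (LocallyConstant.evalRingHom (X := X) (Y := K) y) →
        γ = α ∨ γ = β) := by
  have hsum : ∀ T : Set K, IsTotalOrderingCone T →
      examplePos X K y P₀ ⊆ LocallyConstant.evalRingHom (X := X) (Y := K) y ⁻¹' T :=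
    fun T hT f hf => hT.isSumSq_mem (mem_examplePos_iff.1 hf).2
  refine ⟨isPartialOrdering_examplePos hP₀, fun α β hα hβ h => ?_,
    ⟨PrimeCone.ofRingHom hP₀ _, hsum P₀ hP₀⟩, ⟨PrimeCone.ofRingHom hP₁ _, hsum P₁ hP₁⟩,
    fun h => ?_, rfl, rfl, fun γ hγ => ?_⟩
  · have hT : LocallyConstant.constRingHom ⁻¹' α.1.carrier =
        LocallyConstant.constRingHom ⁻¹' β.1.carrier :=
      IsTotalOrderingCone.eq_of_sqrt_two_mem hsqrt2 hgen
        (α.1.isTotalOrderingCone_preimage LocallyConstant.constRingHom)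
        (β.1.isTotalOrderingCone_preimage LocallyConstant.constRingHom)
        (constRingHom_mem_of_support_ne hP₀ α hα hs₀) (constRingHom_mem_of_support_ne hP₀ β hβ hs₀)
    refine Subtype.ext (PrimeCone.eq_of_carrier_eq (Set.ext fun f => ?_))
    obtain ⟨k, hk⟩ := LocallyConstant.exists_sub_const_mem _ α.1.support_isPrime f
    rw [α.1.mem_iff_of_sub_mem_support hk, β.1.mem_iff_of_sub_mem_support (h ▸ hk)]
    exact Set.ext_iff.1 hT k
  · have hc := congrArg (fun α => α.1.carrier) h
    have hmem : sqrt2 ∈ P₁ := (Set.ext_iff.1 hc (LocallyConstant.constRingHom sqrt2)).1 hs₀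
    have h0 : sqrt2 = 0 := hP₁.2.2.2 _ hmem hs₁
    simp [h0] at hsqrt2
  · have hT := γ.1.isTotalOrderingCone_preimage (LocallyConstant.constRingHom (X := X) (Y := K))
    have key : ∀ T (hT' : IsTotalOrderingCone T) (hsub),
        LocallyConstant.constRingHom ⁻¹' γ.1.carrier = T →
        γ = ⟨PrimeCone.ofRingHom hT' (LocallyConstant.evalRingHom y), hsub⟩ := by
      intro T hT' _ hTγ
      refine Subtype.ext (PrimeCone.eq_of_carrier_eq (Set.ext fun f => ?_))
      rw [γ.1.mem_iff_of_sub_mem_support (b := LocallyConstant.constRingHom (f y))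
        (by rw [hγ, RingHom.mem_ker]; simp [LocallyConstant.sub_apply])]
      exact Set.ext_iff.1 hTγ (f y)
    rcases hT.2.2.1 sqrt2 with h | h
    · exact .inl (key _ _ _ (hT.eq_of_sqrt_two_mem hsqrt2 hgen hP₀ h hs₀))
    · refine .inr (key _ _ _ (hT.eq_of_sqrt_two_mem (s := -sqrt2) (by simpa using hsqrt2)
        (fun x => ?_) hP₁ h hs₁))
      obtain ⟨a, b, rfl⟩ := hgen x
      exact ⟨a, -b, by simp⟩
end

section
/- Let X be an extremally disconnected Boolean space with a non-isolated point y, let K = ℚ(√2), let A := {f : X → K : f⁻¹({k}) is open for every k ∈ K} with pointwise operations, let P₀ be the total ordering of K with √2 ∈ P₀, and let A⁺ := {f ∈ A : f(x) ∈ P₀ for all x ≠ y, and f(y) ∈ ΣK²}. Then the poring (A, A⁺) has a unique real closure *. In particular, there exist von Neumann regular porings with unique real closure * that are not f-rings. -/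
universe u

/-- A proper (not necessarily pointed) preordering of a commutative ring. -/
structure IsProperPreordering {B : Type*} [CommRing B] (T : Set B) : Prop where
  add_mem : ∀ a ∈ T, ∀ b ∈ T, a + b ∈ T
  mul_mem : ∀ a ∈ T, ∀ b ∈ T, a * b ∈ T
  sq_mem : ∀ a : B, a ^ 2 ∈ T
  neg_one_notMem : (-1 : B) ∉ T

namespace IsProperPreordering

variable {B : Type*} [CommRing B] {T : Set B}

lemma exists_maximal (hT : IsProperPreordering T) :
    ∃ M, T ⊆ M ∧ Maximal (IsProperPreordering : Set B → Prop) M := by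
  refine zorn_subset_nonempty {S : Set B | IsProperPreordering S} ?_ T hT
  intro c hc hchain ⟨S₀, hS₀⟩
  refine ⟨⋃₀ c, ⟨?_, ?_, ?_, ?_⟩, fun s hs => Set.subset_sUnion_of_mem hs⟩
  · rintro a ⟨S, hS, ha⟩ b ⟨S', hS', hb⟩
    rcases hchain.total hS hS' with h | h
    · exact ⟨S', hS', (hc hS').add_mem a (h ha) b hb⟩
    · exact ⟨S, hS, (hc hS).add_mem a ha b (h hb)⟩
  · rintro a ⟨S, hS, ha⟩ b ⟨S', hS', hb⟩
    rcases hchain.total hS hS' with h | h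
    · exact ⟨S', hS', (hc hS').mul_mem a (h ha) b hb⟩
    · exact ⟨S, hS, (hc hS).mul_mem a ha b (h hb)⟩
  · exact fun a => ⟨S₀, hS₀, (hc hS₀).sq_mem a⟩
  · rintro ⟨S, hS, h⟩
    exact (hc hS).neg_one_notMem h

lemma one_mem (hT : IsProperPreordering T) : (1 : B) ∈ T := by
  simpa using hT.sq_mem 1

lemma zero_mem (hT : IsProperPreordering T) : (0 : B) ∈ T := by
  simpa using hT.sq_mem 0

/-- An element outside a maximal proper preordering cannot be adjoined to it. -/
lemma exists_eq_of_maximal (hT : Maximal (IsProperPreordering : Set B → Prop) T) {a : B}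
    (ha : a ∉ T) : ∃ s ∈ T, ∃ t ∈ T, -1 = s + a * t := by
  have h := hT.prop
  by_contra! hne
  refine ha (hT.le_of_ge (y := {b | ∃ s ∈ T, ∃ t ∈ T, b = s + a * t}) ⟨?_, ?_, ?_, ?_⟩ ?_ ?_)
  · rintro _ ⟨s, hs, t, ht, rfl⟩ _ ⟨s', hs', t', ht', rfl⟩
    exact ⟨_, h.add_mem s hs s' hs', _, h.add_mem t ht t' ht', by ring⟩
  · rintro _ ⟨s, hs, t, ht, rfl⟩ _ ⟨s', hs', t', ht', rfl⟩
    exact ⟨_, h.add_mem _ (h.mul_mem s hs s' hs') _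
      (h.mul_mem _ (h.sq_mem a) _ (h.mul_mem t ht t' ht')), _,
      h.add_mem _ (h.mul_mem s hs t' ht') _ (h.mul_mem t ht s' hs'), by ring⟩
  · exact fun b => ⟨_, h.sq_mem b, 0, h.zero_mem, by ring⟩
  · rintro ⟨s, hs, t, ht, e⟩
    exact hne s hs t ht e
  · exact fun b hb => ⟨b, hb, 0, h.zero_mem, by ring⟩
  · exact ⟨0, h.zero_mem, 1, h.one_mem, by ring⟩

lemma mem_or_neg_mem_of_maximal (hT : Maximal (IsProperPreordering : Set B → Prop) T) (a : B) :
    a ∈ T ∨ -a ∈ T := by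
  have h := hT.prop
  by_contra! hne
  obtain ⟨s, hs, t, ht, e⟩ := exists_eq_of_maximal hT hne.1
  obtain ⟨u, hu, v, hv, e'⟩ := exists_eq_of_maximal hT hne.2
  refine h.neg_one_notMem ?_
  have : (-1 : B) = a ^ 2 * (t * v) + (s + (u + s * u)) := by
    have e₁ : a * t = -1 - s := by linear_combination -e
    have e₂ : a * v = 1 + u := by linear_combination e'
    linear_combination (-a * v) * e₁ + (1 + s) * e₂
  rw [this]
  exact h.add_mem _ (h.mul_mem _ (h.sq_mem a) _ (h.mul_mem t ht v hv)) _
    (h.add_mem s hs _ (h.add_mem u hu _ (h.mul_mem s hs u hu)))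

/-- The support of a maximal proper preordering. -/
def supportIdeal (hT : Maximal (IsProperPreordering : Set B → Prop) T) : Ideal B where
  carrier := {a | a ∈ T ∧ -a ∈ T}
  add_mem' {a b} ha hb := ⟨hT.prop.add_mem _ ha.1 _ hb.1, by
    rw [neg_add]; exact hT.prop.add_mem _ ha.2 _ hb.2⟩
  zero_mem' := ⟨hT.prop.zero_mem, by simpa using hT.prop.zero_mem⟩
  smul_mem' c a ha := by
    rcases mem_or_neg_mem_of_maximal hT c with hc | hc
    · exact ⟨hT.prop.mul_mem _ hc _ ha.1, by
        simpa using hT.prop.mul_mem _ hc _ ha.2⟩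
    · exact ⟨by simpa using hT.prop.mul_mem _ hc _ ha.2, by
        simpa using hT.prop.mul_mem _ hc _ ha.1⟩

lemma mem_supportIdeal (hT : Maximal (IsProperPreordering : Set B → Prop) T) {a : B} :
    a ∈ supportIdeal hT ↔ a ∈ T ∧ -a ∈ T := Iff.rfl

lemma supportIdeal_isPrime (hT : Maximal (IsProperPreordering : Set B → Prop) T) :
    (supportIdeal hT).IsPrime := by
  have h := hT.prop
  have key : ∀ a ∉ supportIdeal hT, ∃ c, ∃ s ∈ T, a * c = 1 + s := by
    intro a ha
    rw [mem_supportIdeal, not_and_or] at ha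
    rcases ha with ha | ha
    · obtain ⟨s, hs, t, _, e⟩ := exists_eq_of_maximal hT ha
      exact ⟨-t, s, hs, by linear_combination e⟩
    · obtain ⟨s, hs, t, _, e⟩ := exists_eq_of_maximal hT ha
      exact ⟨t, s, hs, by linear_combination e⟩
  refine ⟨fun h1 => ?_, fun {a b} hab => ?_⟩
  · exact h.neg_one_notMem ((Ideal.eq_top_iff_one _).1 h1).2
  · by_contra! hne
    obtain ⟨c, s, hs, e⟩ := key a hne.1
    obtain ⟨d, t, ht, e'⟩ := key b hne.2
    have h1 := ((supportIdeal hT).mul_mem_right (c * d) hab).2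
    refine h.neg_one_notMem ?_
    have : (-1 : B) = -(a * b * (c * d)) + (s + (t + s * t)) := by
      linear_combination (b * d) * e + (1 + s) * e'
    rw [this]
    exact h.add_mem _ h1 _ (h.add_mem s hs _ (h.add_mem t ht _ (h.mul_mem s hs t ht)))

/-- The cone induced by a maximal proper preordering on the quotient by its support. -/
def quotientCone (hT : Maximal (IsProperPreordering : Set B → Prop) T) :
    RingCone (B ⧸ supportIdeal hT) where
  carrier := {d | ∃ t ∈ T, Ideal.Quotient.mk _ t = d}
  add_mem' := by
    rintro _ _ ⟨s, hs, rfl⟩ ⟨t, ht, rfl⟩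
    exact ⟨_, hT.prop.add_mem s hs t ht, map_add _ _ _⟩
  mul_mem' := by
    rintro _ _ ⟨s, hs, rfl⟩ ⟨t, ht, rfl⟩
    exact ⟨_, hT.prop.mul_mem s hs t ht, map_mul _ _ _⟩
  zero_mem' := ⟨0, hT.prop.zero_mem, map_zero _⟩
  one_mem' := ⟨1, hT.prop.one_mem, map_one _⟩
  eq_zero_of_mem_of_neg_mem' := by
    rintro _ ⟨s, hs, rfl⟩ ⟨t, ht, e⟩
    rw [Ideal.Quotient.eq_zero_iff_mem]
    refine ⟨hs, ?_⟩
    have h : t + s ∈ supportIdeal hT := by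
      rw [← Ideal.Quotient.eq_zero_iff_mem, map_add, e, neg_add_cancel]
    simpa using hT.prop.add_mem _ h.2 t ht

end IsProperPreordering

/-- A linearly ordered field that is integral over `ℚ` is archimedean. -/
lemma archimedean_of_isIntegral_rat {D : Type*} [Field D] [LinearOrder D] [IsStrictOrderedRing D]
    (h : (algebraMap ℚ D).IsIntegral) : Archimedean D := by
  refine archimedean_iff_nat_le.2 fun d => ?_
  by_cases hd : d < 1
  · exact ⟨1, by simpa using hd.le⟩
  push Not at hd
  obtain ⟨p, hp, hpd⟩ := h d
  have h0 : p.natDegree ≠ 0 := by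
    intro h0
    rw [hp.natDegree_eq_zero.1 h0] at hpd
    simp at hpd
  obtain ⟨m, hm⟩ := Nat.exists_eq_succ_of_ne_zero h0
  rw [hp.as_sum, Polynomial.eval₂_add, Polynomial.eval₂_finsetSum] at hpd
  simp only [Polynomial.eval₂_pow, Polynomial.eval₂_X, Polynomial.eval₂_mul,
    Polynomial.eval₂_C, hm] at hpd
  obtain ⟨n, hn⟩ := exists_nat_ge (∑ i ∈ Finset.range m.succ, |p.coeff i|)
  refine ⟨n, ?_⟩
  have hdm : 0 < d ^ m := by positivity
  refine le_of_mul_le_mul_right ?_ hdm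
  calc d * d ^ m = d ^ m.succ := by rw [pow_succ']
    _ = ∑ i ∈ Finset.range m.succ, -(algebraMap ℚ D (p.coeff i) * d ^ i) := by
      rw [Finset.sum_neg_distrib]; linear_combination hpd
    _ ≤ ∑ i ∈ Finset.range m.succ, ((|p.coeff i| : ℚ) : D) * d ^ m := by
      refine Finset.sum_le_sum fun i hi => ?_
      have h1 : -algebraMap ℚ D (p.coeff i) ≤ ((|p.coeff i| : ℚ) : D) := by
        rw [eq_ratCast]; exact_mod_cast neg_le_abs _
      have h2 : d ^ i ≤ d ^ m := pow_le_pow_right₀ hd (by have := Finset.mem_range.1 hi; omega)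
      have h3 : (0 : D) ≤ ((|p.coeff i| : ℚ) : D) := by exact_mod_cast abs_nonneg _
      rw [← neg_mul]
      exact (mul_le_mul_of_nonneg_right h1 (by positivity)).trans
        (mul_le_mul_of_nonneg_left h2 h3)
    _ = ((∑ i ∈ Finset.range m.succ, |p.coeff i| : ℚ) : D) * d ^ m := by
      rw [← Finset.sum_mul]; push_cast; rfl
    _ ≤ n * d ^ m := by
      refine mul_le_mul_of_nonneg_right ?_ hdm.le
      exact_mod_cast hn

/-- Every proper preordering of a ring integral over `ℚ` is nonnegative under some real-valued
ring homomorphism. -/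
lemma IsProperPreordering.exists_ringHom_real {B : Type*} [CommRing B] {T : Set B}
    (hT : IsProperPreordering T) (i : ℚ →+* B) (hi : i.IsIntegral) :
    ∃ φ : B →+* ℝ, ∀ t ∈ T, 0 ≤ φ t := by
  classical
  obtain ⟨M, hTM, hM⟩ := hT.exists_maximal
  have := supportIdeal_isPrime hM
  let D := B ⧸ supportIdeal hM
  let j : ℚ →+* D := (Ideal.Quotient.mk _).comp i
  have hj : j.IsIntegral :=
    hi.trans _ _ (RingHom.isIntegral_of_surjective _ Ideal.Quotient.mk_surjective)
  have hfield : IsField D := by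
    let := j.toAlgebra
    have : Algebra.IsIntegral ℚ D := ⟨hj⟩
    exact isField_of_isIntegral_of_isField' (R := ℚ) (Field.toIsField ℚ)
  have : HasMemOrNegMem (quotientCone hM) := ⟨fun d => by
    obtain ⟨b, rfl⟩ := Ideal.Quotient.mk_surjective d
    rcases mem_or_neg_mem_of_maximal hM b with h | h
    · exact Or.inl ⟨b, h, rfl⟩
    · exact Or.inr ⟨-b, h, map_neg _ _⟩⟩
  let : LinearOrder D := LinearOrder.mkOfAddGroupCone (quotientCone hM)
  have : IsOrderedRing D := IsOrderedRing.mkOfCone (quotientCone hM)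
  have : IsStrictOrderedRing D := IsOrderedRing.toIsStrictOrderedRing D
  let : Field D := hfield.toField
  have : Archimedean D := by
    refine archimedean_of_isIntegral_rat ?_
    rwa [Subsingleton.elim (algebraMap ℚ D) j]
  obtain ⟨ψ⟩ := Real.nonemptyOrderRingHom D
  refine ⟨(ψ : D →+* ℝ).comp (Ideal.Quotient.mk _), fun t ht => ?_⟩
  have : (0 : D) ≤ Ideal.Quotient.mk _ t := by
    change _ ∈ quotientCone hM
    exact ⟨t, hTM ht, by simp⟩
  exact map_nonneg ψ this

/-- The embedding `j : R →+* ℝ` identifies `R` with the field of real algebraic numbers. -/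
def IsRealAlgebraicEmbedding {R : Type*} [Field R] (j : R →+* ℝ) : Prop :=
  ∀ z : ℝ, z ∈ j.range ↔ IsIntegral ℚ z

lemma exists_isRealAlgebraicEmbedding :
    ∃ (R : Type u) (_ : Field R) (j : R →+* ℝ), IsRealAlgebraicEmbedding j := by
  refine ⟨ULift.{u} (algebraicClosure ℚ ℝ), inferInstance,
    (algebraMap (algebraicClosure ℚ ℝ) ℝ).comp
      (ULift.ringEquiv : ULift.{u} (algebraicClosure ℚ ℝ) ≃+* _).toRingHom, fun z => ?_⟩
  rw [← mem_algebraicClosure_iff']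
  constructor
  · rintro ⟨r, rfl⟩
    exact r.down.2
  · exact fun hz => ⟨⟨⟨z, hz⟩⟩, rfl⟩

namespace IsRealAlgebraicEmbedding

variable {R : Type*} [Field R] {j : R →+* ℝ}

lemma exists_sq (hj : IsRealAlgebraicEmbedding j) {r : R} (hr : 0 ≤ j r) : ∃ s, s ^ 2 = r := by
  have h1 : IsIntegral ℚ (j r) := (hj _).1 ⟨r, rfl⟩
  have h2 : IsIntegral ℚ (√(j r)) := by
    refine IsIntegral.of_pow two_pos ?_
    rwa [Real.sq_sqrt hr]
  obtain ⟨s, hs⟩ := (hj _).2 h2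
  exact ⟨s, j.injective (by rw [map_pow, hs, Real.sq_sqrt hr])⟩

lemma ringHom_real_eq (hj : IsRealAlgebraicEmbedding j) (h : R →+* ℝ) : h = j := by
  have hle : ∀ q : ℚ, ∀ r : R, (q : ℝ) ≤ j r → (q : ℝ) ≤ h r := by
    intro q r hqr
    have hqj : ∀ g : R →+* ℝ, g (q : R) = q := fun g => map_ratCast g q
    obtain ⟨s, hs⟩ := hj.exists_sq (r := r - (q : R)) (by rw [map_sub, hqj]; linarith)
    have := sq_nonneg (h s)
    rw [← map_pow, hs, map_sub, hqj] at this
    linarith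
  have hle' : ∀ r : R, j r ≤ h r := fun r => by
    refine le_of_forall_rat_lt_imp_le fun q hq => hle q r hq.le
  ext r
  refine le_antisymm ?_ (hle' r)
  have := hle' (-r)
  simp only [map_neg] at this
  linarith

lemma ringHom_eq_id (hj : IsRealAlgebraicEmbedding j) (g : R →+* R) (r : R) : g r = r :=
  j.injective (DFunLike.congr_fun (hj.ringHom_real_eq (j.comp g)) r)

lemma exists_lift (hj : IsRealAlgebraicEmbedding j) {B : Type*} [CommRing B] (i : ℚ →+* B)
    (hi : i.IsIntegral) (φ : B →+* ℝ) : ∃ ψ : B →+* R, ∀ b, j (ψ b) = φ b := by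
  have hφ : ∀ b, φ b ∈ j.range := fun b => by
    obtain ⟨p, hp, hpb⟩ := hi b
    refine (hj _).2 ⟨p, hp, ?_⟩
    rw [Subsingleton.elim (algebraMap ℚ ℝ) (φ.comp i), ← Polynomial.hom_eval₂, hpb, map_zero]
  let e := RingEquiv.ofBijective j.rangeRestrict
    ⟨fun a b h => j.injective (congrArg Subtype.val h), j.rangeRestrict_surjective⟩
  refine ⟨e.symm.toRingHom.comp (φ.codRestrict j.range hφ), fun b => ?_⟩
  exact congrArg Subtype.val (e.apply_symm_apply (φ.codRestrict j.range hφ b))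

lemma isIntegral (hj : IsRealAlgebraicEmbedding j) (i : ℚ →+* R) : i.IsIntegral := by
  intro r
  obtain ⟨p, hp, hpr⟩ := (hj (j r)).1 ⟨r, rfl⟩
  refine ⟨p, hp, j.injective ?_⟩
  rw [Polynomial.hom_eval₂, map_zero, ← hpr]
  congr 1
  exact Subsingleton.elim _ _

end IsRealAlgebraicEmbedding

namespace LocallyConstant

variable {X : Type*} [TopologicalSpace X]

lemma isIntegral_of_isIntegral [CompactSpace X] {F : Type*} [Field F] {k : ℚ →+* F}
    (hk : k.IsIntegral) (i : ℚ →+* LocallyConstant X F) : i.IsIntegral := by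
  intro a
  choose p hp hpe using hk
  have hfin : (Set.range a).Finite := a.range_finite
  refine ⟨∏ v ∈ hfin.toFinset, p v, Polynomial.monic_prod_of_monic _ _ fun v _ => hp v, ?_⟩
  ext x
  have h := Polynomial.hom_eval₂ (∏ v ∈ hfin.toFinset, p v) i (evalRingHom x) a
  rw [evalRingHom_apply, Subsingleton.elim ((evalRingHom x).comp i) k, evalRingHom_apply] at h
  rw [h, Polynomial.eval₂_finsetProd]
  exact Finset.prod_eq_zero (i := a x) (by simp) (hpe _)

/-- The idempotent that is `1` exactly where `a` vanishes. -/
noncomputable def zeroIndicator {F : Type*} (G : Type*) [Zero F] [Zero G] [One G]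
    (a : LocallyConstant X F) : LocallyConstant X G := by
  classical exact a.map fun v => if v = 0 then 1 else 0

lemma zeroIndicator_apply {F G : Type*} [Zero F] [Zero G] [One G] [DecidableEq F]
    (a : LocallyConstant X F) (x : X) : a.zeroIndicator G x = if a x = 0 then 1 else 0 := by
  simp only [zeroIndicator, map_apply, Function.comp_apply]
  congr

lemma isEssentialExtension_mapRingHom {F G : Type*} [Field F] [Field G] (φ : F →+* G) :
    IsEssentialExtension (mapRingHom (X := X) φ) := by
  classical
  refine ⟨fun a b h => ?_, fun J hJ => ?_⟩
  · ext x
    exact φ.injective (congrArg (fun c : LocallyConstant X G => c x) h)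
  · obtain ⟨c, hc, hc0⟩ := Submodule.exists_mem_ne_zero_of_ne_bot hJ
    refine ⟨1 - c.zeroIndicator F, ?_, fun h => hc0 ?_⟩
    · have : mapRingHom φ (1 - c.zeroIndicator F) = c⁻¹ * c := by
        ext x
        change φ (1 - c.zeroIndicator F x) = (c x)⁻¹ * c x
        by_cases h : c x = 0 <;> simp [zeroIndicator_apply, h]
      rw [this]
      exact J.mul_mem_left _ hc
    · ext x
      have : φ (1 - c.zeroIndicator F x) = 0 :=
        congrArg (fun c : LocallyConstant X G => c x) h
      by_contra hx
      have hx' : c x ≠ 0 := hx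
      simp [zeroIndicator_apply, hx'] at this

variable {R : Type*} [Field R] {j : R →+* ℝ}

lemma isRealRing_of_ringHom_real (j : R →+* ℝ) : IsRealRing (LocallyConstant X R) := by
  intro n f hf i
  ext x
  have h := congrArg (fun c => j (evalRingHom x c)) hf
  simp only [map_sum, map_pow, map_zero] at h
  rw [Finset.sum_eq_zero_iff_of_nonneg fun i _ => sq_nonneg _] at h
  have := h i (Finset.mem_univ i)
  simpa using this

lemma exists_sq (hj : IsRealAlgebraicEmbedding j) {c : LocallyConstant X R}
    (hc : ∀ x, 0 ≤ j (c x)) : ∃ d, d ^ 2 = c := by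
  have : ∀ r : R, ∃ s, 0 ≤ j r → s ^ 2 = r := fun r => by
    by_cases hr : 0 ≤ j r
    · obtain ⟨s, hs⟩ := hj.exists_sq hr
      exact ⟨s, fun _ => hs⟩
    · exact ⟨0, fun h => absurd h hr⟩
  choose s hs using this
  refine ⟨c.map s, ?_⟩
  ext x
  exact hs _ (hc x)

lemma isPartialOrdering_nonneg (j : R →+* ℝ) :
    IsPartialOrdering {c : LocallyConstant X R | ∀ x, 0 ≤ j (c x)} := by
  refine ⟨fun a ha b hb x => ?_, fun a ha b hb x => ?_, fun a x => ?_, fun a ha ha' => ?_⟩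
  · simpa using add_nonneg (ha x) (hb x)
  · simpa using mul_nonneg (ha x) (hb x)
  · rw [pow_two, mul_apply, map_mul]
    exact mul_self_nonneg _
  · ext x
    have h1 := ha x
    have h2 := ha' x
    simp only [neg_apply, map_neg] at h2
    exact j.injective (by simp only [zero_apply, map_zero]; linarith)

/-- Pointwise nonnegativity is the only partial ordering of `LocallyConstant X R`. -/
lemma mem_iff_of_isPartialOrdering (hj : IsRealAlgebraicEmbedding j)
    {Q : Set (LocallyConstant X R)} (hQ : IsPartialOrdering Q) {c : LocallyConstant X R} :
    c ∈ Q ↔ ∀ x, 0 ≤ j (c x) := by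
  classical
  obtain ⟨-, hmul, hsq, hneg⟩ := hQ
  constructor
  · intro hc
    let e : LocallyConstant X R := c.map fun r => if 0 ≤ j r then 0 else 1
    have he : e ∈ Q := by
      have : e = e ^ 2 := by
        ext x
        by_cases h : 0 ≤ j (c x) <;> simp [e, h, pow_two]
      rw [this]
      exact hsq e
    obtain ⟨d, hd⟩ := exists_sq hj (c := -(e * c)) fun x => by
      by_cases h : 0 ≤ j (c x)
      · simp [e, h]
      · simpa [e, h] using (not_le.1 h).le
    have h0 := hneg _ (hmul e he c hc) (hd ▸ hsq d)
    intro x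
    by_contra h
    have := congrArg (fun c : LocallyConstant X R => c x) h0
    simp only [mul_apply, e, map_apply, Function.comp_apply, h, if_false, one_mul,
      zero_apply] at this
    simp [this] at h
  · intro hc
    obtain ⟨d, rfl⟩ := exists_sq hj hc
    exact hsq d

end LocallyConstant

/-- The sums of squares of a real ring form a partial ordering. -/
lemma IsRealRing.isPartialOrdering_isSumSq {D : Type*} [CommRing D] (hD : IsRealRing D) :
    IsPartialOrdering {d : D | IsSumSq d} := by
  have hrep : ∀ d : D, IsSumSq d → ∃ (n : ℕ) (f : Fin n → D), d = ∑ i, f i ^ 2 := by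
    intro d hd
    induction hd with
    | zero => exact ⟨0, Fin.elim0, by simp⟩
    | sq_add a _ ih =>
      obtain ⟨n, f, rfl⟩ := ih
      exact ⟨n + 1, Fin.cons a f, by simp [Fin.sum_univ_succ, pow_two]⟩
  refine ⟨fun a ha b hb => ha.add hb, fun a ha b hb => ha.mul hb, fun a => ?_, fun a ha ha' => ?_⟩
  · exact pow_two a ▸ IsSumSq.mul_self a
  · obtain ⟨n, f, rfl⟩ := hrep a ha
    obtain ⟨m, g, hg⟩ := hrep _ ha'
    have := hD (n + m) (Fin.append f g) (by simp [Fin.sum_univ_add, ← hg])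
    refine Finset.sum_eq_zero fun i _ => ?_
    have := this (Fin.castAdd m i)
    rw [Fin.append_left] at this
    simp [this]

section Embedding

variable {X K R B : Type*} [TopologicalSpace X] [Field K] [Field R] [CommRing B]

/-- A ring homomorphism out of a ring extension of `LocallyConstant X K`, extending evaluation at a
point at which idempotents can be chosen nonnegative. -/
lemma exists_ringHom_extending_eval [CompactSpace X] [T2Space X] [TotallyDisconnectedSpace X]
    {j : R →+* ℝ} (hj : IsRealAlgebraicEmbedding j)
    {y x : X} (hx : x ≠ y) {P₀ : Set K} (h0 : (0 : K) ∈ P₀) {s : K} (hs : s ∈ P₀)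
    {ι : K →+* R} (hι : ∀ φ : K →+* R, 0 ≤ j (φ s) → φ = ι)
    (i : ℚ →+* B) (hi : i.IsIntegral)
    {f : LocallyConstant X K →+* B} (hf : Function.Injective f)
    {Q : Set B} (hQ : IsPartialOrdering Q)
    (hmono : ∀ a : LocallyConstant X K, (∀ z ≠ y, a z ∈ P₀) → a y = 0 → f a ∈ Q) :
    ∃ φ : B →+* R, ∀ a, φ (f a) = ι (a x) := by
  classical
  obtain ⟨hadd, hmul, hsq, hneg⟩ := hQ
  have hidem : ∀ e : LocallyConstant X K, e * e = e → f e ∈ Q := fun e he => by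
    rw [← he, ← pow_two, map_pow]
    exact hsq _
  let T : Set B := {b | ∃ e : LocallyConstant X K, e * e = e ∧ e x = 1 ∧ f e * b ∈ Q}
  have hT : IsProperPreordering T := by
    refine ⟨?_, ?_, fun b => ⟨1, one_mul 1, rfl, by simpa using hsq b⟩, ?_⟩
    · rintro a ⟨e, he, hex, ha⟩ b ⟨e', he', hex', hb⟩
      refine ⟨e * e', by rw [mul_mul_mul_comm, he, he'], by simp [hex, hex'], ?_⟩
      have := hadd _ (hmul _ (hidem e' he') _ ha) _ (hmul _ (hidem e he) _ hb)
      convert this using 1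
      rw [map_mul]
      ring
    · rintro a ⟨e, he, hex, ha⟩ b ⟨e', he', hex', hb⟩
      refine ⟨e * e', by rw [mul_mul_mul_comm, he, he'], by simp [hex, hex'], ?_⟩
      convert hmul _ ha _ hb using 1
      rw [map_mul]
      ring
    · rintro ⟨e, he, hex, h⟩
      have := hneg _ (hidem e he) (by simpa using h)
      rw [map_eq_zero_iff f hf] at this
      simp [this] at hex
  obtain ⟨φ₀, hφ₀⟩ := hT.exists_ringHom_real i hi
  obtain ⟨φ, hφ⟩ := hj.exists_lift i hi φ₀
  have hφT : ∀ t ∈ T, 0 ≤ j (φ t) := fun t ht => (hφ t).symm ▸ hφ₀ t ht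
  have hzero : ∀ a : LocallyConstant X K, a x = 0 → φ (f a) = 0 := by
    intro a ha
    let e := a.zeroIndicator K
    have he : e * e = e := by
      ext z
      by_cases h : a z = 0 <;> simp [e, LocallyConstant.zeroIndicator_apply, h]
    have hex : e x = 1 := by simp [e, LocallyConstant.zeroIndicator_apply, ha]
    have hea : f e * f a = 0 := by
      rw [← map_mul, map_eq_zero_iff f hf]
      ext z
      by_cases h : a z = 0 <;> simp [e, LocallyConstant.zeroIndicator_apply, h]
    have hQ0 : (0 : B) ∈ Q := by simpa using hsq 0
    have h1 := hφT (f a) ⟨e, he, hex, by rwa [hea]⟩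
    have h2 := hφT (-f a) ⟨e, he, hex, by rwa [mul_neg, hea, neg_zero]⟩
    simp only [map_neg] at h2
    exact j.injective (by rw [map_zero]; linarith)
  have hconst : (φ.comp f).comp LocallyConstant.constRingHom = ι := by
    refine hι _ (hφT (f (LocallyConstant.const X s)) ?_)
    obtain ⟨U, hU, hxU, hUy⟩ := compact_exists_isClopen_in_isOpen
      (isOpen_compl_singleton (x := y)) (show x ∈ ({y} : Set X)ᶜ from hx)
    have hyU : y ∉ U := fun h => hUy h rfl
    refine ⟨LocallyConstant.charFn K hU, ?_, (LocallyConstant.charFn_eq_one K x hU).2 hxU, ?_⟩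
    · ext z
      by_cases h : z ∈ U <;> simp [LocallyConstant.coe_charFn, h]
    · rw [← map_mul]
      refine hmono _ (fun z _ => ?_) (by simp [LocallyConstant.coe_charFn, hyU])
      by_cases h : z ∈ U <;> simp [LocallyConstant.coe_charFn, h, h0, hs]
  refine ⟨φ, fun a => ?_⟩
  have h1 := hzero (a - LocallyConstant.const X (a x)) (sub_self _)
  rw [map_sub, map_sub, sub_eq_zero] at h1
  rw [h1]
  exact DFunLike.congr_fun hconst (a x)

end Embedding

section Section

variable {X K R B : Type u} [TopologicalSpace X] [CompactSpace X] [T2Space X]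
  [ExtremallyDisconnected X] [Field K] [Field R] [CommRing B]

/-- Homomorphisms extending evaluation at the points of a dense set can be chosen to vary locally
constantly, by projectivity of extremally disconnected spaces. -/
lemma exists_ringHom_locallyConstant (ι : K →+* R) (k : ℚ →+* R)
    (i : ℚ →+* B) (hi : i.IsIntegral) (f : LocallyConstant X K →+* B) {D : Set X} (hD : Dense D)
    (h : ∀ x ∈ D, ∃ φ : B →+* R, ∀ a, φ (f a) = ι (a x)) :
    ∃ g : B →+* LocallyConstant X R, ∀ a, g (f a) = LocallyConstant.mapRingHom ι a := by
  classical
  let _ : TopologicalSpace R := ⊥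
  have : DiscreteTopology R := ⟨rfl⟩
  let S : Set (X × (B → R)) := {p | (p.2 1 = 1 ∧ p.2 0 = 0) ∧
    (∀ b c, p.2 (b * c) = p.2 b * p.2 c) ∧ (∀ b c, p.2 (b + c) = p.2 b + p.2 c) ∧
    ∀ a, p.2 (f a) = ι (a p.1)}
  have hev : ∀ b : B, Continuous fun p : X × (B → R) => p.2 b := fun b => by fun_prop
  have hSclosed : IsClosed S := by
    refine ((isClosed_eq (hev _) continuous_const).inter
      (isClosed_eq (hev _) continuous_const)).inter (IsClosed.inter (s₁ := {p | _}) ?_ (IsClosed.inter (s₁ := {p | _}) (s₂ := {p | _}) ?_ ?_))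
    · simp only [Set.ofPred_forall]
      exact isClosed_iInter fun b => isClosed_iInter fun c =>
        isClosed_eq (hev _) ((hev b).mul (hev c))
    · simp only [Set.ofPred_forall]
      exact isClosed_iInter fun b => isClosed_iInter fun c =>
        isClosed_eq (hev _) ((hev b).add (hev c))
    · simp only [Set.ofPred_forall]
      exact isClosed_iInter fun a => isClosed_eq (hev _)
        ((a.map ι).continuous.comp continuous_fst)
  let toHom : S → B →+* R := fun p =>
    { toFun := p.1.2
      map_one' := p.2.1.1
      map_zero' := p.2.1.2
      map_mul' := p.2.2.1
      map_add' := p.2.2.2.1 }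
  choose q hq hqe using hi
  let F : B → Set R := fun b => {r | r ∈ ((q b).map k).roots}
  have hScompact : IsCompact S := by
    refine IsCompact.of_isClosed_subset (isCompact_univ.prod (isCompact_univ_pi
      (s := F) fun b => ?_)) hSclosed fun p hp => ⟨trivial, fun b _ => ?_⟩
    · exact ((q b).map k).roots.finite_toSet.isCompact
    · change p.2 b ∈ ((q b).map k).roots
      rw [Polynomial.mem_roots ((hq b).map k).ne_zero, Polynomial.IsRoot, Polynomial.eval_map]
      have := Polynomial.hom_eval₂ (q b) i (toHom ⟨p, hp⟩) b
      rw [hqe, map_zero, Subsingleton.elim ((toHom ⟨p, hp⟩).comp i) k] at this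
      exact this.symm
  have : CompactSpace S := isCompact_iff_compactSpace.1 hScompact
  let π : S → X := fun p => p.1.1
  have hπ : Continuous π := continuous_fst.comp continuous_subtype_val
  have hsurj : Function.Surjective π := by
    have hcl : IsClosed (Set.range π) := (isCompact_range hπ).isClosed
    have hsub : D ⊆ Set.range π := fun x hx => by
      obtain ⟨φ, hφ⟩ := h x hx
      exact ⟨⟨(x, φ), ⟨map_one φ, map_zero φ⟩, map_mul φ, map_add φ, hφ⟩, rfl⟩
    have := hD.mono hsub
    rw [← Set.range_eq_univ, ← hcl.closure_eq, this.closure_eq]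
  obtain ⟨σ, hσ, hσπ⟩ := CompactT2.ExtremallyDisconnected.projective
    (f := (id : X → X)) continuous_id hπ hsurj
  refine ⟨
    { toFun := fun b => ⟨fun x => toHom (σ x) b, (IsLocallyConstant.iff_continuous _).2
        ((hev b).comp (continuous_subtype_val.comp hσ))⟩
      map_one' := ?_
      map_zero' := ?_
      map_mul' := fun b c => ?_
      map_add' := fun b c => ?_ }, fun a => ?_⟩
  · ext x; exact map_one (toHom (σ x))
  · ext x; exact map_mul (toHom (σ x)) b c
  · ext x; exact map_zero (toHom (σ x))
  · ext x; exact map_add (toHom (σ x)) b c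
  · ext x
    have h1 : toHom (σ x) (f a) = ι (a (π (σ x))) := (σ x).2.2.2.2 a
    rw [show π (σ x) = x from congrFun hσπ x] at h1
    exact h1

end Section

lemma isProperPreordering_of_isTotalOrderingCone {K : Type*} [Field K] {P₀ : Set K}
    (hP₀ : IsTotalOrderingCone P₀) : IsProperPreordering P₀ := by
  obtain ⟨hadd, hmul, htot, hneg⟩ := hP₀
  have hsq : ∀ a : K, a ^ 2 ∈ P₀ := fun a => by
    rcases htot a with h | h
    · exact pow_two a ▸ hmul a h a h
    · simpa [pow_two] using hmul _ h _ h
  refine ⟨hadd, hmul, hsq, fun h => ?_⟩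
  exact one_ne_zero (hneg 1 (by simpa using hsq 1) h)

lemma isIntegral_of_forall_eq_add_mul {K : Type*} [Field K] [CharZero K] {s : K}
    (hs : s ^ 2 = 2) (hgen : ∀ x : K, ∃ a b : ℚ, x = (a : K) + (b : K) * s) :
    (algebraMap ℚ K).IsIntegral := by
  have hrat : ∀ q : ℚ, IsIntegral ℚ (q : K) := fun q => by
    rw [← eq_ratCast (algebraMap ℚ K) q]
    exact isIntegral_algebraMap
  have hsi : IsIntegral ℚ s := IsIntegral.of_pow two_pos (by rw [hs]; exact_mod_cast hrat 2)
  intro x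
  obtain ⟨a, b, rfl⟩ := hgen x
  exact (hrat a).add ((hrat b).mul hsi)

lemma exists_unique_embedding_of_sqrt_two {K R : Type*} [Field K] [CharZero K] [Field R]
    {j : R →+* ℝ} (hj : IsRealAlgebraicEmbedding j) {s : K} (hs : s ^ 2 = 2)
    (hgen : ∀ x : K, ∃ a b : ℚ, x = (a : K) + (b : K) * s) {P₀ : Set K}
    (hP₀ : IsTotalOrderingCone P₀) (hs₀ : s ∈ P₀) :
    ∃ ι : K →+* R, (∀ p ∈ P₀, 0 ≤ j (ι p)) ∧ ∀ φ : K →+* R, 0 ≤ j (φ s) → φ = ι := by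
  have hint := isIntegral_of_forall_eq_add_mul hs hgen
  obtain ⟨φ₀, hφ₀⟩ :=
    (isProperPreordering_of_isTotalOrderingCone hP₀).exists_ringHom_real _ hint
  obtain ⟨ι, hι⟩ := hj.exists_lift _ hint φ₀
  have hιP : ∀ p ∈ P₀, 0 ≤ j (ι p) := fun p hp => (hι p).symm ▸ hφ₀ p hp
  refine ⟨ι, hιP, fun φ hφ => ?_⟩
  have hsq : ∀ ψ : K →+* R, j (ψ s) ^ 2 = 2 := fun ψ => by
    rw [← map_pow, ← map_pow, hs, map_ofNat, map_ofNat]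
  have hφs : φ s = ι s := j.injective <|
    (pow_left_inj₀ hφ (hιP s hs₀) two_ne_zero).1 ((hsq φ).trans (hsq ι).symm)
  ext x
  obtain ⟨a, b, rfl⟩ := hgen x
  have hrat : ∀ q : ℚ, φ (q : K) = ι (q : K) := fun q =>
    DFunLike.congr_fun (Subsingleton.elim (φ.comp (algebraMap ℚ K)) (ι.comp (algebraMap ℚ K))) q
  simp only [map_add, map_mul, hφs, hrat]

section Closure

variable {X K R : Type u} [TopologicalSpace X] [Field K] [Field R] {j : R →+* ℝ}

lemma LocallyConstant.nonneg_of_mem_examplePos {y : X} {P₀ : Set K} {ι : K →+* R}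
    (hι : ∀ p ∈ P₀, 0 ≤ j (ι p)) {a : LocallyConstant X K} (ha : a ∈ examplePos X K y P₀)
    (x : X) : 0 ≤ j (mapRingHom ι a x) := by
  change 0 ≤ j (ι (a x))
  by_cases hx : x = y
  · obtain ⟨n, g, hg⟩ := ha.2
    rw [hx, hg]
    simp only [map_sum, map_pow]
    exact Finset.sum_nonneg fun i _ => sq_nonneg _
  · exact hι _ (ha.1 x hx)

/-- An endomorphism of `LocallyConstant X R` fixing the image of `LocallyConstant X K` is the
identity. -/
lemma LocallyConstant.comp_eq_id (hj : IsRealAlgebraicEmbedding j) {ι : K →+* R}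
    (g : LocallyConstant X R →+* LocallyConstant X R)
    (hg : ∀ a, g (mapRingHom ι a) = mapRingHom ι a) (c : LocallyConstant X R) : g c = c := by
  classical
  ext x
  let r := c x
  let e : LocallyConstant X K := (c - const X r).zeroIndicator K
  have he : mapRingHom ι e * c = mapRingHom ι e * const X r := by
    ext z
    change ι (e z) * c z = ι (e z) * r
    by_cases hz : (c - const X r) z = 0
    · rw [sub_eq_zero.1 (show c z - r = 0 from hz)]
    · simp [e, zeroIndicator_apply, hz]
  have h := congrArg (fun d => evalRingHom x (g d)) he
  have hex : evalRingHom x (mapRingHom ι e) = 1 := by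
    change ι (e x) = 1
    have : (c - const X r) x = 0 := sub_self _
    simp [e, zeroIndicator_apply, this]
  simp only [map_mul, hg, hex, one_mul] at h
  exact h.trans (hj.ringHom_eq_id (((evalRingHom x).comp g).comp constRingHom) r)

variable [CompactSpace X] [T2Space X] [TotallyDisconnectedSpace X] [ExtremallyDisconnected X]

/-- Every integral extension of the example poring maps to `LocallyConstant X R`. -/
lemma exists_ringHom_of_examplePos_subset [CharZero K] (hj : IsRealAlgebraicEmbedding j)
    {y : X} (hy : ¬ IsOpen ({y} : Set X)) {P₀ : Set K} (h0 : (0 : K) ∈ P₀) {s : K} (hs : s ∈ P₀)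
    {ι : K →+* R} (hι : ∀ φ : K →+* R, 0 ≤ j (φ s) → φ = ι)
    (hK : (algebraMap ℚ K).IsIntegral) {B : Type u} [CommRing B]
    {f : LocallyConstant X K →+* B} (hf : Function.Injective f) (hfi : f.IsIntegral)
    {Q : Set B} (hQ : IsPartialOrdering Q) (hmono : ∀ a ∈ examplePos X K y P₀, f a ∈ Q) :
    ∃ g : B →+* LocallyConstant X R, ∀ a, g (f a) = LocallyConstant.mapRingHom ι a := by
  have hi : (f.comp (algebraMap ℚ (LocallyConstant X K))).IsIntegral :=
    (LocallyConstant.isIntegral_of_isIntegral hK _).trans _ _ hfi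
  refine exists_ringHom_locallyConstant ι (ι.comp (algebraMap ℚ K)) _ hi f
    (D := {y}ᶜ) (dense_compl_singleton_iff_not_open.2 hy) fun x hx => ?_
  exact exists_ringHom_extending_eval hj hx h0 hs hι _ hi hf hQ fun a ha hay =>
    hmono a ⟨ha, 0, Fin.elim0, by simpa using hay⟩

lemma LocallyConstant.isRealClosedStar [CharZero K] (hj : IsRealAlgebraicEmbedding j)
    {y : X} (hy : ¬ IsOpen ({y} : Set X)) {P₀ : Set K} (h0 : (0 : K) ∈ P₀) {s : K} (hs : s ∈ P₀)
    {ι : K →+* R} (hιP : ∀ p ∈ P₀, 0 ≤ j (ι p)) (hι : ∀ φ : K →+* R, 0 ≤ j (φ s) → φ = ι)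
    (hK : (algebraMap ℚ K).IsIntegral) : IsRealClosedStar (LocallyConstant X R) := by
  refine ⟨isRealRing_of_ringHom_real j, fun D _ g hD hess hint => ?_⟩
  have hιint : (mapRingHom (X := X) ι).IsIntegral :=
    RingHom.IsIntegral.tower_top (algebraMap ℚ (LocallyConstant X K)) _
      (isIntegral_of_isIntegral (hj.isIntegral (ι.comp (algebraMap ℚ K))) _)
  obtain ⟨h, hh⟩ := exists_ringHom_of_examplePos_subset hj hy h0 hs hι hK
    (f := g.comp (mapRingHom ι))
    (hess.1.comp (isEssentialExtension_mapRingHom ι).1) (hιint.trans _ _ hint)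
    hD.isPartialOrdering_isSumSq fun a ha => by
      obtain ⟨d, hd⟩ := exists_sq hj (nonneg_of_mem_examplePos hιP ha)
      change IsSumSq (g (mapRingHom ι a))
      rw [← hd, map_pow, pow_two]
      exact IsSumSq.mul_self _
  have hid : ∀ c, h (g c) = c := comp_eq_id hj (h.comp g) hh
  have hinj : Function.Injective h := by
    rw [RingHom.injective_iff_ker_eq_bot]
    by_contra hker
    obtain ⟨c, hc, hc0⟩ := hess.2 _ hker
    rw [RingHom.mem_ker, hid] at hc
    exact hc0 (by rw [hc, map_zero])
  exact fun d => ⟨h d, hinj (hid (h d))⟩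

/-- Every real closure * of the example poring is `LocallyConstant X R`, ordered pointwise. -/
lemma IsRealClosureStarOf.exists_ringEquiv [CharZero K] (hj : IsRealAlgebraicEmbedding j)
    {y : X} (hy : ¬ IsOpen ({y} : Set X)) {P₀ : Set K} (h0 : (0 : K) ∈ P₀) {s : K} (hs : s ∈ P₀)
    {ι : K →+* R} (hι : ∀ φ : K →+* R, 0 ≤ j (φ s) → φ = ι)
    (hK : (algebraMap ℚ K).IsIntegral) {B : Type u} [CommRing B] {Q : Set B}
    {f : LocallyConstant X K →+* B}
    (hB : IsRealClosureStarOf (LocallyConstant X K) (examplePos X K y P₀) B Q f) :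
    ∃ e : B ≃+* LocallyConstant X R, (∀ a, e (f a) = LocallyConstant.mapRingHom ι a) ∧
      ∀ b, b ∈ Q ↔ ∀ x, 0 ≤ j (e b x) := by
  obtain ⟨g, hg⟩ := exists_ringHom_of_examplePos_subset hj hy h0 hs hι hK hB.essential.1
    hB.integral hB.pos_partial hB.mono
  have hess := LocallyConstant.isEssentialExtension_mapRingHom (X := X) ι
  have hinj : Function.Injective g := by
    rw [RingHom.injective_iff_ker_eq_bot]
    by_contra hker
    obtain ⟨a, ha, ha0⟩ := hB.essential.2 _ hker
    rw [RingHom.mem_ker, hg, map_eq_zero_iff _ hess.1] at ha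
    exact ha0 (by rw [ha, map_zero])
  have hgess : IsEssentialExtension g := by
    refine ⟨hinj, fun J hJ => ?_⟩
    obtain ⟨a, ha, ha0⟩ := hess.2 J hJ
    exact ⟨f a, by rwa [hg], by rwa [hg]⟩
  have hgint : g.IsIntegral :=
    RingHom.IsIntegral.tower_top (f.comp (algebraMap ℚ (LocallyConstant X K))) _
      (LocallyConstant.isIntegral_of_isIntegral (hj.isIntegral (ι.comp (algebraMap ℚ K))) _)
  have hsurj := hB.rcs.2 _ g (LocallyConstant.isRealRing_of_ringHom_real j) hgess hgint
  let e := RingEquiv.ofBijective g ⟨hinj, hsurj⟩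
  refine ⟨e, hg, fun b => ?_⟩
  have hQ : IsPartialOrdering {c : LocallyConstant X R | e.symm c ∈ Q} := by
    obtain ⟨hadd, hmul, hsq, hneg⟩ := hB.pos_partial
    refine ⟨fun a ha b hb => ?_, fun a ha b hb => ?_, fun a => ?_, fun a ha ha' => ?_⟩
    · simpa using hadd _ ha _ hb
    · simpa using hmul _ ha _ hb
    · simpa using hsq (e.symm a)
    · simpa using hneg _ ha (by simpa using ha')
  rw [← LocallyConstant.mem_iff_of_isPartialOrdering hj hQ]
  simp

end Closure

/-- Let `X` be an extremally disconnected Boolean space with a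
non-isolated point `y`, let `K = ℚ(√2)`, let `P₀` be the total ordering of `K` with
`√2 ∈ P₀`, let `A` be the ring of locally constant functions `X → K`, and let
`A⁺ = {f ∈ A : f x ∈ P₀ for all x ≠ y, and f y ∈ ΣK²}`.  Then the poring `(A, A⁺)` has a
unique real closure *.  (In particular, there are von Neumann regular porings with unique
real closure * which are not f-rings.) -/
theorem examplePoring_hasUniqueRealClosureStar
    (X : Type u) [TopologicalSpace X] [CompactSpace X] [T2Space X]
    [TotallyDisconnectedSpace X] [ExtremallyDisconnected X]
    (y : X) (hy : ¬ IsOpen ({y} : Set X))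
    (K : Type u) [Field K] [CharZero K]
    (sqrt2 : K) (hsqrt2 : sqrt2 ^ 2 = 2)
    (hgen : ∀ x : K, ∃ a b : ℚ, x = (a : K) + (b : K) * sqrt2)
    (P₀ : Set K) (hP₀ : IsTotalOrderingCone P₀) (hs₀ : sqrt2 ∈ P₀) :
    HasUniqueRealClosureStar (LocallyConstant X K) (examplePos X K y P₀) := by

  obtain ⟨R, _, j, hj⟩ := exists_isRealAlgebraicEmbedding.{u}
  obtain ⟨ι, hιP, hι⟩ := exists_unique_embedding_of_sqrt_two hj hsqrt2 hgen hP₀ hs₀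
  have hK := isIntegral_of_forall_eq_add_mul hsqrt2 hgen
  have h0 := (isProperPreordering_of_isTotalOrderingCone hP₀).zero_mem
  refine ⟨⟨⟨LocallyConstant X R, {c | ∀ x, 0 ≤ j (c x)}, LocallyConstant.mapRingHom ι,
    LocallyConstant.isPartialOrdering_nonneg j,
    LocallyConstant.isRealClosedStar hj hy h0 hs₀ hιP hι hK,
    LocallyConstant.isEssentialExtension_mapRingHom ι,
    RingHom.IsIntegral.tower_top (algebraMap ℚ (LocallyConstant X K)) _
      (LocallyConstant.isIntegral_of_isIntegral (hj.isIntegral (ι.comp (algebraMap ℚ K))) _),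
    fun a ha => LocallyConstant.nonneg_of_mem_examplePos hιP ha⟩⟩, fun B C => ?_⟩
  obtain ⟨e, he, hepos⟩ := B.is.exists_ringEquiv hj hy h0 hs₀ hι hK
  obtain ⟨e', he', hepos'⟩ := C.is.exists_ringEquiv hj hy h0 hs₀ hι hK
  refine ⟨e.trans e'.symm, fun a => ?_, fun b => ?_⟩
  · rw [RingEquiv.trans_apply, he, ← he', RingEquiv.symm_apply_apply]
  · rw [RingEquiv.trans_apply, hepos, hepos', RingEquiv.apply_symm_apply]
end
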